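/- Let (u_p)_{p>1} be a family of low energy nodal solutions of (P_p) with concentration points x⁺, x⁻ ∈ Ω, x⁺ ≠ x⁻. Then J_p(u_p) = 8πe/p + (8πe/p²)(−2 log p + 6 log 2 − 3) + (32π²e/p²)Ψ(x*) + o(1/p²) as p → ∞, where x* = (x⁺, x⁻). -/

import Mathlib

open Real MeasureTheory Metric Filter Topology Bornology

noncomputable section

abbrev E2 : Type := EuclideanSpace ℝ (Fin 2)

/-- Laplacian of `u : ℝ² → ℝ` via coordinate second derivatives. -/
def lap (u : E2 → ℝ) (x : E2) : ℝ :=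
  ∑ i : Fin 2,
    fderiv ℝ (fun y => fderiv ℝ u y (EuclideanSpace.single i 1)) x (EuclideanSpace.single i 1)

/-- `u` is a (classical) solution of the Lane–Emden problem `(P_p)` on `Ω`. -/
def IsSolution (Ω : Set E2) (p : ℝ) (u : E2 → ℝ) : Prop :=
  ContDiffOn ℝ 2 u Ω ∧ ContinuousOn u (closure Ω) ∧
    (∀ x ∈ Ω, -lap u x = |u x| ^ (p - 1) * u x) ∧
    (∀ x ∈ frontier Ω, u x = 0)

/-- `u` is a nodal (sign-changing) function on `Ω`. -/
def IsNodal (Ω : Set E2) (u : E2 → ℝ) : Prop :=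
  (∃ x ∈ Ω, 0 < u x) ∧ (∃ x ∈ Ω, u x < 0)

/-- The Green function of `-Δ` on `Ω` with Dirichlet boundary conditions, together with
its regular part `H`, so that `G(x,y) = -(1/2π) log|x-y| + H(x,y)`. -/
structure GreenData (Ω : Set E2) where
  G : E2 → E2 → ℝ
  H : E2 → E2 → ℝ
  decomp : ∀ x y, G x y = -(1 / (2 * π)) * Real.log ‖x - y‖ + H x y
  bdry : ∀ x ∈ Ω, ∀ y ∈ frontier Ω, G x y = 0
  symm : ∀ x y, G x y = G y x
  smoothH : ContDiffOn ℝ (⊤ : ℕ∞) (fun q : E2 × E2 => H q.1 q.2) (Ω ×ˢ Ω)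
  contH : ∀ x ∈ Ω, ContinuousOn (H x) (closure Ω)
  harmH : ∀ x ∈ Ω, ∀ y ∈ Ω, lap (H x) y = 0

/-- The Kirchhoff–Routh type function `Ψ(a₁,a₂) = 2G(a₁,a₂) − R(a₁) − R(a₂)`. -/
def KR {Ω : Set E2} (gd : GreenData Ω) (q : E2 × E2) : ℝ :=
  2 * gd.G q.1 q.2 - gd.H q.1 q.1 - gd.H q.2 q.2

/-- `q` is a non-degenerate critical point of `F`. -/
def NondegCrit (F : E2 × E2 → ℝ) (q : E2 × E2) : Prop :=
  fderiv ℝ F q = 0 ∧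
    ∀ v : E2 × E2, (∀ w : E2 × E2, fderiv ℝ (fun r => fderiv ℝ F r) q v w = 0) → v = 0

/-- Convergence in `C²_loc(S)`: uniform convergence of all derivatives of order `≤ 2`
on compact subsets of `S`. -/
def TendstoC2LocOn (S : Set E2) (F : ℕ → E2 → ℝ) (g : E2 → ℝ) : Prop :=
  ∀ K : Set E2, K ⊆ S → IsCompact K → ∀ k : ℕ, k ≤ 2 →
    TendstoUniformlyOn (fun n x => iteratedFDeriv ℝ k (F n) x)
      (fun x => iteratedFDeriv ℝ k g x) atTop K

/-- `‖u⁺‖_∞` on `closure Ω`. -/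
def supPos (Ω : Set E2) (u : E2 → ℝ) : ℝ := sSup ((fun x => max (u x) 0) '' closure Ω)

/-- `‖u⁻‖_∞` on `closure Ω`. -/
def supNeg (Ω : Set E2) (u : E2 → ℝ) : ℝ := sSup ((fun x => max (-u x) 0) '' closure Ω)

/-- The energy functional `J_p`. -/
def energy (Ω : Set E2) (p : ℝ) (u : E2 → ℝ) : ℝ :=
  (1 / 2) * (∫ x in Ω, ‖fderiv ℝ u x‖ ^ 2) - (1 / (p + 1)) * ∫ x in Ω, |u x| ^ (p + 1)

/-- The standard bubble `U(z) = −2 log(1 + |z|²/8)`. -/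
def Ustd (z : E2) : ℝ := -2 * Real.log (1 + ‖z‖ ^ 2 / 8)

/-- Unit vector at angle `θ`. -/
def circDir (θ : ℝ) : E2 :=
  EuclideanSpace.single 0 (Real.cos θ) + EuclideanSpace.single 1 (Real.sin θ)

/-- Surface integral over the circle `∂B_r(c)`; the integrand may depend on the
outer unit normal (first argument) and on the point (second argument). -/
def surfInt (c : E2) (r : ℝ) (F : E2 → E2 → ℝ) : ℝ :=
  ∫ θ in (0:ℝ)..(2 * π), r * F (circDir θ) (c + r • circDir θ)

/-- Inner product of gradients `⟨∇f, ∇g⟩`. -/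
def gradInner (f g : E2 → ℝ) (x : E2) : ℝ :=
  ∑ j : Fin 2, fderiv ℝ f x (EuclideanSpace.single j 1) *
    fderiv ℝ g x (EuclideanSpace.single j 1)

/-- The quadratic form `P_i` (centred at `c`, radius `r`). -/
def Pform (c : E2) (r : ℝ) (f g : E2 → ℝ) : ℝ :=
  -2 * r * surfInt c r (fun ν x => fderiv ℝ f x ν * fderiv ℝ g x ν) +
    r * surfInt c r (fun _ x => gradInner f g x)

/-- The quadratic form `Q_{ij}` (centred at `c`, radius `r`). -/
def Qform (c : E2) (r : ℝ) (j : Fin 2) (f g : E2 → ℝ) : ℝ :=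
  surfInt c r (fun ν x =>
    -(fderiv ℝ f x (EuclideanSpace.single j 1)) * fderiv ℝ g x ν -
      fderiv ℝ f x ν * fderiv ℝ g x (EuclideanSpace.single j 1) +
      gradInner f g x * ν j)

/-- Master singular kernel `|y|^{-3/2}` on the unit ball. -/
def sker (y : ℂ) : ℝ := if ‖y‖ < 1 then (‖y‖ * √‖y‖)⁻¹ else 0

lemma ker_nonneg (y : ℂ) : 0 ≤ sker y := by
  unfold sker; split_ifs <;> positivity

lemma ker_integrable : Integrable sker := by
  have h := integrable_fun_norm_addHaar (volume : Measure ℂ)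
    (f := fun t : ℝ => if t < 1 then (t * √t)⁻¹ else 0)
  have : (fun y : ℂ => (fun t : ℝ => if t < 1 then (t * √t)⁻¹ else 0) ‖y‖) = sker := rfl
  rw [← this, h]
  have h2 : IntegrableOn (fun t : ℝ => t ^ (-(1/2) : ℝ)) (Set.Ioo 0 1) := by
    rw [intervalIntegral.integrableOn_Ioo_rpow_iff (by norm_num)]; norm_num
  have h3 : Integrable ((Set.Ioo (0:ℝ) 1).indicator (fun t : ℝ => t ^ (-(1/2) : ℝ))) := by
    rwa [integrable_indicator_iff measurableSet_Ioo]
  refine (h3.integrableOn (s := Set.Ioi 0)).congr_fun ?_ measurableSet_Ioi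
  intro t ht
  have ht : 0 < t := ht
  by_cases h1 : t < 1
  · simp only [Set.indicator, Set.mem_Ioo, ht, h1, and_self, if_true, Complex.finrank_real_complex]
    rw [Real.rpow_neg ht.le, ← Real.sqrt_eq_rpow]
    simp; field_simp
  · simp [Set.indicator, h1]

def cK : ℝ := ∫ y, sker y

lemma cK_nonneg : 0 ≤ cK := integral_nonneg ker_nonneg

lemma ker_ge_32 {y : ℂ} : (‖y‖ * √‖y‖)⁻¹ ≤ sker y + 1 := by
  unfold sker
  split_ifs with h
  · linarith
  · push Not at h
    have : 1 ≤ √‖y‖ := by rw [Real.one_le_sqrt]; exact h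
    rw [zero_add]
    apply inv_le_one_of_one_le₀
    nlinarith

lemma ker_ge_1 {y : ℂ} : ‖y‖⁻¹ ≤ sker y + 1 := by
  by_cases hy : ‖y‖ = 0
  · rw [hy]; simp; linarith [ker_nonneg y]
  have hy : 0 < ‖y‖ := by positivity
  unfold sker
  split_ifs with h
  · have : √‖y‖ ≤ 1 := by exact Real.sqrt_le_one.2 h.le
    have : ‖y‖⁻¹ ≤ (‖y‖ * √‖y‖)⁻¹ := by
      apply inv_anti₀ (by positivity); nlinarith
    linarith
  · push Not at h
    rw [zero_add]; exact inv_le_one_of_one_le₀ h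

lemma ker_ge_log {y : ℂ} (h : ‖y‖ < 1) : |Real.log ‖y‖| ≤ sker y := by
  by_cases hy : ‖y‖ = 0
  · rw [hy]; simp; exact ker_nonneg y
  have hy : 0 < ‖y‖ := by positivity
  have h1 : |Real.log ‖y‖| = Real.log (‖y‖⁻¹) := by
    rw [Real.log_inv, abs_of_neg (Real.log_neg hy h)]
  have h2 := Real.log_le_self (x := ‖y‖⁻¹) (by positivity)
  have h3 : ‖y‖⁻¹ ≤ sker y := by
    unfold sker
    rw [if_pos h]
    have : √‖y‖ ≤ 1 := by exact Real.sqrt_le_one.2 h.le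
    apply inv_anti₀ (by positivity); nlinarith
  linarith

lemma ker_meas : Measurable sker := by
  unfold sker
  exact Measurable.ite (measurableSet_lt measurable_norm measurable_const) (by fun_prop) (by fun_prop)

lemma ker_shift_integrable (z : ℂ) : Integrable (fun ζ => sker (z - ζ)) :=
  ker_integrable.comp_sub_left z

lemma ker_shift_int (z : ℂ) : ∫ ζ, sker (z - ζ) = cK := integral_sub_left_eq_self sker volume z

/-- A bounded integrable density. -/
structure Dens {F : Type*} [NormedAddCommGroup F] (ρ : ℂ → F) (B K : ℝ) : Prop where
  int : Integrable ρ
  bd : ∀ ζ, ‖ρ ζ‖ ≤ B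
  mass : ∫ ζ, ‖ρ ζ‖ ≤ K

section
variable {F : Type*} [NormedAddCommGroup F] {ρ : ℂ → F} {B K : ℝ}

lemma Dens.B_nonneg (h : Dens ρ B K) : 0 ≤ B := (norm_nonneg _).trans (h.bd 0)
lemma Dens.K_nonneg (h : Dens ρ B K) : 0 ≤ K := (integral_nonneg fun _ => norm_nonneg _).trans h.mass
lemma Dens.c_nonneg (h : Dens ρ B K) : 0 ≤ B * cK + K := by
  have := h.B_nonneg; have := h.K_nonneg; have := cK_nonneg; positivity

lemma Dens.ker_int (h : Dens ρ B K) (z : ℂ) : Integrable (fun ζ => sker (z - ζ) * ‖ρ ζ‖) := by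
  refine Integrable.mono' ((ker_shift_integrable z).mul_const B) ?_ ?_
  · exact ((ker_meas.comp (measurable_const.sub measurable_id)).aestronglyMeasurable).mul
      h.int.1.norm
  · refine ae_of_all _ fun ζ => ?_
    rw [Real.norm_eq_abs, abs_mul, abs_norm, abs_of_nonneg (ker_nonneg _)]
    exact mul_le_mul_of_nonneg_left (h.bd ζ) (ker_nonneg _)

lemma Dens.dom_int (h : Dens ρ B K) (z : ℂ) : Integrable (fun ζ => (sker (z - ζ) + 1) * ‖ρ ζ‖) := by
  have := (h.ker_int z).add h.int.norm
  refine this.congr (ae_of_all _ fun ζ => ?_)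
  simp [add_mul]

lemma Dens.dom_le (h : Dens ρ B K) (z : ℂ) : ∫ ζ, (sker (z - ζ) + 1) * ‖ρ ζ‖ ≤ B * cK + K := by
  have e : ∫ ζ, (sker (z - ζ) + 1) * ‖ρ ζ‖ = (∫ ζ, sker (z - ζ) * ‖ρ ζ‖) + ∫ ζ, ‖ρ ζ‖ := by
    rw [← integral_add (h.ker_int z) h.int.norm]; congr 1; ext ζ; ring
  have : ∫ ζ, sker (z - ζ) * ‖ρ ζ‖ ≤ ∫ ζ, sker (z - ζ) * B :=
    integral_mono (h.ker_int z) ((ker_shift_integrable z).mul_const B)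
      fun ζ => mul_le_mul_of_nonneg_left (h.bd ζ) (ker_nonneg _)
  rw [integral_mul_const, ker_shift_int] at this
  have := h.mass
  rw [e]; linarith

end

lemma ae_ne (z : ℂ) : ∀ᵐ ζ : ℂ, ζ ≠ z := by
  have : volume ({z} : Set ℂ) = 0 := by simp
  rw [ae_iff]; simp

lemma ae_sub_ne (z : ℂ) : ∀ᵐ ζ : ℂ, z - ζ ≠ 0 := by
  filter_upwards [ae_ne z] with ζ h
  exact sub_ne_zero.2 h.symm

/-- Cauchy transform. -/
def Cau (ρ : ℂ → ℂ) (z : ℂ) : ℂ := ∫ ζ, ρ ζ / (z - ζ)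

section
variable {ρ : ℂ → ℂ} {B K : ℝ}

lemma Cau_meas (hρ : AEStronglyMeasurable ρ) (z : ℂ) : AEStronglyMeasurable (fun ζ => ρ ζ / (z - ζ)) := by
  have : (fun ζ => ρ ζ / (z - ζ)) = fun ζ => ρ ζ * (z - ζ)⁻¹ := by ext; rw [div_eq_mul_inv]
  rw [this]
  exact hρ.mul (by fun_prop : Measurable fun ζ : ℂ => (z - ζ)⁻¹).aestronglyMeasurable

lemma Cau_bound (ζ z : ℂ) : ‖ρ ζ / (z - ζ)‖ ≤ (sker (z - ζ) + 1) * ‖ρ ζ‖ := by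
  rw [norm_div, div_eq_inv_mul]
  exact mul_le_mul_of_nonneg_right ker_ge_1 (norm_nonneg _)

lemma Dens.Cau_int (h : Dens ρ B K) (z : ℂ) : Integrable (fun ζ => ρ ζ / (z - ζ)) :=
  (h.dom_int z).mono' (Cau_meas h.int.1 z) (ae_of_all _ fun ζ => Cau_bound ζ z)

lemma Dens.Cau_le (h : Dens ρ B K) (z : ℂ) : ‖Cau ρ z‖ ≤ B * cK + K :=
  (norm_integral_le_of_norm_le (h.dom_int z) (ae_of_all _ fun ζ => Cau_bound ζ z)).trans (h.dom_le z)

lemma holder_aux {a b d : ℝ} (ha : 0 < a) (hb : 0 < b) (hd : 0 ≤ d) (hdab : d ≤ a + b) :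
    d / (a * b) ≤ 2 * √d * ((a * √a)⁻¹ + (b * √b)⁻¹) := by
  set x := √a with hx
  set y := √b with hy
  set t := √d with ht
  have hx0 : 0 < x := Real.sqrt_pos.2 ha
  have hy0 : 0 < y := Real.sqrt_pos.2 hb
  have ht0 : 0 ≤ t := Real.sqrt_nonneg _
  have ea : a = x ^ 2 := (Real.sq_sqrt ha.le).symm
  have eb : b = y ^ 2 := (Real.sq_sqrt hb.le).symm
  have ed : d = t ^ 2 := (Real.sq_sqrt hd).symm
  have htxy : t ≤ x + y := by
    rw [ea, eb, ed] at hdab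
    nlinarith [mul_pos hx0 hy0]
  rw [ea, eb, ed]
  have e2 : 2 * t * ((x ^ 2 * x)⁻¹ + (y ^ 2 * y)⁻¹) = t * (2 * (x ^ 3 + y ^ 3)) / (x ^ 3 * y ^ 3) := by
    field_simp; ring
  have e1 : t ^ 2 / (x ^ 2 * y ^ 2) = t * (t * (x * y)) / (x ^ 3 * y ^ 3) := by
    field_simp
  rw [e1, e2]
  apply div_le_div_of_nonneg_right _ (by positivity)
  apply mul_le_mul_of_nonneg_left _ ht0
  have : t * (x * y) ≤ (x + y) * (x * y) := mul_le_mul_of_nonneg_right htxy (by positivity)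
  nlinarith [mul_nonneg (add_pos hx0 hy0).le (sq_nonneg (x - y)), pow_pos hx0 3, pow_pos hy0 3]

lemma Dens.Cau_holder (h : Dens ρ B K) (z z' : ℂ) :
    ‖Cau ρ z - Cau ρ z'‖ ≤ 4 * (B * cK + K) * √‖z - z'‖ := by
  unfold Cau
  rw [← integral_sub (h.Cau_int z) (h.Cau_int z')]
  have hd := ((h.dom_int z).add (h.dom_int z')).const_mul (2 * √‖z - z'‖)
  refine (norm_integral_le_of_norm_le hd ?_).trans ?_
  · filter_upwards [ae_sub_ne z, ae_sub_ne z'] with ζ h1 h2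
    have e : ρ ζ / (z - ζ) - ρ ζ / (z' - ζ) = ρ ζ * ((z' - z) / ((z - ζ) * (z' - ζ))) := by
      field_simp; ring
    rw [e, norm_mul, norm_div, norm_mul]
    have k := holder_aux (norm_pos_iff.2 h1) (norm_pos_iff.2 h2) (norm_nonneg (z - z'))
      (by have := norm_sub_le (z - ζ) (z' - ζ); simpa using this)
    rw [norm_sub_rev z' z]
    have k1 := ker_ge_32 (y := z - ζ)
    have k2 := ker_ge_32 (y := z' - ζ)
    have : ‖z - z'‖ / (‖z - ζ‖ * ‖z' - ζ‖) ≤ 2 * √‖z - z'‖ * ((sker (z - ζ) + 1) + (sker (z' - ζ) + 1)) :=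
      k.trans (mul_le_mul_of_nonneg_left (by linarith) (by positivity))
    calc _ ≤ ‖ρ ζ‖ * (2 * √‖z - z'‖ * ((sker (z - ζ) + 1) + (sker (z' - ζ) + 1))) :=
          mul_le_mul_of_nonneg_left this (norm_nonneg _)
      _ = _ := by simp only [Pi.add_apply]; ring
  · rw [integral_const_mul, integral_add' (h.dom_int z) (h.dom_int z')]
    have := h.dom_le z
    have := h.dom_le z'
    have h0 : 0 ≤ 2 * √‖z - z'‖ := by positivity
    nlinarith

lemma Dens.Cau_cont (h : Dens ρ B K) : Continuous (Cau ρ) := by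
  rw [continuous_iff_continuousAt]
  intro z
  rw [ContinuousAt, tendsto_iff_norm_sub_tendsto_zero]
  refine squeeze_zero (fun _ => norm_nonneg _) (fun y => h.Cau_holder y z) ?_
  have : Continuous fun y : ℂ => 4 * (B * cK + K) * √‖y - z‖ := by fun_prop
  simpa using this.tendsto z

end

lemma log_sub_le {a b : ℝ} (ha : 0 < a) (hb : 0 < b) :
    |Real.log a - Real.log b| ≤ |a - b| * (a⁻¹ + b⁻¹) := by
  have key : ∀ {x y : ℝ}, 0 < x → 0 < y → Real.log x - Real.log y ≤ |x - y| * y⁻¹ := by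
    intro x y hx hy
    rw [← Real.log_div hx.ne' hy.ne']
    have h := Real.log_le_sub_one_of_pos (div_pos hx hy)
    have e : x / y - 1 = (x - y) * y⁻¹ := by field_simp
    rw [e] at h
    exact h.trans (mul_le_mul_of_nonneg_right (le_abs_self _) (by positivity))
  have h1 := key ha hb
  have h2 := key hb ha
  rw [abs_sub_comm b a] at h2
  have : 0 ≤ |a - b| * a⁻¹ := by positivity
  have : 0 ≤ |a - b| * b⁻¹ := by positivity
  rw [abs_le, mul_add]; constructor <;> linarith

/-- Normalised logarithmic potential. -/
def Pot (ρ : ℂ → ℝ) (z : ℂ) : ℝ := ∫ ζ, (Real.log ‖z - ζ‖ - Real.log ‖ζ‖) * ρ ζ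

lemma Dens.ofReal {ρ : ℂ → ℝ} {B K : ℝ} (h : Dens ρ B K) : Dens (fun ζ => (ρ ζ : ℂ)) B K :=
  ⟨h.int.ofReal, fun ζ => by simpa using h.bd ζ, by simpa using h.mass⟩

lemma logdiff_bound (z z' : ℂ) {ζ : ℂ} (h1 : z - ζ ≠ 0) (h2 : z' - ζ ≠ 0) :
    |Real.log ‖z - ζ‖ - Real.log ‖z' - ζ‖| ≤ ‖z - z'‖ * ((sker (z - ζ) + 1) + (sker (z' - ζ) + 1)) := by
  have h := log_sub_le (norm_pos_iff.2 h1) (norm_pos_iff.2 h2)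
  have h3 : |‖z - ζ‖ - ‖z' - ζ‖| ≤ ‖z - z'‖ := by
    have := abs_norm_sub_norm_le (z - ζ) (z' - ζ); simpa using this
  refine h.trans ?_
  have k1 := ker_ge_1 (y := z - ζ)
  have k2 := ker_ge_1 (y := z' - ζ)
  exact mul_le_mul h3 (by linarith) (by positivity) (norm_nonneg _)

section
variable {ρ : ℂ → ℝ} {B K : ℝ}

lemma Dens.logdiff_ae (z z' : ℂ) : ∀ᵐ ζ : ℂ, ‖(Real.log ‖z - ζ‖ - Real.log ‖z' - ζ‖) * ρ ζ‖ ≤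
    ‖z - z'‖ * ((sker (z - ζ) + 1) * ‖ρ ζ‖ + (sker (z' - ζ) + 1) * ‖ρ ζ‖) := by
  filter_upwards [ae_sub_ne z, ae_sub_ne z'] with ζ h1 h2
  rw [norm_mul]
  have := mul_le_mul_of_nonneg_right (logdiff_bound z z' h1 h2) (norm_nonneg (ρ ζ))
  rw [Real.norm_eq_abs (_ - _)]
  calc _ ≤ _ := this
    _ = _ := by ring

lemma Dens.logdiff_int (h : Dens ρ B K) (z z' : ℂ) :
    Integrable (fun ζ => (Real.log ‖z - ζ‖ - Real.log ‖z' - ζ‖) * ρ ζ) := by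
  refine Integrable.mono' (((h.dom_int z).add (h.dom_int z')).const_mul ‖z - z'‖) ?_
    (Dens.logdiff_ae z z')
  exact (by fun_prop : Measurable fun ζ : ℂ => Real.log ‖z - ζ‖ - Real.log ‖z' - ζ‖).aestronglyMeasurable.mul h.int.1

lemma Dens.Pot_int (h : Dens ρ B K) (z : ℂ) :
    Integrable (fun ζ => (Real.log ‖z - ζ‖ - Real.log ‖ζ‖) * ρ ζ) := by
  have := h.logdiff_int z 0
  simpa using this

lemma Dens.Pot_sub (h : Dens ρ B K) (z z' : ℂ) :
    Pot ρ z - Pot ρ z' = ∫ ζ, (Real.log ‖z - ζ‖ - Real.log ‖z' - ζ‖) * ρ ζ := by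
  unfold Pot
  rw [← integral_sub (h.Pot_int z) (h.Pot_int z')]
  congr 1; ext ζ; ring

lemma Dens.Pot_lip (h : Dens ρ B K) (z z' : ℂ) :
    |Pot ρ z - Pot ρ z'| ≤ 2 * (B * cK + K) * ‖z - z'‖ := by
  rw [h.Pot_sub]
  have := norm_integral_le_of_norm_le (((h.dom_int z).add (h.dom_int z')).const_mul ‖z - z'‖)
    (Dens.logdiff_ae (ρ := ρ) z z')
  rw [Real.norm_eq_abs] at this
  refine this.trans ?_
  rw [integral_const_mul, integral_add' (h.dom_int z) (h.dom_int z')]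
  have := h.dom_le z
  have := h.dom_le z'
  nlinarith [norm_nonneg (z - z')]

lemma rem_aux {w h : ℂ} (hw : w ≠ 0) (hwh : w + h ≠ 0) :
    |Real.log ‖w + h‖ - Real.log ‖w‖ - (h / w).re| ≤
      4 * (‖h‖ * √‖h‖) * ((‖w‖ * √‖w‖)⁻¹ + (‖w + h‖ * √‖w + h‖)⁻¹) := by
  have ha : 0 < ‖w‖ := norm_pos_iff.2 hw
  have hb : 0 < ‖w + h‖ := norm_pos_iff.2 hwh
  have sa : 0 < √‖w‖ := Real.sqrt_pos.2 ha
  have sb : 0 < √‖w + h‖ := Real.sqrt_pos.2 hb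
  have hq : ‖h / w‖ = ‖h‖ / ‖w‖ := norm_div _ _
  by_cases hc : ‖h‖ ≤ ‖w‖ / 2
  · have hq2 : ‖h / w‖ ≤ 1 / 2 := by rw [hq, div_le_iff₀ ha]; linarith
    have h1 := Complex.norm_log_one_add_sub_self_le (z := h / w) (by linarith)
    have h2 : Real.log ‖w + h‖ - Real.log ‖w‖ - (h / w).re = (Complex.log (1 + h / w) - h / w).re := by
      rw [Complex.sub_re, Complex.log_re, ← Real.log_div hb.ne' ha.ne', ← norm_div]
      congr 3; field_simp
    rw [h2]
    refine (Complex.abs_re_le_norm _).trans (h1.trans ?_)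
    have h3 : (1 - ‖h / w‖)⁻¹ ≤ 2 := by
      rw [inv_le_comm₀ (by linarith) (by norm_num)]; linarith
    have h4 : ‖h / w‖ ^ 2 * (1 - ‖h / w‖)⁻¹ / 2 ≤ ‖h / w‖ ^ 2 := by
      nlinarith [sq_nonneg ‖h / w‖]
    refine h4.trans ?_
    have h5 : ‖h / w‖ ^ 2 ≤ (‖h‖ * √‖h‖) * (‖w‖ * √‖w‖)⁻¹ := by
      have e : (‖h‖ * √‖h‖) * (‖w‖ * √‖w‖)⁻¹ = ‖h / w‖ * √(‖h / w‖) := by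
        rw [hq, Real.sqrt_div (norm_nonneg _)]; field_simp
      rw [e, sq]
      apply mul_le_mul_of_nonneg_left _ (norm_nonneg _)
      apply Real.le_sqrt_of_sq_le
      nlinarith [norm_nonneg (h / w)]
    have h6 : 0 ≤ (‖h‖ * √‖h‖) * (‖w‖ * √‖w‖)⁻¹ := by positivity
    have h7 : 0 ≤ (‖h‖ * √‖h‖) * (‖w + h‖ * √‖w + h‖)⁻¹ := by positivity
    nlinarith
  · push Not at hc
    have hh : 0 < ‖h‖ := by linarith
    have sh : 0 < √‖h‖ := Real.sqrt_pos.2 hh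
    have h1 := log_sub_le hb ha
    have h2 : |‖w + h‖ - ‖w‖| ≤ ‖h‖ := by
      have := abs_norm_sub_norm_le (w + h) w; simpa using this
    have h3 : |(h / w).re| ≤ ‖h‖ / ‖w‖ := (Complex.abs_re_le_norm _).trans hq.le
    have h4 : |Real.log ‖w + h‖ - Real.log ‖w‖ - (h / w).re| ≤ ‖h‖ * (‖w + h‖⁻¹ + ‖w‖⁻¹) + ‖h‖ / ‖w‖ := by
      refine (abs_sub _ _).trans (add_le_add (h1.trans ?_) h3)
      exact mul_le_mul_of_nonneg_right h2 (by positivity)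
    have hsum : ‖w + h‖ ≤ 3 * ‖h‖ := by
      have := norm_add_le w h; linarith
    have h5 : √‖w‖ ≤ 2 * √‖h‖ := by
      rw [Real.sqrt_le_left (by positivity), mul_pow, Real.sq_sqrt hh.le]; linarith
    have h6 : √‖w + h‖ ≤ 2 * √‖h‖ := by
      rw [Real.sqrt_le_left (by positivity), mul_pow, Real.sq_sqrt hh.le]; linarith
    have h7 : ‖w‖⁻¹ ≤ 2 * √‖h‖ * (‖w‖ * √‖w‖)⁻¹ := by
      have : ‖w‖⁻¹ = √‖w‖ * (‖w‖ * √‖w‖)⁻¹ := by field_simp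
      rw [this]; exact mul_le_mul_of_nonneg_right h5 (by positivity)
    have h8 : ‖w + h‖⁻¹ ≤ 2 * √‖h‖ * (‖w + h‖ * √‖w + h‖)⁻¹ := by
      have : ‖w + h‖⁻¹ = √‖w + h‖ * (‖w + h‖ * √‖w + h‖)⁻¹ := by field_simp
      rw [this]; exact mul_le_mul_of_nonneg_right h6 (by positivity)
    have h9 := mul_le_mul_of_nonneg_left h7 hh.le
    have h10 := mul_le_mul_of_nonneg_left h8 hh.le
    have h11 : 0 ≤ ‖h‖ * (2 * √‖h‖ * (‖w + h‖ * √‖w + h‖)⁻¹) := by positivity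
    have h12 : ‖h‖ / ‖w‖ = ‖h‖ * ‖w‖⁻¹ := div_eq_mul_inv _ _
    rw [h12] at h4
    linarith

lemma Dens.Pot_rem (h : Dens ρ B K) (z k : ℂ) :
    |Pot ρ (z + k) - Pot ρ z - (k * Cau (fun ζ => (ρ ζ : ℂ)) z).re| ≤
      8 * (B * cK + K) * (‖k‖ * √‖k‖) := by
  have hC := h.ofReal.Cau_int z
  have e1 : (k * Cau (fun ζ => (ρ ζ : ℂ)) z).re = ∫ ζ, (k / (z - ζ)).re * ρ ζ := by
    unfold Cau
    rw [← integral_const_mul]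
    have := integral_re (hC.const_mul k)
    simp only [RCLike.re_eq_complex_re] at this
    rw [← this]
    congr 1; ext ζ
    have : k * (↑(ρ ζ) / (z - ζ)) = (k / (z - ζ)) * (ρ ζ : ℂ) := by ring
    rw [this, Complex.re_mul_ofReal]
  have hI : Integrable fun ζ => (k / (z - ζ)).re * ρ ζ := by
    have := (hC.const_mul k).re
    refine this.congr (ae_of_all _ fun ζ => ?_)
    have : k * (↑(ρ ζ) / (z - ζ)) = (k / (z - ζ)) * (ρ ζ : ℂ) := by ring
    simp only [RCLike.re_eq_complex_re]
    rw [this, Complex.re_mul_ofReal]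
  rw [h.Pot_sub, e1, ← integral_sub (h.logdiff_int _ _) hI]
  have hd := ((h.dom_int z).add (h.dom_int (z + k))).const_mul (4 * (‖k‖ * √‖k‖))
  have := norm_integral_le_of_norm_le (f := fun ζ => (Real.log ‖z + k - ζ‖ - Real.log ‖z - ζ‖) * ρ ζ - (k / (z - ζ)).re * ρ ζ) hd ?_
  · rw [Real.norm_eq_abs] at this
    refine this.trans ?_
    rw [integral_const_mul, integral_add' (h.dom_int z) (h.dom_int (z + k))]
    have := h.dom_le z
    have := h.dom_le (z + k)
    have h0 : 0 ≤ ‖k‖ * √‖k‖ := by positivity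
    nlinarith
  · filter_upwards [ae_sub_ne z, ae_sub_ne (z + k)] with ζ h1 h2
    have e : z + k - ζ = (z - ζ) + k := by ring
    have := rem_aux h1 (h := k) (by rwa [← e])
    rw [← sub_mul, norm_mul, Real.norm_eq_abs, e]
    have k1 := ker_ge_32 (y := z - ζ)
    have k2 := ker_ge_32 (y := z - ζ + k)
    have h0 : 0 ≤ 4 * (‖k‖ * √‖k‖) := by positivity
    have h3 := this.trans (mul_le_mul_of_nonneg_left (add_le_add k1 k2) h0)
    have h4 := mul_le_mul_of_nonneg_right h3 (norm_nonneg (ρ ζ))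
    simp only [Pi.add_apply, e]
    linarith

/-- real linear functional `h ↦ Re (h c)`. -/
def reMul (c : ℂ) : ℂ →L[ℝ] ℝ := Complex.reCLM.comp ((ContinuousLinearMap.mul ℝ ℂ).flip c)

@[simp] lemma reMul_apply (c h : ℂ) : reMul c h = (h * c).re := by simp [reMul]; ring

lemma hasFDerivAt_of_rem {E F : Type*} [NormedAddCommGroup E] [NormedSpace ℝ E] [NormedAddCommGroup F] [NormedSpace ℝ F] {f : E → F} {L : E →L[ℝ] F} {z : E} {C : ℝ}
    (h : ∀ k, ‖f (z + k) - f z - L k‖ ≤ C * (‖k‖ * √‖k‖)) : HasFDerivAt f L z := by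
  rw [hasFDerivAt_iff_isLittleO_nhds_zero]
  refine (Asymptotics.IsBigO.of_bound C (Eventually.of_forall fun k => (h k).trans_eq ?_)
    : (fun k => f (z + k) - f z - L k) =O[𝓝 0] fun k => ‖k‖ * √‖k‖).trans_isLittleO ?_
  · rw [norm_of_nonneg (by positivity)]
  · have : (fun k : E => √‖k‖) =o[𝓝 0] fun _ => (1 : ℝ) := by
      rw [Asymptotics.isLittleO_one_iff]
      have : Continuous fun k : E => √‖k‖ := by fun_prop
      simpa using this.tendsto 0
    have h2 := (Asymptotics.isBigO_refl (fun k : E => ‖k‖) (𝓝 0)).mul_isLittleO this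
    simp only [mul_one] at h2
    exact h2.of_norm_right

lemma Dens.Pot_deriv (h : Dens ρ B K) (z : ℂ) :
    HasFDerivAt (Pot ρ) (reMul (Cau (fun ζ => (ρ ζ : ℂ)) z)) z :=
  hasFDerivAt_of_rem (C := 8 * (B * cK + K)) fun k => by
    rw [reMul_apply, Real.norm_eq_abs]; exact h.Pot_rem z k

end

section
variable {f ρ : ℂ → ℂ} {B K : ℝ}

lemma Dens.Cau_norm_int_le (h : Dens ρ B K) (z : ℂ) : ∫ ζ, ‖ρ ζ / (z - ζ)‖ ≤ B * cK + K :=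
  (integral_mono (h.Cau_int z).norm (h.dom_int z) fun ζ => Cau_bound ζ z).trans (h.dom_le z)

lemma Dens.prod_int (h : Dens ρ B K) (hf : Integrable f) :
    Integrable (fun q : ℂ × ℂ => f q.1 * (ρ q.2 / (q.1 - q.2))) (volume.prod volume) := by
  have hm : AEStronglyMeasurable (fun q : ℂ × ℂ => f q.1 * (ρ q.2 / (q.1 - q.2))) (volume.prod volume) := by
    refine (hf.1.comp_fst).mul ?_
    have e : (fun q : ℂ × ℂ => ρ q.2 / (q.1 - q.2)) = fun q => ρ q.2 * (q.1 - q.2)⁻¹ := by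
      ext; rw [div_eq_mul_inv]
    rw [e]
    exact (h.int.1.comp_snd).mul (by fun_prop : Measurable fun q : ℂ × ℂ => (q.1 - q.2)⁻¹).aestronglyMeasurable
  rw [integrable_prod_iff hm]
  refine ⟨ae_of_all _ fun a => (h.Cau_int a).const_mul (f a), ?_⟩
  refine Integrable.mono' (hf.norm.mul_const (B * cK + K)) hm.norm.integral_prod_right' (ae_of_all _ fun a => ?_)
  simp only [norm_mul]
  rw [integral_const_mul, norm_mul, norm_norm]
  apply mul_le_mul_of_nonneg_left _ (norm_nonneg _)
  rw [norm_of_nonneg (integral_nonneg fun _ => norm_nonneg _)]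
  exact h.Cau_norm_int_le a

lemma Dens.int_Cau (h : Dens ρ B K) (hf : Integrable f) :
    ∫ a, f a * Cau ρ a = ∫ q : ℂ × ℂ, f q.1 * (ρ q.2 / (q.1 - q.2)) ∂(volume.prod volume) := by
  rw [integral_prod _ (h.prod_int hf)]
  congr 1; ext a
  exact (integral_const_mul _ _).symm

lemma ae_prod_ne : ∀ᵐ q : ℂ × ℂ ∂(volume.prod volume), q.1 - q.2 ≠ 0 := by
  rw [Measure.ae_prod_iff_ae_ae]
  · exact ae_of_all _ fun a => ae_sub_ne a
  · have : {q : ℂ × ℂ | q.1 - q.2 ≠ 0} = (fun q : ℂ × ℂ => q.1 - q.2) ⁻¹' {0}ᶜ := rfl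
    rw [this]
    exact (by fun_prop : Measurable fun q : ℂ × ℂ => q.1 - q.2) (measurableSet_singleton 0).compl

/-- symmetrization -/
lemma Dens.symm_int (h : Dens ρ B K) {g : ℂ → ℂ} (hf : Integrable (fun a => g a * ρ a)) :
    2 * ∫ a, g a * ρ a * Cau ρ a = ∫ q : ℂ × ℂ, ρ q.1 * ρ q.2 * ((g q.1 - g q.2) / (q.1 - q.2)) ∂(volume.prod volume) := by
  have I := h.prod_int hf
  have I2 := I.swap
  have e := integral_prod_swap (μ := (volume : Measure ℂ)) (ν := (volume : Measure ℂ))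
    (fun q : ℂ × ℂ => g q.1 * ρ q.1 * (ρ q.2 / (q.1 - q.2)))
  rw [h.int_Cau hf, two_mul]
  nth_rewrite 2 [← e]
  refine (integral_add I I2).symm.trans ?_
  apply integral_congr_ae
  filter_upwards [ae_prod_ne] with q hq
  have hq2 : q.2 - q.1 ≠ 0 := by rw [← neg_sub]; exact neg_ne_zero.2 hq
  have e3 : q.2 - q.1 = -(q.1 - q.2) := by ring
  simp only [Function.comp, Prod.swap, e3, div_neg]
  field_simp
  ring

/-- `Cau(ρ)² = 2 Cau(ρ Cau ρ)`. -/
lemma Dens.Cau_sq (h : Dens ρ B K) (z : ℂ) :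
    (Cau ρ z) ^ 2 = 2 * Cau (fun a => ρ a * Cau ρ a) z := by
  have hf : Integrable (fun a => (z - a)⁻¹ * ρ a) :=
    (h.Cau_int z).congr (ae_of_all _ fun a => by simp only [div_eq_inv_mul])
  have e := h.symm_int hf
  have e2 : Cau (fun a => ρ a * Cau ρ a) z = ∫ a, (z - a)⁻¹ * ρ a * Cau ρ a := by
    unfold Cau; congr 1; ext a; rw [div_eq_inv_mul, mul_assoc]
  rw [e2, e, sq]
  have e4 : Cau ρ z * Cau ρ z = ∫ q : ℂ × ℂ, (ρ q.1 / (z - q.1)) * (ρ q.2 / (z - q.2)) ∂(volume.prod volume) := by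
    rw [integral_prod_mul (fun a => ρ a / (z - a)) (fun a => ρ a / (z - a))]; rfl
  rw [e4]
  apply integral_congr_ae
  have h1 : ∀ᵐ q : ℂ × ℂ ∂(volume.prod volume), z - q.1 ≠ 0 :=
    Measure.quasiMeasurePreserving_fst.ae (ae_sub_ne z)
  have h2 : ∀ᵐ q : ℂ × ℂ ∂(volume.prod volume), z - q.2 ≠ 0 :=
    Measure.quasiMeasurePreserving_snd.ae (ae_sub_ne z)
  filter_upwards [ae_prod_ne, h1, h2] with q hq h1 h2
  field_simp
  ring

lemma Dens.Cau_moment (h : Dens ρ B K) (x0 : ℂ) (hf : Integrable (fun a => (a - x0) * ρ a)) :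
    2 * ∫ a, (a - x0) * ρ a * Cau ρ a = (∫ a, ρ a) ^ 2 := by
  rw [h.symm_int hf, sq, ← integral_prod_mul]
  apply integral_congr_ae
  filter_upwards [ae_prod_ne] with q hq
  have : q.1 - x0 - (q.2 - x0) = q.1 - q.2 := by ring
  rw [this, div_self hq, mul_one]

end

lemma radial_sq {c : ℝ} (hc : 0 < c) {g G : ℝ → ℝ} {L : ℝ}
    (h0 : ContinuousWithinAt G (Set.Ici 0) 0) (hG : ∀ s, 0 < s → HasDerivAt G (g s) s)
    (hL : Tendsto G atTop (𝓝 L)) (hi : Integrable (fun z : ℂ => g (c * ‖z‖ ^ 2))) :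
    ∫ z : ℂ, g (c * ‖z‖ ^ 2) = (π / c) * (L - G 0) := by
  have hi' := (integrable_fun_norm_addHaar (volume : Measure ℂ)
    (f := fun t : ℝ => g (c * t ^ 2))).1 hi
  have e := integral_fun_norm_addHaar (volume : Measure ℂ) (fun t : ℝ => g (c * t ^ 2))
  rw [e]
  simp only [Complex.finrank_real_complex, smul_eq_mul] at hi' ⊢
  have hv : (volume : Measure ℂ).real (ball 0 1) = π := by
    simp [Measure.real, Complex.volume_ball]
  rw [hv]
  have e2 := integral_Ioi_of_hasDerivAt_of_tendsto (a := (0:ℝ)) (f := fun t => (1 / (2 * c)) * G (c * t ^ 2))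
    (f' := fun t => t ^ (2 - 1) * g (c * t ^ 2)) (m := (1 / (2 * c)) * L) ?_ ?_ hi' ?_
  · rw [e2]; simp; field_simp
  · refine ContinuousWithinAt.const_smul (c := 1 / (2 * c)) ?_
    refine ContinuousWithinAt.comp (t := Set.Ici 0) (by simpa using h0) (by fun_prop) ?_
    intro t ht; exact mul_nonneg hc.le (sq_nonneg _)
  · intro t ht
    have ht : 0 < t := ht
    have h1 := (hG (c * t ^ 2) (by positivity)).comp t (((hasDerivAt_pow 2 t).const_mul c))
    refine HasDerivAt.congr_deriv (h1.const_mul (1 / (2 * c))) ?_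
    simp; field_simp
  · refine Tendsto.const_mul _ (hL.comp ?_)
    exact (tendsto_pow_atTop two_ne_zero).const_mul_atTop hc

lemma int_dec {k : ℝ} (hk : 2 < k) : Integrable (fun z : ℂ => (1 + ‖z‖) ^ (-k)) :=
  integrable_one_add_norm (by simpa using hk)

lemma one_add_sq_ge {c : ℝ} (hc : 0 < c) (r : ℝ) (_hr : 0 ≤ r) :
    min c 1 / 2 * (1 + r) ^ 2 ≤ 1 + c * r ^ 2 := by
  have h1 : min c 1 ≤ c := min_le_left _ _
  have h2 : min c 1 ≤ 1 := min_le_right _ _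
  have h3 : 0 < min c 1 := lt_min hc one_pos
  have h4 : (1 + r) ^ 2 ≤ 2 * (1 + r ^ 2) := by nlinarith [sq_nonneg (1 - r)]
  nlinarith [mul_le_mul_of_nonneg_left h4 h3.le, sq_nonneg r, mul_le_mul_of_nonneg_right h1 (sq_nonneg r)]

lemma bub_le {c : ℝ} (hc : 0 < c) : ∃ C, 0 ≤ C ∧ ∀ z : ℂ, ((1 + c * ‖z‖ ^ 2) ^ 2)⁻¹ ≤ C * (1 + ‖z‖) ^ (-(4:ℝ)) := by
  have h3 : 0 < min c 1 := lt_min hc one_pos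
  refine ⟨((min c 1 / 2) ^ 2)⁻¹, by positivity, fun z => ?_⟩
  have h := one_add_sq_ge hc ‖z‖ (norm_nonneg _)
  have : (1 + ‖z‖) ^ (-(4:ℝ)) = ((1 + ‖z‖) ^ 4)⁻¹ := by
    rw [Real.rpow_neg (by positivity)]; norm_cast
  rw [this, ← mul_inv]
  apply inv_anti₀ (by positivity)
  calc _ = (min c 1 / 2 * (1 + ‖z‖) ^ 2) ^ 2 := by ring
    _ ≤ _ := pow_le_pow_left₀ (by positivity) h 2

lemma bub_int {c : ℝ} (hc : 0 < c) : Integrable (fun z : ℂ => ((1 + c * ‖z‖ ^ 2) ^ 2)⁻¹) := by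
  obtain ⟨C, hC, h⟩ := bub_le hc
  refine ((int_dec (k := 4) (by norm_num)).const_mul C).mono' (by fun_prop : Measurable _).aestronglyMeasurable
    (ae_of_all _ fun z => ?_)
  rw [norm_of_nonneg (by positivity)]; exact h z

/-- weight with one more power -/
lemma bub_int_norm {c : ℝ} (hc : 0 < c) : Integrable (fun z : ℂ => (1 + ‖z‖) * ((1 + c * ‖z‖ ^ 2) ^ 2)⁻¹) := by
  obtain ⟨C, hC, h⟩ := bub_le hc
  refine ((int_dec (k := 3) (by norm_num)).const_mul C).mono' (by fun_prop : Measurable _).aestronglyMeasurable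
    (ae_of_all _ fun z => ?_)
  rw [norm_of_nonneg (by positivity)]
  have e : (1 + ‖z‖) ^ (-(3:ℝ)) = (1 + ‖z‖) * (1 + ‖z‖) ^ (-(4:ℝ)) := by
    rw [← Real.rpow_one_add' (by positivity) (by norm_num)]; norm_num
  rw [e]
  have := mul_le_mul_of_nonneg_left (h z) (by positivity : 0 ≤ 1 + ‖z‖)
  linarith

lemma bub_mass {c : ℝ} (hc : 0 < c) : ∫ z : ℂ, ((1 + c * ‖z‖ ^ 2) ^ 2)⁻¹ = π / c := by
  rw [radial_sq hc (g := fun s => ((1 + s) ^ 2)⁻¹) (G := fun s => -(1 + s)⁻¹) (L := 0) ?_ ?_ ?_ (bub_int hc)]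
  · simp
  · apply ContinuousAt.continuousWithinAt
    have : (1 + (0:ℝ)) ≠ 0 := by norm_num
    fun_prop (disch := assumption)
  · intro s hs
    have : 1 + s ≠ 0 := by positivity
    refine HasDerivAt.congr_deriv ((((hasDerivAt_id s).const_add 1).inv this).neg) ?_
    simp [neg_div]
  · have : Tendsto (fun s : ℝ => 1 + s) atTop atTop := tendsto_atTop_add_const_left _ _ tendsto_id
    simpa using (tendsto_inv_atTop_zero.comp this).neg

lemma bub_moment {c : ℝ} (hc : 0 < c) : ∫ z : ℂ, (c * ‖z‖ ^ 2) * ((1 + c * ‖z‖ ^ 2) ^ 3)⁻¹ = π / (2 * c) := by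
  rw [radial_sq hc (g := fun s => s * ((1 + s) ^ 3)⁻¹) (G := fun s => -(1 + s)⁻¹ + ((1 + s)⁻¹) ^ 2 / 2) (L := 0)]
  · simp; field_simp; ring
  · apply ContinuousAt.continuousWithinAt
    have : (1 + (0:ℝ)) ≠ 0 := by norm_num
    fun_prop (disch := assumption)
  · intro s hs
    have : 1 + s ≠ 0 := by positivity
    have h := (((hasDerivAt_id s).const_add 1).inv this)
    refine HasDerivAt.congr_deriv (h.neg.add ((h.pow 2).div_const 2)) ?_
    simp; field_simp; ring
  · have : Tendsto (fun s : ℝ => 1 + s) atTop atTop := tendsto_atTop_add_const_left _ _ tendsto_id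
    have := tendsto_inv_atTop_zero.comp this
    simpa using this.neg.add ((this.pow 2).div_const 2)
  · refine (bub_int hc).mono' (by fun_prop : Measurable _).aestronglyMeasurable (ae_of_all _ fun z => ?_)
    have h0 : 0 ≤ c * ‖z‖ ^ 2 := by positivity
    rw [norm_of_nonneg (by positivity)]
    generalize c * ‖z‖ ^ 2 = s at *
    have : s * ((1 + s) ^ 3)⁻¹ = (s / (1 + s)) * ((1 + s) ^ 2)⁻¹ := by field_simp
    rw [this]
    apply mul_le_of_le_one_left (by positivity)
    rw [div_le_one (by positivity)]; linarith

/-- The standard bubble on `ℂ`. -/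
def Ub (z : ℂ) : ℝ := -2 * Real.log (1 + ‖z‖ ^ 2 / 8)

lemma exp_Ub (z : ℂ) : Real.exp (Ub z) = ((1 + (1/8) * ‖z‖ ^ 2) ^ 2)⁻¹ := by
  have h : 0 < 1 + ‖z‖ ^ 2 / 8 := by positivity
  unfold Ub
  rw [neg_mul, Real.exp_neg, two_mul, Real.exp_add, Real.exp_log h, ← sq]
  congr 3; ring

lemma Ub_abs (z : ℂ) : |Ub z| ≤ 4 * (1 + ‖z‖) := by
  unfold Ub
  have h : 0 ≤ Real.log (1 + ‖z‖ ^ 2 / 8) := Real.log_nonneg (by have := sq_nonneg ‖z‖; linarith)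
  have h2 : Real.log (1 + ‖z‖ ^ 2 / 8) ≤ Real.log ((1 + ‖z‖) ^ 2) :=
    Real.log_le_log (by positivity) (by nlinarith [norm_nonneg z])
  rw [Real.log_pow] at h2
  have h3 := Real.log_le_self (x := 1 + ‖z‖) (by positivity)
  rw [abs_of_nonpos (by linarith)]
  push_cast at h2
  linarith

lemma Ub_cont : Continuous Ub := by
  unfold Ub
  apply Continuous.mul continuous_const
  apply Continuous.log (by fun_prop)
  intro z; positivity

lemma expU_int : Integrable (fun z : ℂ => Real.exp (Ub z)) := by
  simp_rw [exp_Ub]; exact bub_int (by norm_num)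

lemma expU_mass : ∫ z : ℂ, Real.exp (Ub z) = 8 * π := by
  simp_rw [exp_Ub]; rw [bub_mass (by norm_num)]; ring

lemma expU_U : ∫ z : ℂ, Real.exp (Ub z) * Ub z = -16 * π := by
  have e : ∀ z : ℂ, Real.exp (Ub z) * Ub z = (fun s => -2 * Real.log (1 + s) * ((1 + s) ^ 2)⁻¹) ((1/8) * ‖z‖ ^ 2) := by
    intro z; rw [exp_Ub, Ub]; simp only; rw [mul_comm]; congr 4; ring
  simp_rw [e]
  rw [radial_sq (c := 1/8) (by norm_num) (g := fun s => -2 * Real.log (1 + s) * ((1 + s) ^ 2)⁻¹)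
    (G := fun s => 2 * (Real.log (1 + s) / (1 + s) + (1 + s)⁻¹)) (L := 0)]
  · simp; ring
  · apply ContinuousAt.continuousWithinAt
    have : (1 + (0:ℝ)) ≠ 0 := by norm_num
    fun_prop (disch := assumption)
  · intro s hs
    have : 1 + s ≠ 0 := by positivity
    have h1 := ((hasDerivAt_id s).const_add 1)
    refine HasDerivAt.congr_deriv ((((h1.log this).div h1 this).add (h1.inv this)).const_mul 2) ?_
    simp; field_simp; ring
  · have : Tendsto (fun s : ℝ => 1 + s) atTop atTop := tendsto_atTop_add_const_left _ _ tendsto_id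
    have h1 := tendsto_inv_atTop_zero.comp this
    have h2 : Tendsto (fun s : ℝ => Real.log s / s) atTop (𝓝 0) := by
      simpa using Real.tendsto_pow_log_div_mul_add_atTop 1 0 1 one_ne_zero
    simpa using ((h2.comp this).add h1).const_mul 2
  · have : (fun z : ℂ => (fun s => -2 * Real.log (1 + s) * ((1 + s) ^ 2)⁻¹) ((1/8) * ‖z‖ ^ 2)) = fun z => Real.exp (Ub z) * Ub z := by
      ext z; rw [e]
    rw [this]
    refine ((bub_int_norm (c := 1/8) (by norm_num)).const_mul 4).mono' ?_ (ae_of_all _ fun z => ?_)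
    · exact ((Real.continuous_exp.comp Ub_cont).mul Ub_cont).aestronglyMeasurable
    · rw [norm_mul, Real.norm_eq_abs, Real.norm_eq_abs, abs_of_pos (Real.exp_pos _), exp_Ub]
      have := mul_le_mul_of_nonneg_left (Ub_abs z) (by positivity : 0 ≤ ((1 + (1/8) * ‖z‖ ^ 2) ^ 2)⁻¹)
      linarith

lemma abs_log_le (z : ℂ) : |Real.log ‖z‖| ≤ sker z + ‖z‖ := by
  by_cases h : ‖z‖ < 1
  · have := ker_ge_log h; linarith [norm_nonneg z]
  · push Not at h
    rw [abs_of_nonneg (Real.log_nonneg h)]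
    linarith [ker_nonneg z, Real.log_le_self (norm_nonneg z)]

lemma expU_log : ∫ z : ℂ, Real.exp (Ub z) * Real.log ‖z‖ = 12 * π * Real.log 2 := by
  have e : ∀ z : ℂ, z ≠ 0 → Real.exp (Ub z) * Real.log ‖z‖ = (fun s => (1/2) * (Real.log 8 + Real.log s) * ((1 + s) ^ 2)⁻¹) ((1/8) * ‖z‖ ^ 2) := by
    intro z hz
    have hz : 0 < ‖z‖ := norm_pos_iff.2 hz
    have : Real.log 8 + Real.log ((1/8) * ‖z‖ ^ 2) = 2 * Real.log ‖z‖ := by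
      rw [← Real.log_mul (by norm_num) (by positivity)]
      have : 8 * (1 / 8 * ‖z‖ ^ 2) = ‖z‖ ^ 2 := by ring
      rw [this, Real.log_pow]; norm_num
    simp only
    rw [exp_Ub, this]; ring
  have hae : ∀ᵐ z : ℂ, Real.exp (Ub z) * Real.log ‖z‖ = (fun s => (1/2) * (Real.log 8 + Real.log s) * ((1 + s) ^ 2)⁻¹) ((1/8) * ‖z‖ ^ 2) := by
    filter_upwards [ae_ne 0] with z hz using e z hz
  rw [integral_congr_ae hae]
  rw [radial_sq (c := 1/8) (by norm_num) (g := fun s => (1/2) * (Real.log 8 + Real.log s) * ((1 + s) ^ 2)⁻¹)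
    (G := fun s => (1/2) * (-Real.log 8 * (1 + s)⁻¹ + (s * Real.log s) * (1 + s)⁻¹ - Real.log (1 + s))) (L := 0)]
  · have : Real.log 8 = 3 * Real.log 2 := by
      rw [show (8:ℝ) = 2 ^ 3 by norm_num, Real.log_pow]; norm_num
    simp; rw [this]; ring
  · apply ContinuousAt.continuousWithinAt
    have : (1 + (0:ℝ)) ≠ 0 := by norm_num
    have h2 := Real.continuous_mul_log.continuousAt (x := 0)
    fun_prop (disch := assumption)
  · intro s hs
    have : 1 + s ≠ 0 := by positivity
    have h1 := ((hasDerivAt_id s).const_add 1)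
    have h2 := Real.hasDerivAt_mul_log hs.ne'
    refine HasDerivAt.congr_deriv (((((h1.inv this).const_mul (-Real.log 8)).add (h2.mul (h1.inv this))).sub (h1.log this)).const_mul (1/2)) ?_
    simp; field_simp; ring
  · have h0 : Tendsto (fun s : ℝ => 1 + s) atTop atTop := tendsto_atTop_add_const_left _ _ tendsto_id
    have h1 := tendsto_inv_atTop_zero.comp h0
    have h2 : Tendsto (fun s : ℝ => Real.log s / (1 * s + 1)) atTop (𝓝 0) := by
      simpa using Real.tendsto_pow_log_div_mul_add_atTop 1 1 1 one_ne_zero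
    have h3 : Tendsto (fun s : ℝ => Real.log (1 - (1 + s)⁻¹)) atTop (𝓝 0) := by
      have : Tendsto (fun s : ℝ => 1 - (1 + s)⁻¹) atTop (𝓝 1) := by simpa using h1.const_sub 1
      simpa using this.log one_ne_zero
    have h4 := (((h1.const_mul (-Real.log 8)).add h3).sub h2).const_mul (1/2)
    simp only [mul_zero, add_zero, sub_zero] at h4
    refine h4.congr' ?_
    filter_upwards [eventually_gt_atTop 0] with s hs
    have e1 : 1 - (1 + s)⁻¹ = s / (1 + s) := by field_simp; ring
    rw [e1, Real.log_div hs.ne' (by positivity)]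
    simp only [Function.comp]
    field_simp; ring
  · have h1 : Integrable (fun z : ℂ => Real.exp (Ub z) * Real.log ‖z‖) := by
      refine (ker_integrable.add (bub_int_norm (c := 1/8) (by norm_num))).mono' ?_ (ae_of_all _ fun z => ?_)
      · exact (Real.continuous_exp.comp Ub_cont).aestronglyMeasurable.mul (by fun_prop : Measurable fun z : ℂ => Real.log ‖z‖).aestronglyMeasurable
      · rw [norm_mul, Real.norm_eq_abs, Real.norm_eq_abs, abs_of_pos (Real.exp_pos _), exp_Ub]
        have h1 : 0 ≤ ((1 + (1/8) * ‖z‖ ^ 2) ^ 2)⁻¹ := by positivity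
        have h2 : ((1 + (1/8) * ‖z‖ ^ 2) ^ 2)⁻¹ ≤ 1 := by
          apply inv_le_one_of_one_le₀; apply one_le_pow₀; nlinarith [sq_nonneg ‖z‖]
        have := mul_le_mul_of_nonneg_left (abs_log_le z) h1
        simp only [Pi.add_apply]
        nlinarith [ker_nonneg z, norm_nonneg z, mul_le_of_le_one_left (ker_nonneg z) h2]
    exact h1.congr hae

lemma hasFDerivAt_of_rem' {E F : Type*} [NormedAddCommGroup E] [NormedSpace ℝ E] [NormedAddCommGroup F] [NormedSpace ℝ F] {f : E → F} {L : E →L[ℝ] F} {z : E} {C δ : ℝ} (hδ : 0 < δ)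
    (h : ∀ k, ‖k‖ ≤ δ → ‖f (z + k) - f z - L k‖ ≤ C * (‖k‖ * √‖k‖)) : HasFDerivAt f L z := by
  rw [hasFDerivAt_iff_isLittleO_nhds_zero]
  have hev : ∀ᶠ k in 𝓝 (0 : E), ‖f (z + k) - f z - L k‖ ≤ C * ‖(‖k‖ * √‖k‖)‖ := by
    filter_upwards [Metric.closedBall_mem_nhds (0:E) hδ] with k hk
    rw [norm_of_nonneg (by positivity)]
    exact h k (by simpa using hk)
  refine (Asymptotics.IsBigO.of_bound C hev : (fun k => f (z + k) - f z - L k) =O[𝓝 0] fun k => ‖k‖ * √‖k‖).trans_isLittleO ?_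
  have : (fun k : E => √‖k‖) =o[𝓝 0] fun _ => (1 : ℝ) := by
    rw [Asymptotics.isLittleO_one_iff]
    have : Continuous fun k : E => √‖k‖ := by fun_prop
    simpa using this.tendsto 0
  have h2 := (Asymptotics.isBigO_refl (fun k : E => ‖k‖) (𝓝 0)).mul_isLittleO this
  simp only [mul_one] at h2
  exact h2.of_norm_right

/-- Solutions of the Liouville integral equation. -/
structure Liou (w : ℂ → ℝ) : Prop where
  z0 : w 0 = 0
  le : ∀ z, w z ≤ 0
  int : Integrable (fun ζ => Real.exp (w ζ))
  eq : ∀ z, w z = -(1 / (2 * π)) * Pot (fun ζ => Real.exp (w ζ)) z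

namespace Liou
variable {w : ℂ → ℝ}

def SS (w : ℂ → ℝ) : ℂ → ℂ := Cau (fun ζ => ((Real.exp (w ζ) : ℝ) : ℂ))
def MM (w : ℂ → ℝ) : ℝ := 1 * cK + ∫ ζ, Real.exp (w ζ)
def QQ (w : ℂ → ℝ) : ℂ → ℂ := Cau (fun ζ => ((Real.exp (w ζ) : ℝ) : ℂ) * (starRingEnd ℂ) (SS w ζ))

lemma dens (h : Liou w) : Dens (fun ζ => Real.exp (w ζ)) 1 (∫ ζ, Real.exp (w ζ)) := by
  refine ⟨h.int, fun ζ => ?_, le_of_eq ?_⟩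
  · rw [Real.norm_eq_abs, abs_of_pos (Real.exp_pos _)]; exact Real.exp_le_one_iff.2 (h.le ζ)
  · congr 1; ext ζ; rw [Real.norm_eq_abs, abs_of_pos (Real.exp_pos _)]

lemma MM_nonneg (h : Liou w) : 0 ≤ MM w := h.dens.c_nonneg

lemma SS_le (h : Liou w) (z : ℂ) : ‖SS w z‖ ≤ MM w := h.dens.ofReal.Cau_le z

lemma SS_cont (h : Liou w) : Continuous (SS w) := h.dens.ofReal.Cau_cont

lemma two_pi_inv : 1 / (2 * π) ≤ 1 := by
  rw [div_le_one (by positivity)]; linarith [Real.pi_gt_three]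

lemma two_pi_inv_pos : 0 < 1 / (2 * π) := by positivity

lemma w_rem (h : Liou w) (z k : ℂ) :
    |w (z + k) - w z - (-(1 / (2 * π)) * (k * SS w z).re)| ≤ 8 * MM w * (‖k‖ * √‖k‖) := by
  rw [h.eq (z + k), h.eq z]
  have e : ∀ a b c d : ℝ, -d * a - -d * b - (-d * c) = -d * (a - b - c) := by intros; ring
  rw [e, abs_mul, abs_neg, abs_of_pos two_pi_inv_pos]
  refine (mul_le_of_le_one_left (abs_nonneg _) two_pi_inv).trans ?_
  exact h.dens.Pot_rem z k

lemma w_lip (h : Liou w) (z k : ℂ) : |w (z + k) - w z| ≤ 2 * MM w * ‖k‖ := by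
  rw [h.eq (z + k), h.eq z]
  have e : ∀ a b d : ℝ, -d * a - -d * b = -d * (a - b) := by intros; ring
  rw [e, abs_mul, abs_neg, abs_of_pos two_pi_inv_pos]
  refine (mul_le_of_le_one_left (abs_nonneg _) two_pi_inv).trans ?_
  have := h.dens.Pot_lip (z + k) z
  simpa [MM] using this

lemma w_deriv (h : Liou w) (z : ℂ) : HasFDerivAt w (-(1 / (2 * π)) • reMul (SS w z)) z :=
  hasFDerivAt_of_rem (C := 8 * MM w) fun k => by
    rw [Real.norm_eq_abs]; simpa using h.w_rem z k

lemma rho_rem (h : Liou w) (z k : ℂ) (hk : ‖k‖ ≤ 1) (hk2 : 2 * MM w * ‖k‖ ≤ 1) :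
    |Real.exp (w (z + k)) - Real.exp (w z) - Real.exp (w z) * (-(1 / (2 * π)) * (k * SS w z).re)| ≤
      Real.exp (w z) * ((4 * MM w ^ 2 + 8 * MM w) * (‖k‖ * √‖k‖)) := by
  set d := w (z + k) - w z with hd
  have h1 := h.w_lip z k
  have h2 := h.w_rem z k
  rw [← hd] at h1 h2
  have h3 := Real.abs_exp_sub_one_sub_id_le (h1.trans hk2)
  have e : Real.exp (w (z + k)) = Real.exp (w z) * Real.exp d := by
    rw [← Real.exp_add, hd]; congr 1; ring
  have e2 : Real.exp (w (z + k)) - Real.exp (w z) - Real.exp (w z) * (-(1 / (2 * π)) * (k * SS w z).re)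
    = Real.exp (w z) * ((Real.exp d - 1 - d) + (d - (-(1 / (2 * π)) * (k * SS w z).re))) := by
    rw [e]; ring
  rw [e2, abs_mul, abs_of_pos (Real.exp_pos _)]
  apply mul_le_mul_of_nonneg_left _ (Real.exp_pos _).le
  refine (abs_add_le _ _).trans ?_
  have h4 : d ^ 2 ≤ (2 * MM w * ‖k‖) ^ 2 := by
    rw [← sq_abs d]; exact pow_le_pow_left₀ (abs_nonneg _) h1 2
  have h5 : ‖k‖ ≤ √‖k‖ := by
    apply Real.le_sqrt_of_sq_le; nlinarith [norm_nonneg k]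
  have h6 : ‖k‖ * ‖k‖ ≤ ‖k‖ * √‖k‖ := mul_le_mul_of_nonneg_left h5 (norm_nonneg _)
  have h7 := mul_le_mul_of_nonneg_left h6 (by positivity : 0 ≤ 4 * MM w ^ 2)
  nlinarith

lemma densS (h : Liou w) : Dens (fun ζ => ((Real.exp (w ζ) : ℝ) : ℂ) * SS w ζ) (MM w) (MM w * ∫ ζ, Real.exp (w ζ)) := by
  have hb : ∀ ζ, ‖((Real.exp (w ζ) : ℝ) : ℂ) * SS w ζ‖ ≤ MM w * Real.exp (w ζ) := fun ζ => by
    rw [norm_mul, Complex.norm_real, Real.norm_eq_abs, abs_of_pos (Real.exp_pos _), mul_comm]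
    exact mul_le_mul_of_nonneg_right (h.SS_le ζ) (Real.exp_pos _).le
  have hi : Integrable (fun ζ => ((Real.exp (w ζ) : ℝ) : ℂ) * SS w ζ) :=
    (h.int.const_mul (MM w)).mono' (h.dens.ofReal.int.1.mul h.SS_cont.aestronglyMeasurable) (ae_of_all _ hb)
  refine ⟨hi, fun ζ => (hb ζ).trans (mul_le_of_le_one_right h.MM_nonneg (Real.exp_le_one_iff.2 (h.le ζ))), ?_⟩
  rw [← integral_const_mul]
  exact integral_mono hi.norm (h.int.const_mul _) hb

lemma densSc (h : Liou w) : Dens (fun ζ => ((Real.exp (w ζ) : ℝ) : ℂ) * (starRingEnd ℂ) (SS w ζ)) (MM w) (MM w * ∫ ζ, Real.exp (w ζ)) := by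
  have e : ∀ ζ, ‖((Real.exp (w ζ) : ℝ) : ℂ) * (starRingEnd ℂ) (SS w ζ)‖ = ‖((Real.exp (w ζ) : ℝ) : ℂ) * SS w ζ‖ := fun ζ => by
    rw [norm_mul, norm_mul, RCLike.norm_conj]
  refine ⟨?_, fun ζ => by rw [e]; exact h.densS.bd ζ, ?_⟩
  · refine h.densS.int.norm.mono' ?_ (ae_of_all _ fun ζ => (e ζ).le)
    exact h.dens.ofReal.int.1.mul (Complex.continuous_conj.comp h.SS_cont).aestronglyMeasurable
  · simp_rw [e]; exact h.densS.mass

/-- derivative of `S` -/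
def DS (w : ℂ → ℝ) (z : ℂ) : ℂ →L[ℝ] ℂ :=
  (-(SS w z) ^ 2 / (8 * π)) • ContinuousLinearMap.id ℝ ℂ + (-(QQ w z) / (4 * π)) • (Complex.conjCLE : ℂ →L[ℝ] ℂ)

lemma DS_apply (z k : ℂ) : DS w z k = -(SS w z) ^ 2 / (8 * π) * k + -(QQ w z) / (4 * π) * (starRingEnd ℂ) k := by
  simp [DS]

lemma DS_eq (h : Liou w) (z k : ℂ) :
    DS w z k = ∫ ζ, ((Real.exp (w ζ) * (-(1 / (2 * π)) * (k * SS w ζ).re) : ℝ) : ℂ) / (z - ζ) := by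
  have h1 := h.dens.ofReal.Cau_sq z
  have h1' : SS w z ^ 2 = 2 * Cau (fun ζ => ((Real.exp (w ζ) : ℝ) : ℂ) * SS w ζ) z := h1
  have e : ∀ ζ, ((Real.exp (w ζ) * (-(1 / (2 * π)) * (k * SS w ζ).re) : ℝ) : ℂ) / (z - ζ) =
      (-k / (4 * π)) * (((Real.exp (w ζ) : ℝ) : ℂ) * SS w ζ / (z - ζ)) + (-(starRingEnd ℂ) k / (4 * π)) * (((Real.exp (w ζ) : ℝ) : ℂ) * (starRingEnd ℂ) (SS w ζ) / (z - ζ)) := by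
    intro ζ
    have : (((k * SS w ζ).re : ℝ) : ℂ) = (k * SS w ζ + (starRingEnd ℂ) k * (starRingEnd ℂ) (SS w ζ)) / 2 := by
      rw [← map_mul, Complex.add_conj]; simp
    push_cast [this]
    ring
  simp_rw [e]
  rw [integral_add ((h.densS.Cau_int z).const_mul _) ((h.densSc.Cau_int z).const_mul _), integral_const_mul, integral_const_mul, DS_apply, h1']
  unfold QQ Cau
  ring

lemma S_shift (h : Liou w) (z k : ℂ) : Integrable (fun ζ => ((Real.exp (w (ζ + k)) : ℝ) : ℂ) / (z - ζ)) ∧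
    SS w (z + k) = ∫ ζ, ((Real.exp (w (ζ + k)) : ℝ) : ℂ) / (z - ζ) := by
  have e : (fun ζ => ((Real.exp (w (ζ + k)) : ℝ) : ℂ) / (z - ζ)) = fun ζ => (fun η => ((Real.exp (w η) : ℝ) : ℂ) / (z + k - η)) (ζ + k) := by
    ext ζ; simp
  rw [e]
  refine ⟨(h.dens.ofReal.Cau_int (z + k)).comp_add_right k, ?_⟩
  rw [integral_add_right_eq_self (fun η => ((Real.exp (w η) : ℝ) : ℂ) / (z + k - η))]
  rfl

lemma S_deriv (h : Liou w) (z : ℂ) : HasFDerivAt (SS w) (DS w z) z := by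
  have hM := h.MM_nonneg
  refine hasFDerivAt_of_rem' (δ := min 1 (1 / (2 * MM w + 1))) (C := (4 * MM w ^ 2 + 8 * MM w) * MM w) (by positivity) fun k hk => ?_
  have hk1 : ‖k‖ ≤ 1 := hk.trans (min_le_left _ _)
  have hk2 : 2 * MM w * ‖k‖ ≤ 1 := by
    have := hk.trans (min_le_right _ _)
    rw [le_div_iff₀ (by positivity)] at this
    nlinarith [norm_nonneg k]
  have hI : Integrable (fun ζ => ((Real.exp (w ζ) * (-(1 / (2 * π)) * (k * SS w ζ).re) : ℝ) : ℂ) / (z - ζ)) := by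
    have hd : Dens (fun ζ => ((Real.exp (w ζ) * (-(1 / (2 * π)) * (k * SS w ζ).re) : ℝ) : ℂ)) (‖k‖ * MM w) (‖k‖ * (MM w * ∫ ζ, Real.exp (w ζ))) := by
      have hb : ∀ ζ, ‖((Real.exp (w ζ) * (-(1 / (2 * π)) * (k * SS w ζ).re) : ℝ) : ℂ)‖ ≤ ‖k‖ * ‖((Real.exp (w ζ) : ℝ) : ℂ) * SS w ζ‖ := fun ζ => by
        rw [Complex.norm_real, norm_mul, norm_mul, norm_mul, Complex.norm_real, norm_neg, norm_of_nonneg two_pi_inv_pos.le]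
        have : ‖(k * SS w ζ).re‖ ≤ ‖k‖ * ‖SS w ζ‖ := (Complex.abs_re_le_norm _).trans (norm_mul_le _ _)
        have h2 : 1 / (2 * π) * ‖(k * SS w ζ).re‖ ≤ ‖k‖ * ‖SS w ζ‖ := (mul_le_of_le_one_left (norm_nonneg _) two_pi_inv).trans this
        have := mul_le_mul_of_nonneg_left h2 (norm_nonneg (Real.exp (w ζ)))
        linarith
      have hi : Integrable (fun ζ => ((Real.exp (w ζ) * (-(1 / (2 * π)) * (k * SS w ζ).re) : ℝ) : ℂ)) := by
        refine (h.densS.int.norm.const_mul ‖k‖).mono' ?_ (ae_of_all _ hb)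
        refine Complex.continuous_ofReal.comp_aestronglyMeasurable ?_
        refine h.int.1.mul (Continuous.aestronglyMeasurable ?_)
        have := h.SS_cont
        fun_prop
      refine ⟨hi, fun ζ => (hb ζ).trans (mul_le_mul_of_nonneg_left (h.densS.bd ζ) (norm_nonneg _)), ?_⟩
      refine (integral_mono hi.norm (h.densS.int.norm.const_mul ‖k‖) hb).trans ?_
      rw [integral_const_mul]
      exact mul_le_mul_of_nonneg_left h.densS.mass (norm_nonneg _)
    exact hd.Cau_int z
  obtain ⟨hs1, hs2⟩ := h.S_shift z k
  rw [hs2, h.DS_eq z k]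
  have hS : SS w z = ∫ ζ, ((Real.exp (w ζ) : ℝ) : ℂ) / (z - ζ) := rfl
  have hSi := h.dens.ofReal.Cau_int z
  have hs3 : Integrable (fun ζ => ((Real.exp (w (ζ + k)) : ℝ) : ℂ) / (z - ζ) - ((Real.exp (w ζ) : ℝ) : ℂ) / (z - ζ)) := hs1.sub hSi
  rw [hS, ← integral_sub hs1 hSi, ← integral_sub hs3 hI]
  refine (norm_integral_le_of_norm_le ((hSi.norm).const_mul ((4 * MM w ^ 2 + 8 * MM w) * (‖k‖ * √‖k‖))) (ae_of_all _ fun ζ => ?_)).trans ?_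
  · rw [← sub_div, ← sub_div, norm_div, norm_div]
    have := h.rho_rem ζ k hk1 hk2
    have e : ‖((Real.exp (w (ζ + k)) : ℝ) : ℂ) - ((Real.exp (w ζ) : ℝ) : ℂ) - ((Real.exp (w ζ) * (-(1 / (2 * π)) * (k * SS w ζ).re) : ℝ) : ℂ)‖ = |Real.exp (w (ζ + k)) - Real.exp (w ζ) - Real.exp (w ζ) * (-(1 / (2 * π)) * (k * SS w ζ).re)| := by
      rw [← Complex.ofReal_sub, ← Complex.ofReal_sub, Complex.norm_real, Real.norm_eq_abs]
    rw [e, Complex.norm_real, norm_of_nonneg (Real.exp_pos _).le, ← mul_div_assoc]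
    apply div_le_div_of_nonneg_right _ (norm_nonneg _)
    linarith
  · rw [integral_const_mul]
    have := h.dens.ofReal.Cau_norm_int_le z
    have h0 : 0 ≤ (4 * MM w ^ 2 + 8 * MM w) * (‖k‖ * √‖k‖) := by positivity
    have h1 := mul_le_mul_of_nonneg_left this h0
    refine h1.trans (le_of_eq ?_)
    unfold MM; ring

lemma Q_real (h : Liou w) (z : ℂ) : (QQ w z).im = 0 := by
  let L : ℂ →L[ℝ] (ℂ →L[ℝ] ℝ) := -(1 / (2 * π)) • ((ContinuousLinearMap.compL ℝ ℂ ℂ ℝ Complex.reCLM).comp ((ContinuousLinearMap.mul ℝ ℂ).flip))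
  have hL : ∀ c k, L c k = -(1 / (2 * π)) * (k * c).re := by intro c k; simp [L]; ring
  have h1 : ∀ y, HasFDerivAt w (L (SS w y)) y := fun y => by
    refine (h.w_deriv y).congr_fderiv ?_
    ext k; rw [hL]; simp
  have h2 : HasFDerivAt (fun y => L (SS w y)) (L.comp (DS w z)) z := L.hasFDerivAt.comp z (h.S_deriv z)
  have h3 := second_derivative_symmetric h1 h2 1 Complex.I
  simp only [ContinuousLinearMap.comp_apply, hL, DS_apply] at h3
  have h4 := mul_left_cancel₀ (by simp [Real.pi_ne_zero] : -(1 / (2 * π)) ≠ 0) h3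
  have e8 : ∀ a : ℂ, a / (8 * π) = ((1 / (8 * π) : ℝ) : ℂ) * a := by intro a; push_cast; ring
  have e4 : ∀ a : ℂ, a / (4 * π) = ((1 / (4 * π) : ℝ) : ℂ) * a := by intro a; push_cast; ring
  rw [e8, e4] at h4
  simp only [map_one, mul_one, one_mul, Complex.conj_I] at h4
  simp only [Complex.mul_re, Complex.mul_im, Complex.add_re, Complex.add_im, Complex.I_re, Complex.I_im, Complex.ofReal_re, Complex.ofReal_im, Complex.neg_re, Complex.neg_im] at h4
  have hp : 1 / (4 * π) ≠ 0 := by simp [Real.pi_ne_zero]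
  have h5 : 1 / (4 * π) * (QQ w z).im = 0 := by linarith
  exact (mul_eq_zero.1 h5).resolve_left hp

lemma S_zero (h : Liou w) : SS w 0 = 0 := by
  have h1 : IsLocalMax w 0 := Eventually.of_forall fun z => by simpa [h.z0] using h.le z
  have h2 := h1.hasFDerivAt_eq_zero (h.w_deriv 0)
  have h3 := congrArg (fun L : ℂ →L[ℝ] ℝ => L ((starRingEnd ℂ) (SS w 0))) h2
  simp only [smul_apply, reMul_apply, smul_eq_mul, zero_apply] at h3
  have h4 := (mul_eq_zero.1 h3).resolve_left (by simp [Real.pi_ne_zero])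
  rw [← Complex.normSq_eq_conj_mul_self, Complex.ofReal_re] at h4
  exact Complex.normSq_eq_zero.1 h4

def phi (w : ℂ → ℝ) (z : ℂ) : ℝ := Real.exp (-(1 / 2) * w z)

lemma phi_deriv (h : Liou w) (z : ℂ) : HasFDerivAt (phi w) ((phi w z * (1 / (4 * π))) • reMul (SS w z)) z := by
  have := ((h.w_deriv z).const_mul (-(1 / 2))).exp
  refine this.congr_fderiv ?_
  ext k; simp [phi]; ring

def ff (w : ℂ → ℝ) (z : ℂ) : ℂ := (starRingEnd ℂ) (phi w z • SS w z)

def gg (w : ℂ → ℝ) (z : ℂ) : ℝ := phi w z * (Complex.normSq (SS w z) / (8 * π) - (QQ w z).re / (4 * π))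

lemma f_deriv (h : Liou w) (z : ℂ) : HasDerivAt (ff w) (gg w z : ℂ) z := by
  have h1 := (h.phi_deriv z).smul (h.S_deriv z)
  have h2 : HasFDerivAt (ff w) _ z := ((Complex.conjCLE : ℂ →L[ℝ] ℂ).hasFDerivAt).comp z h1
  have hQ : QQ w z = ((QQ w z).re : ℂ) := by
    apply Complex.ext <;> simp [h.Q_real z]
  rw [hasDerivAt_iff_hasFDerivAt]
  refine hasFDerivAt_of_restrictScalars ℝ h2 ?_
  ext1 k
  simp only [ContinuousLinearMap.comp_apply, add_apply, smul_apply, ContinuousLinearMap.smulRight_apply, reMul_apply, DS_apply, smul_eq_mul, Complex.real_smul]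
  have e8 : ∀ a : ℂ, a / (8 * π) = ((1 / (8 * π) : ℝ) : ℂ) * a := by intro a; push_cast; ring
  have e4 : ∀ a : ℂ, a / (4 * π) = ((1 / (4 * π) : ℝ) : ℂ) * a := by intro a; push_cast; ring
  rw [hQ, e8, e4]
  have hre : (((k * SS w z).re : ℝ) : ℂ) = (k * SS w z + (starRingEnd ℂ) k * (starRingEnd ℂ) (SS w z)) / 2 := by
      rw [← map_mul, Complex.add_conj]; simp
  have hns : ((Complex.normSq (SS w z) : ℝ) : ℂ) = (starRingEnd ℂ) (SS w z) * SS w z := Complex.normSq_eq_conj_mul_self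
  have e2 : ∀ a : ℂ, a / 2 = ((1 / 2 : ℝ) : ℂ) * a := by intro a; push_cast; ring
  rw [Complex.ofReal_mul, hre, e2]
  simp only [ContinuousLinearEquiv.coe_coe, Complex.conjCLE_apply, map_add, map_mul, map_neg, map_pow, Complex.conj_conj, Complex.conj_ofReal]
  simp only [gg, ContinuousLinearMap.coe_restrictScalars', ContinuousLinearMap.toSpanSingleton_apply, smul_eq_mul]
  push_cast
  rw [hns]
  ring

lemma f_lin (h : Liou w) : ∃ c : ℝ, ∀ z, ff w z = c * z := by
  have hd : Differentiable ℂ (ff w) := fun z => (h.f_deriv z).differentiableAt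
  have hder : deriv (ff w) = fun z => (gg w z : ℂ) := by ext z; exact (h.f_deriv z).deriv
  have hA : AnalyticOnNhd ℂ (deriv (ff w)) Set.univ := by
    intro z _; exact (hd.analyticAt z).deriv
  obtain ⟨c, hc⟩ := AnalyticOnNhd.eq_const_of_im_eq_const (c₀ := 0) hA (by intro z _; rw [hder]; simp) isOpen_univ isConnected_univ
  refine ⟨c.re, fun z => ?_⟩
  have hcr : c = (c.re : ℂ) := by
    have := hc 0 (Set.mem_univ _)
    rw [hder] at this
    rw [← this]; simp
  have h0 : ff w 0 = 0 := by simp [ff, h.S_zero]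
  have hd2 : Differentiable ℂ (fun z => ff w z - c * z) := hd.sub (by fun_prop)
  have := is_const_of_deriv_eq_zero hd2 (fun x => by
    have h1 : HasDerivAt (fun z => ff w z - c * z) (deriv (ff w) x - c * 1) x := (hd x).hasDerivAt.sub ((hasDerivAt_id x).const_mul c)
    rw [h1.deriv, hc x (Set.mem_univ _)]; simp) z 0
  rw [h0] at this
  simp only [mul_zero, sub_zero, sub_eq_zero] at this
  rw [← hcr]; exact this

lemma S_form (h : Liou w) : ∃ c : ℝ, ∀ z, phi w z • SS w z = (8 * π * c) * (starRingEnd ℂ) z := by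
  obtain ⟨c, hc⟩ := h.f_lin
  refine ⟨c / (8 * π), fun z => ?_⟩
  have := congrArg (starRingEnd ℂ) (hc z)
  simp only [ff, Complex.conj_conj, map_mul, Complex.conj_ofReal] at this
  rw [this]
  have : (π : ℂ) ≠ 0 := by exact_mod_cast Real.pi_ne_zero
  push_cast
  field_simp

lemma phi_form (h : Liou w) {c : ℝ} (hc : ∀ z, phi w z • SS w z = (8 * π * c) * (starRingEnd ℂ) z) (z : ℂ) :
    phi w z = 1 + c * ‖z‖ ^ 2 := by
  have hd : ∀ z : ℂ, HasFDerivAt (fun z : ℂ => phi w z - c * Complex.normSq z) (0 : ℂ →L[ℝ] ℝ) z := by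
    intro z
    have h1 : HasFDerivAt (fun z : ℂ => Complex.normSq z) (2 • reMul ((starRingEnd ℂ) z)) z := by
      have : HasFDerivAt (fun z : ℂ => z.re * z.re + z.im * z.im) _ z := ((Complex.reCLM.hasFDerivAt (x := z)).mul Complex.reCLM.hasFDerivAt).add ((Complex.imCLM.hasFDerivAt (x := z)).mul Complex.imCLM.hasFDerivAt)
      refine this.congr_fderiv ?_
      ext k; simp; ring
    refine ((h.phi_deriv z).sub (h1.const_mul c)).congr_fderiv ?_
    ext k
    have := congrArg (fun a => (1 / (4 * π) : ℝ) * (k * a).re) (hc z)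
    simp only [sub_apply, smul_apply, reMul_apply, zero_apply, smul_eq_mul, nsmul_eq_mul]
    have e1 : (k * phi w z • SS w z).re = phi w z * (k * SS w z).re := by
      rw [Complex.real_smul, mul_left_comm, Complex.re_ofReal_mul]
    have e2 : (k * (8 * π * c * (starRingEnd ℂ) z)).re = 8 * π * c * (k * (starRingEnd ℂ) z).re := by
      have : k * (8 * π * c * (starRingEnd ℂ) z) = ((8 * π * c : ℝ) : ℂ) * (k * (starRingEnd ℂ) z) := by push_cast; ring
      rw [this, Complex.re_ofReal_mul]
    rw [e1, e2] at this
    have e3 : 1 / (4 * π) * (8 * π * c * (k * (starRingEnd ℂ) z).re) = 2 * c * (k * (starRingEnd ℂ) z).re := by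
      field_simp; ring
    rw [e3] at this
    push_cast
    linarith
  have h2 := is_const_of_fderiv_eq_zero (𝕜 := ℝ) (fun z => (hd z).differentiableAt) (fun z => (hd z).fderiv) z 0
  have h3 : phi w 0 = 1 := by simp [phi, h.z0]
  simp only [h3, map_zero, mul_zero, sub_zero] at h2
  rw [← Complex.normSq_eq_norm_sq]
  linarith

theorem classify (h : Liou w) (z : ℂ) : w z = Ub z := by
  obtain ⟨c, hc⟩ := h.S_form
  have hphi := h.phi_form hc
  have hpos : ∀ z, 0 < 1 + c * ‖z‖ ^ 2 := fun z => by rw [← hphi z]; exact Real.exp_pos _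
  have hw : ∀ z, w z = -2 * Real.log (1 + c * ‖z‖ ^ 2) := fun z => by
    rw [← hphi z, phi, Real.log_exp]; ring
  have hexp : ∀ z, Real.exp (w z) = ((1 + c * ‖z‖ ^ 2) ^ 2)⁻¹ := fun z => by
    rw [hw z, neg_mul, Real.exp_neg, two_mul, Real.exp_add, Real.exp_log (hpos z), ← sq]
  have hc0 : 0 ≤ c := by
    by_contra hneg
    push Not at hneg
    have := hpos (√(1 / (-c)) : ℝ)
    rw [Complex.norm_real, norm_of_nonneg (Real.sqrt_nonneg _), Real.sq_sqrt (by apply le_of_lt; apply one_div_pos.2; linarith)] at this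
    have e : c * (1 / -c) = -1 := by have := hneg.ne; rw [div_neg, mul_neg, mul_one_div_cancel this]
    rw [e] at this; linarith
  have hcpos : 0 < c := by
    rcases hc0.lt_or_eq with h1 | h1
    · exact h1
    · exfalso
      have := h.int
      simp_rw [hexp, ← h1] at this
      simp at this
      rw [integrable_const_iff] at this
      simp [isFiniteMeasure_iff] at this
  -- moment identity
  have hS : ∀ z, SS w z = (8 * π * c / (1 + c * ‖z‖ ^ 2) : ℝ) * (starRingEnd ℂ) z := fun z => by
    have := hc z
    rw [hphi z, Complex.real_smul] at this
    have h0 : ((1 + c * ‖z‖ ^ 2 : ℝ) : ℂ) ≠ 0 := by exact_mod_cast (hpos z).ne'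
    rw [Complex.ofReal_div]
    field_simp
    rw [mul_comm, this]; push_cast; ring
  have hI : Integrable (fun a : ℂ => (a - 0) * ((Real.exp (w a) : ℝ) : ℂ)) := by
    refine (bub_int_norm hcpos).mono' ?_ (ae_of_all _ fun a => ?_)
    · exact (by fun_prop : Continuous fun a : ℂ => a - 0).aestronglyMeasurable.mul h.dens.ofReal.int.1
    · rw [sub_zero, norm_mul, Complex.norm_real, norm_of_nonneg (Real.exp_pos _).le, hexp]
      exact mul_le_mul_of_nonneg_right (by linarith [norm_nonneg a]) (by positivity)
  have hm := h.dens.ofReal.Cau_moment 0 hI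
  have e1 : ∫ a, ((Real.exp (w a) : ℝ) : ℂ) = ((π / c : ℝ) : ℂ) := by
    rw [integral_complex_ofReal]; congr 1; simp_rw [hexp]; exact bub_mass hcpos
  have e2 : ∀ a, (a - 0) * ((Real.exp (w a) : ℝ) : ℂ) * Cau (fun ζ => ((Real.exp (w ζ) : ℝ) : ℂ)) a = ((8 * π * ((c * ‖a‖ ^ 2) * ((1 + c * ‖a‖ ^ 2) ^ 3)⁻¹) : ℝ) : ℂ) := by
    intro a
    have : Cau (fun ζ => ((Real.exp (w ζ) : ℝ) : ℂ)) a = SS w a := rfl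
    rw [this, hS a, hexp]
    have e : a * (starRingEnd ℂ) a = ((‖a‖ ^ 2 : ℝ) : ℂ) := by
      rw [Complex.mul_conj, Complex.normSq_eq_norm_sq]
    have h0 := (hpos a).ne'
    have : (a - 0) * (((1 + c * ‖a‖ ^ 2) ^ 2)⁻¹ : ℝ) * ((8 * π * c / (1 + c * ‖a‖ ^ 2) : ℝ) * (starRingEnd ℂ) a) = (((1 + c * ‖a‖ ^ 2) ^ 2)⁻¹ : ℝ) * (8 * π * c / (1 + c * ‖a‖ ^ 2) : ℝ) * (a * (starRingEnd ℂ) a) := by ring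
    rw [this, e, ← Complex.ofReal_mul, ← Complex.ofReal_mul]
    congr 1; field_simp
  rw [e1] at hm
  simp_rw [e2] at hm
  rw [integral_complex_ofReal, integral_const_mul, bub_moment hcpos] at hm
  have hm' : 2 * (8 * π * (π / (2 * c))) = (π / c) ^ 2 := by exact_mod_cast hm
  have hc8 : c = 1 / 8 := by
    have hp := Real.pi_pos
    field_simp at hm'
    linarith
  rw [hw z, Ub, hc8]; congr 3; ring

end Liou

lemma pot_tail {ρ : ℂ → ℝ} {B K : ℝ} (h : Dens ρ B K) {z : ℂ} {R : ℝ} (hR : 0 < R) (hz : 2 * ‖z‖ ≤ R) :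
    |Pot ρ z - ∫ ζ in ball (0:ℂ) R, (Real.log ‖z - ζ‖ - Real.log ‖ζ‖) * ρ ζ| ≤ 3 * ‖z‖ / R * K := by
  have hI := h.Pot_int z
  have e : Pot ρ z - ∫ ζ in ball (0:ℂ) R, (Real.log ‖z - ζ‖ - Real.log ‖ζ‖) * ρ ζ = ∫ ζ in (ball (0:ℂ) R)ᶜ, (Real.log ‖z - ζ‖ - Real.log ‖ζ‖) * ρ ζ := by
    rw [Pot, ← integral_add_compl measurableSet_ball hI]; ring
  rw [e, ← Real.norm_eq_abs]
  have hb : ∀ ζ ∈ (ball (0:ℂ) R)ᶜ, ‖(Real.log ‖z - ζ‖ - Real.log ‖ζ‖) * ρ ζ‖ ≤ 3 * ‖z‖ / R * ‖ρ ζ‖ := by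
    intro ζ hζ
    have hζ : R ≤ ‖ζ‖ := by simpa using hζ
    rw [norm_mul]
    apply mul_le_mul_of_nonneg_right _ (norm_nonneg _)
    have h1 : R / 2 ≤ ‖z - ζ‖ := by
      have := norm_sub_norm_le ζ z; rw [norm_sub_rev] at this; linarith
    have h2 := log_sub_le (by linarith : 0 < ‖z - ζ‖) (by linarith : 0 < ‖ζ‖)
    have h3 : |‖z - ζ‖ - ‖ζ‖| ≤ ‖z‖ := by
      have := abs_norm_sub_norm_le (z - ζ) (-ζ); simpa using this
    have h4 : ‖z - ζ‖⁻¹ ≤ 2 / R := by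
      have := inv_anti₀ (by positivity) h1; rw [inv_div] at this; exact this
    have h5 : ‖ζ‖⁻¹ ≤ 1 / R := by rw [one_div]; exact inv_anti₀ hR hζ
    rw [Real.norm_eq_abs]
    calc _ ≤ _ := h2
      _ ≤ ‖z‖ * (2 / R + 1 / R) := mul_le_mul h3 (add_le_add h4 h5) (by positivity) (norm_nonneg _)
      _ = _ := by ring
  refine (norm_integral_le_of_norm_le ((h.int.norm.const_mul (3 * ‖z‖ / R)).integrableOn (s := (ball (0:ℂ) R)ᶜ)) ?_).trans ?_
  · exact (ae_restrict_iff' measurableSet_ball.compl).2 (ae_of_all _ hb)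
  · rw [integral_const_mul]
    apply mul_le_mul_of_nonneg_left _ (by positivity)
    exact (setIntegral_le_integral h.int.norm (ae_of_all _ fun _ => norm_nonneg _)).trans h.mass

lemma tendsto_pow_exp {p w : ℕ → ℝ} {l : ℝ} (hp : Tendsto p atTop atTop) (hw : Tendsto w atTop (𝓝 l)) :
    Tendsto (fun n => |1 + w n / p n| ^ (p n - 1) * (1 + w n / p n)) atTop (𝓝 (Real.exp l)) := by
  have h0 : Tendsto (fun n => w n / p n) atTop (𝓝 0) := hw.div_atTop hp
  have h1 : Tendsto (fun n => 1 + w n / p n) atTop (𝓝 1) := by simpa using h0.const_add 1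
  have hpos : ∀ᶠ n in atTop, 0 < 1 + w n / p n := h1.eventually (lt_mem_nhds one_pos)
  have h2 : Tendsto (fun n => p n * Real.log (1 + w n / p n)) atTop (𝓝 l) := by
    have h3 : Tendsto (fun n => w n / (1 + w n / p n)) atTop (𝓝 l) := by
      have := hw.div h1 one_ne_zero
      rw [div_one] at this; exact this
    refine tendsto_of_tendsto_of_tendsto_of_le_of_le' h3 hw ?_ ?_
    · filter_upwards [hpos, hp.eventually_gt_atTop 0] with n hn hpn
      have := Real.one_sub_inv_le_log_of_pos hn
      have := mul_le_mul_of_nonneg_left this hpn.le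
      refine le_trans (le_of_eq ?_) this
      have e : w n = p n * (w n / p n) := by field_simp
      generalize w n / p n = t at *
      rw [e]
      have := hn.ne'
      field_simp; ring
    · filter_upwards [hpos, hp.eventually_gt_atTop 0] with n hn hpn
      have := Real.log_le_sub_one_of_pos hn
      have := mul_le_mul_of_nonneg_left this hpn.le
      refine this.trans (le_of_eq ?_)
      field_simp; ring
  refine ((Real.continuous_exp.tendsto l).comp h2).congr' ?_
  filter_upwards [hpos] with n hn
  rw [abs_of_pos hn, Real.rpow_sub_one hn.ne', div_mul_cancel₀ _ hn.ne', Real.rpow_def_of_pos hn]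
  simp [mul_comm]

/-- Blow-up sequences. -/
structure BlowSeq (p : ℕ → ℝ) (κ w E : ℕ → ℂ → ℝ) (τ : ℕ → ℝ) (K : ℝ) : Prop where
  hp : Tendsto p atTop atTop
  dens : ∀ᶠ n in atTop, Dens (κ n) 1 K
  rep : ∀ᶠ n in atTop, ∀ z, w n z = -(1 / (2 * π)) * Pot (κ n) z + E n z
  E0 : ∀ᶠ n in atTop, E n 0 = 0
  Elip : ∀ᶠ n in atTop, ∀ z z', |E n z - E n z'| ≤ τ n * ‖z - z'‖
  hτ : Tendsto τ atTop (𝓝 0)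
  loc : ∀ R : ℝ, ∀ᶠ n in atTop, ∀ z, ‖z‖ ≤ R → w n z ≤ 0 ∧
    κ n z = |1 + w n z / p n| ^ (p n - 1) * (1 + w n z / p n)

namespace BlowSeq
variable {p : ℕ → ℝ} {κ w E : ℕ → ℂ → ℝ} {τ : ℕ → ℝ} {K : ℝ}

lemma comp (h : BlowSeq p κ w E τ K) {φ : ℕ → ℕ} (hφ : Tendsto φ atTop atTop) :
    BlowSeq (p ∘ φ) (κ ∘ φ) (w ∘ φ) (E ∘ φ) (τ ∘ φ) K :=
  ⟨h.hp.comp hφ, hφ.eventually h.dens, hφ.eventually h.rep, hφ.eventually h.E0, hφ.eventually h.Elip,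
    h.hτ.comp hφ, fun R => hφ.eventually (h.loc R)⟩

lemma w0 (h : BlowSeq p κ w E τ K) : ∀ᶠ n in atTop, w n 0 = 0 := by
  filter_upwards [h.rep, h.E0] with n h1 h2
  rw [h1, h2]; simp [Pot]

lemma K_nonneg (h : BlowSeq p κ w E τ K) : 0 ≤ K := by
  obtain ⟨n, hn⟩ := h.dens.exists; exact hn.K_nonneg

lemma lip (h : BlowSeq p κ w E τ K) : ∀ᶠ n in atTop, ∀ z z', |w n z - w n z'| ≤ (2 * (cK + K) + 1) * ‖z - z'‖ := by
  filter_upwards [h.dens, h.rep, h.Elip, h.hτ.eventually (gt_mem_nhds one_pos)] with n h1 h2 h3 h4 z z'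
  rw [h2, h2]
  have e : ∀ a b c d e : ℝ, -e * a + b - (-e * c + d) = -e * (a - c) + (b - d) := by intros; ring
  rw [e]
  have h5 := h1.Pot_lip z z'
  have h6 := h3 z z'
  have h7 : |-(1 / (2 * π)) * (Pot (κ n) z - Pot (κ n) z')| ≤ 2 * (cK + K) * ‖z - z'‖ := by
    rw [abs_mul, abs_neg, abs_of_pos Liou.two_pi_inv_pos]
    refine (mul_le_of_le_one_left (abs_nonneg _) Liou.two_pi_inv).trans ?_
    simpa using h5
  refine (abs_add_le _ _).trans ?_
  nlinarith [norm_nonneg (z - z')]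

lemma sub_conv (h : BlowSeq p κ w E τ K) : ∃ φ : ℕ → ℕ, StrictMono φ ∧ ∃ W : ℂ → ℝ, ∀ z, Tendsto (fun n => w (φ n) z) atTop (𝓝 (W z)) := by
  set L := 2 * (cK + K) + 1 with hL
  have hL0 : 0 ≤ L := by have := cK_nonneg; have := h.K_nonneg; positivity
  let d := TopologicalSpace.denseSeq ℂ
  have hcomp : IsCompact (Set.univ.pi fun i : ℕ => Set.Icc (-(L * ‖d i‖)) (L * ‖d i‖)) :=
    isCompact_univ_pi fun i => isCompact_Icc
  have hmem : ∃ᶠ n in atTop, (fun i => w n (d i)) ∈ (Set.univ.pi fun i : ℕ => Set.Icc (-(L * ‖d i‖)) (L * ‖d i‖)) := by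
    apply Eventually.frequently
    filter_upwards [h.lip, h.w0] with n h1 h2
    intro i _
    have := h1 (d i) 0
    rw [h2, sub_zero, sub_zero, abs_le] at this
    exact this
  obtain ⟨a, _, φ, hφ, hlim⟩ := hcomp.tendsto_subseq' hmem
  have hlim' : ∀ i, Tendsto (fun n => w (φ n) (d i)) atTop (𝓝 (a i)) := by
    rw [tendsto_pi_nhds] at hlim; exact hlim
  have hC : ∀ z, ∃ l, Tendsto (fun n => w (φ n) z) atTop (𝓝 l) := by
    intro z
    apply cauchySeq_tendsto_of_complete
    rw [Metric.cauchySeq_iff]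
    intro ε hε
    obtain ⟨i, hi⟩ : ∃ i, dist z (d i) < ε / (3 * (L + 1)) := by
      have := (TopologicalSpace.denseRange_denseSeq ℂ).exists_dist_lt z (by positivity : 0 < ε / (3 * (L + 1)))
      exact this
    have hc := (hlim' i).cauchySeq
    rw [Metric.cauchySeq_iff] at hc
    obtain ⟨N, hN⟩ := hc (ε / 3) (by positivity)
    obtain ⟨N2, hN2⟩ := eventually_atTop.1 (hφ.tendsto_atTop.eventually h.lip)
    refine ⟨max N N2, fun m hm n hn => ?_⟩
    have h1 := hN m (le_of_max_le_left hm) n (le_of_max_le_left hn)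
    have h2 := hN2 m (le_of_max_le_right hm) z (d i)
    have h3 := hN2 n (le_of_max_le_right hn) z (d i)
    rw [Real.dist_eq] at h1 ⊢
    rw [dist_eq_norm, lt_div_iff₀ (by positivity)] at hi
    have h4 : L * ‖z - d i‖ < ε / 3 := by nlinarith [norm_nonneg (z - d i)]
    rw [← hL] at h2 h3
    have h5 := abs_lt.1 h1
    have h6 := abs_le.1 h2
    have h7 := abs_le.1 h3
    rw [abs_lt]; constructor <;> linarith
  choose W hW using hC
  exact ⟨φ, hφ, W, hW⟩

lemma lim_eq (h : BlowSeq p κ w E τ K) {W : ℂ → ℝ} (hW : ∀ z, Tendsto (fun n => w n z) atTop (𝓝 (W z))) : Liou W := by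
  have hK := h.K_nonneg
  have hWle : ∀ z, W z ≤ 0 := fun z => le_of_tendsto (hW z) (by
    filter_upwards [h.loc ‖z‖] with n hn using (hn z le_rfl).1)
  have hW0 : W 0 = 0 := tendsto_nhds_unique (hW 0) (tendsto_const_nhds.congr' (by
    filter_upwards [h.w0] with n hn using hn.symm))
  have hWlip : ∀ z z', |W z - W z'| ≤ (2 * (cK + K) + 1) * ‖z - z'‖ := fun z z' =>
    le_of_tendsto ((hW z).sub (hW z')).abs (by filter_upwards [h.lip] with n hn using hn z z')
  have hWc : Continuous W := by
    have : LipschitzWith (Real.toNNReal (2 * (cK + K) + 1)) W := LipschitzWith.of_dist_le' fun z z' => by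
      rw [Real.dist_eq, dist_eq_norm]; exact hWlip z z'
    exact this.continuous
  have hκ : ∀ z, Tendsto (fun n => κ n z) atTop (𝓝 (Real.exp (W z))) := fun z => by
    refine (tendsto_pow_exp h.hp (hW z)).congr' ?_
    filter_upwards [h.loc ‖z‖] with n hn using (hn z le_rfl).2.symm
  have hlint : ∫⁻ z, ENNReal.ofReal (Real.exp (W z)) ≤ ENNReal.ofReal K := by
    obtain ⟨N, hN⟩ := eventually_atTop.1 h.dens
    have e : ∀ z, ENNReal.ofReal (Real.exp (W z)) = liminf (fun n => ‖κ (n + N) z‖ₑ) atTop := by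
      intro z
      have h1 := ((hκ z).comp (tendsto_add_atTop_nat N)).enorm
      have h2 : ‖Real.exp (W z)‖ₑ = ENNReal.ofReal (Real.exp (W z)) := Real.enorm_of_nonneg (Real.exp_pos _).le
      rw [← h2]; exact h1.liminf_eq.symm
    simp_rw [e]
    refine (lintegral_liminf_le' fun n => (hN (n + N) (by omega)).int.1.enorm).trans ?_
    refine liminf_le_of_le (by isBoundedDefault) fun b hb => ?_
    obtain ⟨n, hn⟩ := hb.exists
    refine hn.trans ?_
    have := hN (n + N) (by omega)
    rw [← ofReal_integral_norm_eq_lintegral_enorm this.int]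
    exact ENNReal.ofReal_le_ofReal this.mass
  have hIntg : Integrable (fun z => Real.exp (W z)) := by
    refine ⟨(Real.continuous_exp.comp hWc).aestronglyMeasurable, ?_⟩
    rw [hasFiniteIntegral_iff_ofReal (ae_of_all _ fun z => (Real.exp_pos _).le)]
    exact hlint.trans_lt ENNReal.ofReal_lt_top
  have hmass : ∫ z, Real.exp (W z) ≤ K := by
    rw [integral_eq_lintegral_of_nonneg_ae (ae_of_all _ fun z => (Real.exp_pos _).le) hIntg.1]
    exact ENNReal.toReal_le_of_le_ofReal hK hlint
  have hdW : Dens (fun z => Real.exp (W z)) 1 K := by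
    refine ⟨hIntg, fun z => ?_, ?_⟩
    · rw [norm_of_nonneg (Real.exp_pos _).le]; exact Real.exp_le_one_iff.2 (hWle z)
    · simp_rw [norm_of_nonneg (Real.exp_pos _).le]; exact hmass
  refine ⟨hW0, hWle, hIntg, fun z => ?_⟩
  -- convergence of potentials
  have hball : ∀ R : ℝ, Tendsto (fun n => ∫ ζ in ball (0:ℂ) R, (Real.log ‖z - ζ‖ - Real.log ‖ζ‖) * κ n ζ) atTop
      (𝓝 (∫ ζ in ball (0:ℂ) R, (Real.log ‖z - ζ‖ - Real.log ‖ζ‖) * Real.exp (W ζ))) := by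
    intro R
    refine tendsto_integral_filter_of_dominated_convergence (fun ζ => |Real.log ‖z - ζ‖ - Real.log ‖ζ‖|) ?_ ?_ ?_ ?_
    · filter_upwards [h.dens] with n hn
      exact ((by fun_prop : Measurable fun ζ : ℂ => Real.log ‖z - ζ‖ - Real.log ‖ζ‖).aestronglyMeasurable.mul hn.int.1).restrict
    · filter_upwards [h.dens] with n hn
      refine ae_of_all _ fun ζ => ?_
      rw [norm_mul, Real.norm_eq_abs]
      exact mul_le_of_le_one_right (abs_nonneg _) (hn.bd ζ)
    · have hd : Dens ((ball (0:ℂ) R).indicator (fun _ => (1:ℝ))) 1 (volume.real (ball (0:ℂ) R)) := by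
        refine ⟨?_, ?_, ?_⟩
        · rw [integrable_indicator_iff measurableSet_ball]; exact integrableOn_const measure_ball_lt_top.ne
        · intro ζ; by_cases hζ : ζ ∈ ball (0:ℂ) R <;> simp [Set.indicator, hζ]
        · simp_rw [norm_indicator_eq_indicator_norm]
          rw [integral_indicator measurableSet_ball]; simp
      have := (hd.Pot_int z).abs
      have h2 : IntegrableOn (fun ζ => |(Real.log ‖z - ζ‖ - Real.log ‖ζ‖) * (ball (0:ℂ) R).indicator (fun _ => (1:ℝ)) ζ|) (ball 0 R) := this.integrableOn
      refine h2.congr_fun (fun ζ hζ => ?_) measurableSet_ball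
      simp [Set.indicator_of_mem hζ]
    · exact ae_of_all _ fun ζ => (hκ ζ).const_mul _
  have hpot : Tendsto (fun n => Pot (κ n) z) atTop (𝓝 (Pot (fun ζ => Real.exp (W ζ)) z)) := by
    rw [Metric.tendsto_atTop']
    intro ε hε
    set R := 2 * ‖z‖ + 1 + 12 * ‖z‖ * K / ε with hR
    have hRpos : 0 < R := by positivity
    have hRz : 2 * ‖z‖ ≤ R := by
      have : 0 ≤ 12 * ‖z‖ * K / ε := by positivity
      linarith
    have hsm : 3 * ‖z‖ / R * K < ε / 3 := by
      rw [div_mul_eq_mul_div, div_lt_iff₀ hRpos, hR]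
      have : ε / 3 * (12 * ‖z‖ * K / ε) = 4 * ‖z‖ * K := by field_simp; ring
      have h0 : 0 < ε / 3 * (2 * ‖z‖ + 1) := by positivity
      have : 0 ≤ ‖z‖ * K := by positivity
      nlinarith
    have h1 := pot_tail hdW hRpos hRz
    obtain ⟨N, hN⟩ := eventually_atTop.1 (((Metric.tendsto_nhds.1 (hball R)) (ε / 3) (by positivity)).and h.dens)
    refine ⟨N, fun n hn => ?_⟩
    obtain ⟨h2, h3⟩ := hN n hn.le
    have h4 := pot_tail h3 hRpos hRz
    rw [Real.dist_eq] at h2 ⊢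
    have h1 := abs_le.1 h1
    have h2 := abs_lt.1 h2
    have h4 := abs_le.1 h4
    rw [abs_lt]; constructor <;> linarith
  have hE : Tendsto (fun n => E n z) atTop (𝓝 0) := by
    have : Tendsto (fun n => τ n * ‖z‖) atTop (𝓝 0) := by simpa using h.hτ.mul_const ‖z‖
    refine squeeze_zero_norm' ?_ this
    filter_upwards [h.E0, h.Elip] with n h1 h2
    have := h2 z 0
    rwa [h1, sub_zero, sub_zero] at this
  have h5 := (hpot.const_mul (-(1 / (2 * π)))).add hE
  rw [add_zero] at h5
  refine tendsto_nhds_unique (hW z) (h5.congr' ?_)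
  filter_upwards [h.rep] with n hn using (hn z).symm

theorem conv (h : BlowSeq p κ w E τ K) (z : ℂ) : Tendsto (fun n => w n z) atTop (𝓝 (Ub z)) := by
  refine tendsto_of_subseq_tendsto fun ns hns => ?_
  obtain ⟨φ, hφ, W, hW⟩ := (h.comp hns).sub_conv
  have h2 := ((h.comp hns).comp hφ.tendsto_atTop)
  have h3 := h2.lim_eq hW
  refine ⟨φ, ?_⟩
  rw [← h3.classify z]
  exact hW z

theorem conv_kappa (h : BlowSeq p κ w E τ K) (z : ℂ) : Tendsto (fun n => κ n z) atTop (𝓝 (Real.exp (Ub z))) := by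
  refine (tendsto_pow_exp h.hp (h.conv z)).congr' ?_
  filter_upwards [h.loc ‖z‖] with n hn using (hn z le_rfl).2.symm

end BlowSeq

lemma pow_geom {p : ℕ → ℝ} (hp : Tendsto p atTop atTop) (j : ℕ) {t : ℝ} (ht0 : 0 < t) (ht : t < 1) :
    Tendsto (fun n => p n ^ j * t ^ p n) atTop (𝓝 0) := by
  have h := tendsto_rpow_mul_exp_neg_mul_atTop_nhds_zero j (-Real.log t) (by have := Real.log_neg ht0 ht; linarith)
  refine (h.comp hp).congr fun n => ?_
  simp only [Function.comp, neg_neg, Real.rpow_natCast]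
  rw [Real.rpow_def_of_pos ht0]

lemma pow_super {p : ℕ → ℝ} (hp : Tendsto p atTop atTop) (j : ℕ) {K : ℝ} (hK : 0 ≤ K) :
    Tendsto (fun n => p n ^ j * (K / p n) ^ p n) atTop (𝓝 0) := by
  refine tendsto_of_tendsto_of_tendsto_of_le_of_le' tendsto_const_nhds (pow_geom hp j (t := 1/2) (by norm_num) (by norm_num)) ?_ ?_
  · filter_upwards [hp.eventually_gt_atTop 0] with n hn; positivity
  · filter_upwards [hp.eventually_gt_atTop 0, hp.eventually_ge_atTop (2 * K)] with n hn h2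
    apply mul_le_mul_of_nonneg_left _ (by positivity)
    apply Real.rpow_le_rpow (by positivity) _ hn.le
    rw [div_le_div_iff₀ hn (by norm_num)]; linarith

def dns (b p : ℝ) (v : ℂ → ℝ) : ℂ → ℝ := (ball (0:ℂ) b).indicator (fun y => p * (|v y| ^ (p - 1) * v y))

lemma dns_in {b p : ℝ} {v : ℂ → ℝ} {y : ℂ} (hy : ‖y‖ < b) : dns b p v y = p * (|v y| ^ (p - 1) * v y) := by
  rw [dns, Set.indicator_of_mem (by simpa using hy)]

lemma dns_out {b p : ℝ} {v : ℂ → ℝ} {y : ℂ} (hy : b ≤ ‖y‖) : dns b p v y = 0 := by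
  rw [dns, Set.indicator_of_notMem (by simpa using hy)]

lemma abs_pow_mul {p : ℝ} (hp : 1 < p) (t : ℝ) : |t| ^ (p - 1) * |t| = |t| ^ p := by
  rcases eq_or_ne t 0 with rfl | h
  · simp [Real.zero_rpow (by linarith : p ≠ 0)]
  · rw [Real.rpow_sub_one (by positivity), div_mul_cancel₀]; positivity

lemma dns_abs {b p : ℝ} (hp : 1 < p) {v : ℂ → ℝ} {y : ℂ} (hy : ‖y‖ < b) : |dns b p v y| = p * |v y| ^ p := by
  rw [dns_in hy, abs_mul, abs_mul, abs_of_pos (by linarith : 0 < p), abs_of_nonneg (by positivity : 0 ≤ |v y| ^ (p-1)), abs_pow_mul hp]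

lemma dns_mul {b p : ℝ} (hp : 1 < p) {v : ℂ → ℝ} {y : ℂ} (hy : ‖y‖ < b) : dns b p v y * v y = p * |v y| ^ (p + 1) := by
  rw [dns_in hy, mul_assoc, mul_assoc, ← abs_mul_abs_self (v y), ← mul_assoc (|v y| ^ (p-1)), abs_pow_mul hp]
  congr 1
  rcases eq_or_ne (v y) 0 with h | h
  · rw [h]; simp [Real.zero_rpow (by linarith : p + 1 ≠ 0)]
  · rw [Real.rpow_add_one (by positivity)]

structure Loc (p : ℕ → ℝ) (v e : ℕ → ℂ → ℝ) (b L : ℝ) (h : ℂ → ℝ) : Prop where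
  b0 : 0 < b
  b1 : b ≤ 1 / 2
  hp1 : ∀ n, 1 < p n
  hp : Tendsto p atTop atTop
  cont : ∀ n, ContinuousOn (v n) (closedBall 0 b)
  smooth : ∀ n, ContDiffOn ℝ 1 (v n) (ball 0 b)
  rep : ∀ n, ∀ x, ‖x‖ ≤ b → p n * v n x = -(1 / (2 * π)) * (∫ y, Real.log ‖x - y‖ * dns b (p n) (v n) y) + e n x
  L0 : 0 ≤ L
  elip : ∀ᶠ n in atTop, ∀ x x', |e n x - e n x'| ≤ L * ‖x - x'‖
  bnd : ∀ s, 0 < s → ∃ K, ∀ᶠ n in atTop, ∀ x : ℂ, s ≤ ‖x‖ → ‖x‖ ≤ b → |p n * v n x| ≤ K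
  lim : ∀ x : ℂ, 0 < ‖x‖ → ‖x‖ < b → Tendsto (fun n => p n * v n x) atTop (𝓝 (-(4 * √(Real.exp 1)) * Real.log ‖x‖ + h x))
  hc : ContinuousAt h 0

namespace Loc
variable {p : ℕ → ℝ} {v e : ℕ → ℂ → ℝ} {b L : ℝ} {h : ℂ → ℝ}

lemma dens (H : Loc p v e b L h) (n : ℕ) : ∃ B K, Dens (dns b (p n) (v n)) B K := by
  have hp := H.hp1 n
  have hc : ContinuousOn (fun y => p n * (|v n y| ^ (p n - 1) * v n y)) (closedBall 0 b) := by
    apply ContinuousOn.mul continuousOn_const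
    apply ContinuousOn.mul _ (H.cont n)
    exact (H.cont n).abs.rpow_const (fun x _ => Or.inr (by linarith))
  obtain ⟨B, hB⟩ := (isCompact_closedBall (0:ℂ) b).exists_bound_of_continuousOn hc
  have hi : Integrable (dns b (p n) (v n)) := by
    rw [dns, integrable_indicator_iff measurableSet_ball]
    exact (hc.integrableOn_compact (isCompact_closedBall _ _)).mono_set ball_subset_closedBall
  refine ⟨max B 0, _, hi, fun y => ?_, le_rfl⟩
  by_cases hy : ‖y‖ < b
  · rw [dns_in hy]; exact (hB y (by simpa using hy.le)).trans (le_max_left _ _)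
  · rw [dns_out (not_lt.1 hy)]; simp

lemma kint (H : Loc p v e b L h) (n : ℕ) : Integrable (dns b (p n) (v n)) := by
  obtain ⟨B, K, hd⟩ := H.dens n; exact hd.int

/-- Annulus bound. -/
lemma ann (H : Loc p v e b L h) {s : ℝ} (hs : 0 < s) : ∃ K, 0 ≤ K ∧ ∀ᶠ n in atTop, ∀ x : ℂ, s ≤ ‖x‖ → ‖x‖ ≤ b →
    |v n x| ≤ K / p n := by
  obtain ⟨K, hK⟩ := H.bnd s hs
  refine ⟨max K 0, le_max_right _ _, ?_⟩
  filter_upwards [hK] with n hn x h1 h2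
  have := H.hp1 n
  rw [le_div_iff₀ (by linarith), mul_comm, ← abs_of_pos (by linarith : 0 < p n), ← abs_mul]
  exact (hn x h1 h2).trans (le_max_left _ _)

lemma annk (H : Loc p v e b L h) {s : ℝ} (hs : 0 < s) : ∃ K, 0 ≤ K ∧ ∀ᶠ n in atTop, ∀ x : ℂ, s ≤ ‖x‖ →
    |dns b (p n) (v n) x| ≤ p n * (K / p n) ^ p n := by
  obtain ⟨K, hK0, hK⟩ := H.ann hs
  refine ⟨K, hK0, ?_⟩
  filter_upwards [hK] with n hn x h1
  have := H.hp1 n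
  by_cases hx : ‖x‖ < b
  · rw [dns_abs this hx]
    apply mul_le_mul_of_nonneg_left _ (by linarith)
    exact Real.rpow_le_rpow (abs_nonneg _) (hn x h1 hx.le) (by linarith)
  · rw [dns_out (not_lt.1 hx)]; simp; positivity

lemma ann_small (H : Loc p v e b L h) {s : ℝ} (hs : 0 < s) {δ : ℝ} (hδ : 0 < δ) : ∀ᶠ n in atTop, ∀ x : ℂ, s ≤ ‖x‖ →
    |dns b (p n) (v n) x| ≤ δ := by
  obtain ⟨K, hK0, hK⟩ := H.annk hs
  have := pow_super H.hp 1 hK0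
  simp only [pow_one] at this
  filter_upwards [hK, this.eventually (gt_mem_nhds hδ)] with n hn h2 x hx
  exact (hn x hx).trans h2.le

/-- the energy mass -/
def A (p : ℕ → ℝ) (v : ℕ → ℂ → ℝ) (b : ℝ) (n : ℕ) : ℝ := p n * ∫ y in ball (0:ℂ) b, |v n y| ^ (p n + 1)
def C (p : ℕ → ℝ) (v : ℕ → ℂ → ℝ) (b : ℝ) (n : ℕ) : ℝ := ∫ y, dns b (p n) (v n) y
def Ca (p : ℕ → ℝ) (v : ℕ → ℂ → ℝ) (b : ℝ) (n : ℕ) : ℝ := ∫ y, |dns b (p n) (v n) y|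

lemma C_le_Ca (n : ℕ) : |C p v b n| ≤ Ca p v b n := abs_integral_le_integral_abs

lemma Ca_nonneg (n : ℕ) : 0 ≤ Ca p v b n := integral_nonneg fun _ => abs_nonneg _

lemma vint (H : Loc p v e b L h) (n : ℕ) : IntegrableOn (fun y => |v n y| ^ (p n + 1)) (ball (0:ℂ) b) := by
  have hc : ContinuousOn (fun y => |v n y| ^ (p n + 1)) (closedBall 0 b) :=
    (H.cont n).abs.rpow_const (fun x _ => Or.inr (by linarith [H.hp1 n]))
  exact (hc.integrableOn_compact (isCompact_closedBall _ _)).mono_set ball_subset_closedBall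

lemma vol_ball (b : ℝ) (hb : 0 < b) (hb1 : b ≤ 1/2) : (volume (ball (0:ℂ) b)).toReal ≤ 1 := by
  rw [Complex.volume_ball]
  simp [hb.le]
  have : (NNReal.pi : ℝ) = π := rfl
  nlinarith [Real.pi_le_four, Real.pi_pos]

/-- E0 -/
lemma Ca_le (H : Loc p v e b L h) (n : ℕ) {t : ℝ} (ht : 0 < t) : Ca p v b n ≤ A p v b n / t + p n * t ^ p n := by
  have hp := H.hp1 n
  have e1 : Ca p v b n = ∫ y in ball (0:ℂ) b, |dns b (p n) (v n) y| := by
    rw [Ca, ← integral_indicator measurableSet_ball]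
    congr 1; ext y
    by_cases hy : ‖y‖ < b
    · rw [Set.indicator_of_mem (by simpa using hy)]
    · rw [Set.indicator_of_notMem (by simpa using hy), dns_out (not_lt.1 hy), abs_zero]
  have hfin : volume (ball (0:ℂ) b) ≠ ⊤ := measure_ball_lt_top.ne
  have h2 : ∫ y in ball (0:ℂ) b, |dns b (p n) (v n) y| ≤ ∫ y in ball (0:ℂ) b, (p n / t * |v n y| ^ (p n + 1) + p n * t ^ p n) := by
    apply setIntegral_mono_on (H.kint n).abs.integrableOn _ measurableSet_ball
    · intro y hy
      rw [dns_abs hp (by simpa using hy)]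
      have : |v n y| ^ p n ≤ |v n y| ^ (p n + 1) / t + t ^ p n := by
        rcases le_total t |v n y| with h | h
        · have h0 : 0 < |v n y| := ht.trans_le h
          have : |v n y| ^ p n ≤ |v n y| ^ (p n + 1) / t := by
            rw [Real.rpow_add_one h0.ne', le_div_iff₀ ht]
            exact mul_le_mul_of_nonneg_left h (by positivity)
          have : 0 ≤ t ^ p n := by positivity
          linarith
        · have := Real.rpow_le_rpow (abs_nonneg _) h (by linarith : 0 ≤ p n)
          have : 0 ≤ |v n y| ^ (p n + 1) / t := by positivity
          linarith
      calc _ ≤ p n * (|v n y| ^ (p n + 1) / t + t ^ p n) := mul_le_mul_of_nonneg_left this (by linarith)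
        _ = _ := by ring
    · exact ((H.vint n).const_mul _).add (integrableOn_const hfin)
  rw [e1]
  refine h2.trans ?_
  rw [integral_add ((H.vint n).const_mul _) (integrableOn_const hfin), integral_const_mul, setIntegral_const, A]
  have := vol_ball b H.b0 H.b1
  have h3 : volume.real (ball (0:ℂ) b) * (p n * t ^ p n) ≤ 1 * (p n * t ^ p n) := mul_le_mul_of_nonneg_right this (by positivity)
  rw [smul_eq_mul]
  have : p n / t * (∫ y in ball (0:ℂ) b, |v n y| ^ (p n + 1)) = p n * (∫ y in ball (0:ℂ) b, |v n y| ^ (p n + 1)) / t := by ring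
  linarith

lemma Ca_ev (H : Loc p v e b L h) {Ā δ : ℝ} (hA : ∀ᶠ n in atTop, A p v b n ≤ Ā) (hδ : 0 < δ) :
    ∀ᶠ n in atTop, Ca p v b n ≤ Ā + δ := by
  -- choose t close to one
  obtain ⟨t, ht0, ht1, ht⟩ : ∃ t : ℝ, 0 < t ∧ t < 1 ∧ Ā / t < Ā + δ / 2 := by
    have hc : Tendsto (fun t : ℝ => Ā / t) (𝓝[<] 1) (𝓝 Ā) := by
      have : ContinuousAt (fun t : ℝ => Ā / t) 1 := by fun_prop (disch := norm_num)
      have := this.tendsto; rw [div_one] at this; exact this.mono_left nhdsWithin_le_nhds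
    have h1 := hc.eventually (gt_mem_nhds (show Ā < Ā + δ / 2 by linarith))
    have h2 : ∀ᶠ t : ℝ in 𝓝[<] 1, t < 1 := eventually_mem_nhdsWithin
    have h3 : ∀ᶠ t : ℝ in 𝓝[<] 1, 0 < t := nhdsWithin_le_nhds (lt_mem_nhds one_pos)
    obtain ⟨t, h⟩ := (h1.and (h2.and h3)).exists
    exact ⟨t, h.2.2, h.2.1, h.1⟩
  have := pow_geom H.hp 1 ht0 ht1
  simp only [pow_one] at this
  filter_upwards [hA, this.eventually (gt_mem_nhds (half_pos hδ))] with n h1 h2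
  have := H.Ca_le n ht0
  have : A p v b n / t ≤ Ā / t := by gcongr
  linarith

end Loc

namespace Loc
variable {p : ℕ → ℝ} {v e : ℕ → ℂ → ℝ} {b L : ℝ} {h : ℂ → ℝ}

lemma lt_one (H : Loc p v e b L h) {x y : ℂ} (hx : ‖x‖ ≤ b) (hy : ‖y‖ < b) : ‖x - y‖ < 1 := by
  have := norm_sub_le x y; have := H.b1; linarith

lemma logk_le (H : Loc p v e b L h) (n : ℕ) {x : ℂ} (hx : ‖x‖ ≤ b) (y : ℂ) :
    |Real.log ‖x - y‖ * dns b (p n) (v n) y| ≤ sker (x - y) * |dns b (p n) (v n) y| := by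
  by_cases hy : ‖y‖ < b
  · rw [abs_mul]; exact mul_le_mul_of_nonneg_right (ker_ge_log (H.lt_one hx hy)) (abs_nonneg _)
  · rw [dns_out (not_lt.1 hy)]; simp

lemma logk_meas (H : Loc p v e b L h) (n : ℕ) (x : ℂ) :
    AEStronglyMeasurable (fun y => Real.log ‖x - y‖ * dns b (p n) (v n) y) := by
  refine AEStronglyMeasurable.mul ?_ (H.kint n).1
  exact (Real.measurable_log.comp (by fun_prop : Measurable fun y : ℂ => ‖x - y‖)).aestronglyMeasurable

lemma logk_int (H : Loc p v e b L h) (n : ℕ) {x : ℂ} (hx : ‖x‖ ≤ b) :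
    Integrable (fun y => Real.log ‖x - y‖ * dns b (p n) (v n) y) := by
  obtain ⟨B, K, hd⟩ := H.dens n
  exact (hd.ker_int x).mono' (H.logk_meas n x) (ae_of_all _ (H.logk_le n hx))

lemma logk_diff (H : Loc p v e b L h) (n : ℕ) {x : ℂ} (hx0 : 0 < ‖x‖) (hx : ‖x‖ < b) {s δ : ℝ} (hs0 : 0 ≤ s)
    (hs : 2 * s ≤ ‖x‖) (hδ0 : 0 ≤ δ) (hδ : ∀ y : ℂ, s ≤ ‖y‖ → |dns b (p n) (v n) y| ≤ δ) :
    |(∫ y, Real.log ‖x - y‖ * dns b (p n) (v n) y) - Real.log ‖x‖ * C p v b n| ≤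
      3 * s / ‖x‖ * Ca p v b n + δ * (cK + |Real.log ‖x‖|) := by
  have hk := H.kint n
  rw [C, ← integral_const_mul, ← integral_sub (H.logk_int n hx.le) (hk.const_mul _), ← Real.norm_eq_abs]
  have hIntg : Integrable (fun y => 3 * s / ‖x‖ * |dns b (p n) (v n) y| + (δ * sker (x - y) + (ball (0:ℂ) b).indicator (fun _ => δ * |Real.log ‖x‖|) y)) := by
    refine (hk.abs.const_mul _).add (((ker_shift_integrable x).const_mul _).add ?_)
    exact (integrable_indicator_iff measurableSet_ball).2 (integrableOn_const measure_ball_lt_top.ne)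
  refine (norm_integral_le_of_norm_le hIntg (ae_of_all _ fun y => ?_)).trans ?_
  · have hr0 : 0 ≤ 3 * s / ‖x‖ * |dns b (p n) (v n) y| := by positivity
    have hr1 : 0 ≤ δ * sker (x - y) := mul_nonneg hδ0 (ker_nonneg _)
    by_cases hyb : ‖y‖ < b
    swap
    · rw [dns_out (not_lt.1 hyb), Set.indicator_of_notMem (by simpa using hyb)]; simpa using hr1
    rw [Set.indicator_of_mem (by simpa using hyb), ← sub_mul, norm_mul, Real.norm_eq_abs, Real.norm_eq_abs]
    have hr2 : 0 ≤ δ * |Real.log ‖x‖| := by positivity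
    rcases lt_or_ge ‖y‖ s with hy | hy
    · have h1 : ‖x‖ / 2 ≤ ‖x - y‖ := by have := norm_sub_norm_le x y; linarith
      have h2 := log_sub_le (by linarith : 0 < ‖x - y‖) hx0
      have h3 : |‖x - y‖ - ‖x‖| ≤ s := by
        have := abs_norm_sub_norm_le (x - y) x; simp at this; linarith
      have h4 : ‖x - y‖⁻¹ ≤ 2 / ‖x‖ := by
        have := inv_anti₀ (by positivity) h1; rw [inv_div] at this; exact this
      have h5 : |Real.log ‖x - y‖ - Real.log ‖x‖| ≤ 3 * s / ‖x‖ := by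
        calc _ ≤ _ := h2
          _ ≤ s * (2 / ‖x‖ + ‖x‖⁻¹) := mul_le_mul h3 (by linarith) (by positivity) hs0
          _ = _ := by field_simp; ring
      have := mul_le_mul_of_nonneg_right h5 (abs_nonneg (dns b (p n) (v n) y))
      linarith
    · have h1 := ker_ge_log (H.lt_one hx.le hyb)
      have h2 : |Real.log ‖x - y‖ - Real.log ‖x‖| ≤ sker (x - y) + |Real.log ‖x‖| := (abs_sub _ _).trans (by linarith)
      have h3 := mul_le_mul h2 (hδ y hy) (abs_nonneg _) (by have := ker_nonneg (x-y); positivity)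
      calc _ ≤ _ := h3
        _ ≤ _ := by linarith
  · rw [integral_add (hk.abs.const_mul _), integral_add ((ker_shift_integrable x).const_mul _), integral_const_mul, integral_const_mul, ker_shift_int, integral_indicator measurableSet_ball, setIntegral_const, smul_eq_mul]
    · have h1 := vol_ball b H.b0 H.b1
      have h2 : volume.real (ball (0:ℂ) b) * (δ * |Real.log ‖x‖|) ≤ 1 * (δ * |Real.log ‖x‖|) := mul_le_mul_of_nonneg_right h1 (by positivity)
      rw [Ca]; linarith
    · exact (integrable_indicator_iff measurableSet_ball).2 (integrableOn_const measure_ball_lt_top.ne)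
    · refine ((ker_shift_integrable x).const_mul _).add ?_
      exact (integrable_indicator_iff measurableSet_ball).2 (integrableOn_const measure_ball_lt_top.ne)

lemma logk_lim (H : Loc p v e b L h) {K0 : ℝ} (hK : ∀ᶠ n in atTop, Ca p v b n ≤ K0) {x : ℂ} (hx0 : 0 < ‖x‖) (hx : ‖x‖ < b) :
    Tendsto (fun n => (∫ y, Real.log ‖x - y‖ * dns b (p n) (v n) y) - Real.log ‖x‖ * C p v b n) atTop (𝓝 0) := by
  rw [Metric.tendsto_atTop']
  simp_rw [dist_zero_right, Real.norm_eq_abs]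
  intro η hη
  obtain ⟨n0, hn0⟩ := hK.exists
  have hK0 : 0 ≤ K0 := (Ca_nonneg n0).trans hn0
  set s := min (‖x‖ / 2) (η * ‖x‖ / (12 * (K0 + 1))) with hs
  have hs0 : 0 < s := by rw [hs]; apply lt_min <;> positivity
  set δ := η / (4 * (cK + |Real.log ‖x‖| + 1)) with hδ
  have hc := cK_nonneg
  have hδ0 : 0 < δ := by positivity
  have := (H.ann_small hs0 hδ0).and hK
  obtain ⟨N, hN⟩ := eventually_atTop.1 this
  refine ⟨N, fun n hn => ?_⟩
  obtain ⟨h1, h2⟩ := hN n hn.le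
  refine (H.logk_diff n hx0 hx hs0.le (by have := min_le_left (‖x‖ / 2) (η * ‖x‖ / (12 * (K0 + 1))); linarith) hδ0.le h1).trans_lt ?_
  have h3 : 3 * s / ‖x‖ * Ca p v b n ≤ η / 4 := by
    have : s ≤ η * ‖x‖ / (12 * (K0 + 1)) := min_le_right _ _
    calc _ ≤ 3 * (η * ‖x‖ / (12 * (K0 + 1))) / ‖x‖ * (K0 + 1) := by
          apply mul_le_mul _ (by linarith) (Ca_nonneg n) (by positivity)
          gcongr
      _ = η / 4 := by field_simp; norm_num
  have h4 : δ * (cK + |Real.log ‖x‖|) ≤ η / 4 := by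
    calc _ ≤ δ * (cK + |Real.log ‖x‖| + 1) := mul_le_mul_of_nonneg_left (by linarith) hδ0.le
      _ = η / 4 := by rw [hδ]; field_simp
  linarith

/-- e_n(x) - (C_n/2π) log|x| converges. -/
lemma e_lim0 (H : Loc p v e b L h) {K0 : ℝ} (hK : ∀ᶠ n in atTop, Ca p v b n ≤ K0) {x : ℂ} (hx0 : 0 < ‖x‖) (hx : ‖x‖ < b) :
    Tendsto (fun n => e n x - (C p v b n / (2 * π) - 4 * √(Real.exp 1)) * Real.log ‖x‖) atTop (𝓝 (h x)) := by
  have h1 := H.lim x hx0 hx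
  have h2 := (H.logk_lim hK hx0 hx).const_mul (1 / (2 * π))
  have h3 := (h1.add h2).add_const (4 * √(Real.exp 1) * Real.log ‖x‖)
  refine (h3.congr fun n => ?_).trans (le_of_eq ?_)
  · rw [H.rep n x hx.le]; ring
  · congr 1; ring

lemma C_lim (H : Loc p v e b L h) {K0 : ℝ} (hK : ∀ᶠ n in atTop, Ca p v b n ≤ K0) :
    Tendsto (C p v b) atTop (𝓝 (8 * π * √(Real.exp 1))) := by
  have hb := H.b0
  -- bound h near zero
  obtain ⟨r, hr, hr'⟩ := Metric.continuousAt_iff.1 H.hc 1 one_pos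
  have hh : ∀ x : ℂ, ‖x‖ < r → |h x| ≤ |h 0| + 1 := by
    intro x hx
    have := hr' (by simpa using hx)
    rw [Real.dist_eq] at this
    have := abs_sub_abs_le_abs_sub (h x) (h 0); linarith
  set x1 : ℂ := ((b / 2 : ℝ) : ℂ) with hx1
  have nx1 : ‖x1‖ = b / 2 := by rw [hx1, Complex.norm_real, Real.norm_eq_abs, abs_of_pos (by positivity)]
  suffices Tendsto (fun n => C p v b n / (2 * π) - 4 * √(Real.exp 1)) atTop (𝓝 0) by
    have h2 := (this.add_const (4 * √(Real.exp 1))).mul_const (2 * π)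
    refine (h2.congr fun n => ?_).trans (le_of_eq ?_)
    · have := Real.pi_ne_zero; field_simp; ring
    · congr 1; ring
  rw [Metric.tendsto_atTop']
  simp_rw [dist_zero_right, Real.norm_eq_abs]
  intro η hη
  set T := L * b + |h x1| + |h 0| + 3 with hT
  have hT0 : 0 < T := by have := H.L0; positivity
  obtain ⟨s, hs0, hsb, hsr, hsl⟩ : ∃ s : ℝ, 0 < s ∧ s < b / 2 ∧ s < r ∧ T / η < Real.log (b / 2) - Real.log s := by
    have h1 : ∀ᶠ s : ℝ in 𝓝[>] 0, 0 < s := eventually_mem_nhdsWithin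
    have h2 : ∀ᶠ s : ℝ in 𝓝[>] 0, s < b / 2 := nhdsWithin_le_nhds (gt_mem_nhds (by positivity))
    have h3 : ∀ᶠ s : ℝ in 𝓝[>] 0, s < r := nhdsWithin_le_nhds (gt_mem_nhds hr)
    have h4 : ∀ᶠ s : ℝ in 𝓝[>] 0, Real.log s < Real.log (b/2) - T / η := Real.tendsto_log_nhdsGT_zero.eventually_lt_atBot _
    obtain ⟨s, a1, a2, a3, a4⟩ := (h1.and (h2.and (h3.and h4))).exists
    exact ⟨s, a1, a2, a3, by linarith⟩
  set x2 : ℂ := (s : ℂ) with hx2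
  have nx2 : ‖x2‖ = s := by rw [hx2, Complex.norm_real, Real.norm_eq_abs, abs_of_pos hs0]
  have l1 := H.e_lim0 hK (x := x1) (by rw [nx1]; positivity) (by rw [nx1]; linarith)
  have l2 := H.e_lim0 hK (x := x2) (by rw [nx2]; positivity) (by rw [nx2]; linarith)
  have l3 := (Metric.tendsto_atTop'.1 l1) 1 one_pos
  have l4 := (Metric.tendsto_atTop'.1 l2) 1 one_pos
  obtain ⟨N1, hN1⟩ := l3
  obtain ⟨N2, hN2⟩ := l4
  obtain ⟨N3, hN3⟩ := eventually_atTop.1 H.elip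
  refine ⟨max N1 (max N2 N3), fun n hn => ?_⟩
  have a1 := hN1 n (lt_of_le_of_lt (le_max_left _ _) hn)
  have a2 := hN2 n (lt_of_le_of_lt ((le_max_left _ _).trans (le_max_right _ _)) hn)
  have a3 := hN3 n (((le_max_right _ _).trans (le_max_right _ _)).trans hn.le) x1 x2
  rw [Real.dist_eq, nx1] at a1
  rw [Real.dist_eq, nx2] at a2
  set q := C p v b n / (2 * π) - 4 * √(Real.exp 1)
  have a4 : ‖x1 - x2‖ ≤ b := by have := norm_sub_le x1 x2; rw [nx1, nx2] at this; linarith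
  have a5 : L * ‖x1 - x2‖ ≤ L * b := mul_le_mul_of_nonneg_left a4 H.L0
  have a6 := hh x2 (by rw [nx2]; exact hsr)
  have key : |q * (Real.log (b/2) - Real.log s)| < T := by
    have e1 : q * (Real.log (b/2) - Real.log s) = (e n x1 - e n x2) - (e n x1 - q * Real.log (b/2) - h x1) + (e n x2 - q * Real.log s - h x2) - h x1 + h x2 := by ring
    rw [e1, hT]
    rw [abs_lt] at a1 a2
    rw [abs_le] at a3 a6
    have := abs_le.1 (le_refl |h x1|)
    rw [abs_lt]; constructor <;> linarith
  have hpos : 0 < Real.log (b/2) - Real.log s := lt_trans (by positivity) hsl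
  rw [abs_mul, abs_of_pos hpos] at key
  rw [div_lt_iff₀ hη] at hsl
  by_contra hcon
  push Not at hcon
  nlinarith

lemma e_lim (H : Loc p v e b L h) {K0 : ℝ} (hK : ∀ᶠ n in atTop, Ca p v b n ≤ K0) {x : ℂ} (hx0 : 0 < ‖x‖) (hx : ‖x‖ < b) :
    Tendsto (fun n => e n x) atTop (𝓝 (h x)) := by
  have h1 := H.e_lim0 hK hx0 hx
  have h2 := (((H.C_lim hK).div_const (2 * π)).sub_const (4 * √(Real.exp 1))).mul_const (Real.log ‖x‖)
  refine ((h1.add h2).congr fun n => ?_).trans (le_of_eq ?_)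
  · ring
  · congr 1
    have := Real.pi_ne_zero; field_simp; ring

lemma e_lim_zero (H : Loc p v e b L h) {K0 : ℝ} (hK : ∀ᶠ n in atTop, Ca p v b n ≤ K0) {x : ℕ → ℂ} (hx : Tendsto x atTop (𝓝 0)) :
    Tendsto (fun n => e n (x n)) atTop (𝓝 (h 0)) := by
  have hb := H.b0
  have hL := H.L0
  rw [Metric.tendsto_atTop']
  intro η hη
  obtain ⟨r, hr, hr'⟩ := Metric.continuousAt_iff.1 H.hc (η / 4) (by positivity)
  set s := min (min (r / 2) (b / 2)) (η / (4 * (L + 1))) with hs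
  have hs0 : 0 < s := by rw [hs]; refine lt_min (lt_min ?_ ?_) ?_ <;> positivity
  have s1 : s < r := lt_of_le_of_lt ((min_le_left _ _).trans (min_le_left _ _)) (by linarith)
  have s2 : s < b := lt_of_le_of_lt ((min_le_left _ _).trans (min_le_right _ _)) (by linarith)
  have s3 : L * s ≤ η / 4 := by
    calc _ ≤ (L + 1) * (η / (4 * (L + 1))) := mul_le_mul (by linarith) (min_le_right _ _) hs0.le (by linarith)
      _ = _ := by field_simp
  set y : ℂ := (s : ℂ)
  have ny : ‖y‖ = s := by rw [Complex.norm_real, Real.norm_eq_abs, abs_of_pos hs0]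
  have l1 := Metric.tendsto_atTop'.1 (H.e_lim hK (x := y) (by rw [ny]; exact hs0) (by rw [ny]; exact s2)) (η/4) (by positivity)
  obtain ⟨N1, hN1⟩ := l1
  have l2 : ∀ᶠ n in atTop, L * ‖x n - y‖ < L * s + η / 4 := by
    have : Tendsto (fun n => L * ‖x n - y‖) atTop (𝓝 (L * ‖(0:ℂ) - y‖)) := ((hx.sub_const y).norm).const_mul L
    rw [zero_sub, norm_neg, ny] at this
    exact this.eventually (gt_mem_nhds (by linarith))
  obtain ⟨N2, hN2⟩ := eventually_atTop.1 (l2.and H.elip)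
  refine ⟨max N1 N2, fun n hn => ?_⟩
  have a1 := hN1 n (lt_of_le_of_lt (le_max_left _ _) hn)
  obtain ⟨a2, a3⟩ := hN2 n ((le_max_right _ _).trans hn.le)
  have a4 := a3 (x n) y
  have a5 : dist (h y) (h 0) < η / 4 := hr' (by rw [dist_zero_right, ny]; exact s1)
  rw [Real.dist_eq, abs_lt] at *
  rw [abs_le] at a4
  constructor <;> linarith

lemma e_bdd (H : Loc p v e b L h) {K0 : ℝ} (hK : ∀ᶠ n in atTop, Ca p v b n ≤ K0) :
    ∃ T, 0 ≤ T ∧ ∀ᶠ n in atTop, ∀ x : ℂ, ‖x‖ ≤ b → |e n x| ≤ T := by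
  have h0 := H.e_lim_zero hK (x := fun _ => 0) tendsto_const_nhds
  have hL := H.L0; have hb := H.b0
  refine ⟨|h 0| + 1 + L * b, by positivity, ?_⟩
  filter_upwards [(h0.abs).eventually (gt_mem_nhds (show |h 0| < |h 0| + 1 by linarith)), H.elip] with n h1 h2 x hx
  have h3 := h2 x 0
  rw [sub_zero] at h3
  have h4 := abs_sub_abs_le_abs_sub (e n x) (e n 0)
  have : L * ‖x‖ ≤ L * b := by gcongr
  linarith

/-- lower bound on the energy mass. -/
lemma A_lower (H : Loc p v e b L h) {Ā : ℝ} (hA : ∀ᶠ n in atTop, A p v b n ≤ Ā) {δ : ℝ} (hδ : 0 < δ) :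
    ∀ᶠ n in atTop, 8 * π * √(Real.exp 1) - δ ≤ A p v b n := by
  have hC := H.C_lim (H.Ca_ev hA one_pos)
  obtain ⟨t, ht0, ht1, ht⟩ : ∃ t : ℝ, 0 < t ∧ t < 1 ∧ 8 * π * √(Real.exp 1) - δ < t * (8 * π * √(Real.exp 1) - δ / 2) := by
    have hc : Tendsto (fun t : ℝ => t * (8 * π * √(Real.exp 1) - δ / 2)) (𝓝[<] 1) (𝓝 (1 * (8 * π * √(Real.exp 1) - δ / 2))) := by
      have : ContinuousAt (fun t : ℝ => t * (8 * π * √(Real.exp 1) - δ / 2)) 1 := by fun_prop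
      exact this.tendsto.mono_left nhdsWithin_le_nhds
    have h1 := hc.eventually (lt_mem_nhds (show 8 * π * √(Real.exp 1) - δ < 1 * (8 * π * √(Real.exp 1) - δ / 2) by linarith))
    have h2 : ∀ᶠ t : ℝ in 𝓝[<] 1, t < 1 := eventually_mem_nhdsWithin
    have h3 : ∀ᶠ t : ℝ in 𝓝[<] 1, 0 < t := nhdsWithin_le_nhds (lt_mem_nhds one_pos)
    obtain ⟨t, h⟩ := (h1.and (h2.and h3)).exists
    exact ⟨t, h.2.2, h.2.1, h.1⟩
  have := pow_geom H.hp 1 ht0 ht1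
  simp only [pow_one] at this
  filter_upwards [hC.eventually (lt_mem_nhds (show 8 * π * √(Real.exp 1) - δ / 4 < 8 * π * √(Real.exp 1) by linarith)), this.eventually (gt_mem_nhds (show 0 < δ / 4 by linarith))] with n h1 h2
  have h3 := H.Ca_le n ht0
  have h4 := (le_abs_self _).trans (C_le_Ca (p := p) (v := v) (b := b) n)
  have h5 : 8 * π * √(Real.exp 1) - δ / 2 ≤ A p v b n / t := by linarith
  rw [le_div_iff₀ ht0] at h5
  linarith

end Loc

lemma log_le_div_e {t : ℝ} (ht : 0 < t) : Real.log t ≤ t / Real.exp 1 := by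
  have h := Real.log_le_sub_one_of_pos (show 0 < t / Real.exp 1 by positivity)
  rw [Real.log_div ht.ne' (Real.exp_pos 1).ne', Real.log_exp] at h; linarith

lemma logp_le {q : ℝ} (hq : 0 ≤ q) : Real.log (max 1 q) ≤ q / Real.exp 1 := by
  rcases le_total q 1 with h | h
  · rw [max_eq_left h, Real.log_one]; positivity
  · rw [max_eq_right h]; exact log_le_div_e (by linarith)

lemma sqrt_e_bd : 1.6 < √(Real.exp 1) ∧ √(Real.exp 1) < 1.7 := by
  have h1 := Real.exp_one_gt_d9; have h2 := Real.exp_one_lt_d9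
  constructor
  · apply Real.lt_sqrt_of_sq_lt; norm_num; linarith
  · rw [Real.sqrt_lt' (by norm_num)]; norm_num; linarith

lemma sqrt_e_sq : √(Real.exp 1) * √(Real.exp 1) = Real.exp 1 := Real.mul_self_sqrt (Real.exp_pos 1).le

lemma ker_scale {s : ℝ} (hs : 0 < s) (x : ℂ) : Integrable (fun y => sker ((s:ℂ) * (x - y))) ∧
    ∫ y, sker ((s:ℂ) * (x - y)) = (s ^ 2)⁻¹ * cK := by
  have e1 : (fun y => sker ((s:ℂ) * (x - y))) = fun y => (fun z => sker (s • z)) (x - y) := by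
    ext y; simp
  constructor
  · rw [e1]
    exact (ker_integrable.comp_smul hs.ne').comp_sub_left x
  · rw [e1, integral_sub_left_eq_self (fun z => sker (s • z)) volume x, Measure.integral_comp_smul]
    simp [cK]

/-- Bathtub estimate. -/
lemma bathtub {f : ℂ → ℝ} {Λ : ℝ} (hΛ : 1 ≤ Λ) (hf0 : ∀ y, 0 ≤ f y) (hf : ∀ y, f y ≤ Λ) (hi : Integrable f) (x : ℂ)
    (hli : Integrable (fun y => Real.log ‖x - y‖ * f y)) :
    -(∫ y, Real.log ‖x - y‖ * f y) ≤ cK + (∫ y, f y) / 2 * Real.log Λ := by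
  have hs : 0 < √Λ := by positivity
  obtain ⟨h1, h2⟩ := ker_scale hs x
  rw [Real.sq_sqrt (by linarith)] at h2
  have hpt : ∀ y, -(Real.log ‖x - y‖ * f y) ≤ Λ * sker ((√Λ:ℂ) * (x - y)) + Real.log Λ / 2 * f y := by
    intro y
    have hk := ker_nonneg ((√Λ:ℂ) * (x - y))
    have hl : 0 ≤ Real.log Λ := Real.log_nonneg hΛ
    have a : -Real.log ‖x - y‖ ≤ sker ((√Λ:ℂ) * (x - y)) + Real.log Λ / 2 := by
      rcases eq_or_lt_of_le (norm_nonneg (x - y)) with h0 | h0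
      · rw [← h0, Real.log_zero]; linarith
      · have hn : ‖(√Λ:ℂ) * (x - y)‖ = √Λ * ‖x - y‖ := by
          rw [norm_mul, Complex.norm_real, Real.norm_eq_abs, abs_of_pos hs]
        have hlog : Real.log (√Λ * ‖x - y‖) = Real.log Λ / 2 + Real.log ‖x - y‖ := by
          rw [Real.log_mul hs.ne' h0.ne', Real.log_sqrt (by linarith)]
        rcases lt_or_ge (√Λ * ‖x - y‖) 1 with h3 | h3
        · have h4 := ker_ge_log (y := (√Λ:ℂ) * (x - y)) (by rw [hn]; exact h3)
          rw [hn, hlog] at h4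
          have := neg_abs_le (Real.log Λ / 2 + Real.log ‖x - y‖)
          linarith
        · have := Real.log_nonneg h3
          linarith
    calc _ = (-Real.log ‖x - y‖) * f y := by ring
      _ ≤ (sker ((√Λ:ℂ) * (x - y)) + Real.log Λ / 2) * f y := mul_le_mul_of_nonneg_right a (hf0 y)
      _ = sker ((√Λ:ℂ) * (x - y)) * f y + Real.log Λ / 2 * f y := by ring
      _ ≤ sker ((√Λ:ℂ) * (x - y)) * Λ + Real.log Λ / 2 * f y := by
        have := mul_le_mul_of_nonneg_left (hf y) hk; linarith
      _ = _ := by ring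
  rw [← integral_neg]
  refine (integral_mono hli.neg ((h1.const_mul Λ).add (hi.const_mul _)) hpt).trans (le_of_eq ?_)
  have := integral_add (h1.const_mul Λ) (hi.const_mul (Real.log Λ / 2))
  simp only [Pi.add_apply]
  rw [this, integral_const_mul, integral_const_mul, h2]
  have : Λ ≠ 0 := by linarith
  field_simp

namespace Loc
variable {p : ℕ → ℝ} {v e : ℕ → ℂ → ℝ} {b L : ℝ} {h : ℂ → ℝ}

def Pos (p : ℕ → ℝ) (v : ℕ → ℂ → ℝ) (b : ℝ) (n : ℕ) : ℝ := ∫ y, max (dns b (p n) (v n) y) 0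
def Neg (p : ℕ → ℝ) (v : ℕ → ℂ → ℝ) (b : ℝ) (n : ℕ) : ℝ := ∫ y, max (-dns b (p n) (v n) y) 0

lemma pn_sub (H : Loc p v e b L h) (n : ℕ) : Pos p v b n - Neg p v b n = C p v b n := by
  rw [Pos, Neg, ← integral_sub (H.kint n).pos_part (H.kint n).neg_part, C]
  congr 1; ext y
  rcases le_total 0 (dns b (p n) (v n) y) with h | h
  · rw [max_eq_left h, max_eq_right (by linarith)]; ring
  · rw [max_eq_right h, max_eq_left (by linarith)]; ring

lemma pn_add (H : Loc p v e b L h) (n : ℕ) : Pos p v b n + Neg p v b n = Ca p v b n := by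
  rw [Pos, Neg, ← integral_add (H.kint n).pos_part (H.kint n).neg_part, Ca]
  congr 1; ext y
  rcases le_total 0 (dns b (p n) (v n) y) with h | h
  · rw [max_eq_left h, max_eq_right (by linarith), abs_of_nonneg h]; ring
  · rw [max_eq_right h, max_eq_left (by linarith), abs_of_nonpos h]; ring

lemma Pos_nonneg (n : ℕ) : 0 ≤ Pos p v b n := integral_nonneg fun _ => le_max_right _ _
lemma Neg_nonneg (n : ℕ) : 0 ≤ Neg p v b n := integral_nonneg fun _ => le_max_right _ _

/-- bathtub for signed densities -/
lemma bath_signed (H : Loc p v e b L h) {g : ℂ → ℝ} (hg : Integrable g) {x : ℂ} (hx : ‖x‖ ≤ b) (hout : ∀ y, b ≤ ‖y‖ → g y = 0)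
    (hgi : Integrable (fun y => Real.log ‖x - y‖ * g y)) {Λ : ℝ} (hΛ : 1 ≤ Λ) (hle : ∀ y, g y ≤ Λ) :
    -(∫ y, Real.log ‖x - y‖ * g y) ≤ cK + (∫ y, max (g y) 0) / 2 * Real.log Λ := by
  have hi : Integrable (fun y => Real.log ‖x - y‖ * max (g y) 0) := by
    refine hgi.mono ?_ (ae_of_all _ fun y => ?_)
    · exact ((Real.measurable_log.comp (by fun_prop : Measurable fun y : ℂ => ‖x - y‖)).aestronglyMeasurable).mul hg.pos_part.1
    · rw [norm_mul, norm_mul]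
      apply mul_le_mul_of_nonneg_left _ (norm_nonneg _)
      rw [Real.norm_eq_abs, Real.norm_eq_abs, abs_of_nonneg (le_max_right _ _)]
      exact max_le (le_abs_self _) (abs_nonneg _)
  have h1 := bathtub hΛ (fun y => le_max_right (g y) 0) (fun y => max_le (hle y) (by linarith)) hg.pos_part x hi
  refine le_trans ?_ h1
  rw [neg_le_neg_iff]
  refine integral_mono hi hgi fun y => ?_
  by_cases hy : ‖y‖ < b
  · have : Real.log ‖x - y‖ ≤ 0 := Real.log_nonpos (norm_nonneg _) (H.lt_one hx hy).le
    exact mul_le_mul_of_nonpos_left (le_max_left _ _) this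
  · simp only [hout y (not_lt.1 hy), max_self]; rfl

lemma log_lam {p q : ℝ} (hp : 1 < p) : 1 ≤ p * (max 1 q) ^ p ∧ Real.log (p * (max 1 q) ^ p) = Real.log p + p * Real.log (max 1 q) := by
  have h1 : 1 ≤ max 1 q := le_max_left _ _
  have h2 : 1 ≤ (max 1 q) ^ p := Real.one_le_rpow h1 (by linarith)
  refine ⟨by nlinarith, ?_⟩
  rw [Real.log_mul (by linarith) (by linarith), Real.log_rpow (by linarith)]

lemma k_le (H : Loc p v e b L h) (n : ℕ) {q : ℝ} (hq : ∀ y, ‖y‖ ≤ b → v n y ≤ q) (y : ℂ) :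
    dns b (p n) (v n) y ≤ p n * (max 1 q) ^ p n := by
  have hp := H.hp1 n
  have h1 : 0 ≤ p n * (max 1 q) ^ p n := by linarith [(log_lam (q := q) hp).1]
  by_cases hy : ‖y‖ < b
  · rcases le_total 0 (v n y) with h0 | h0
    · refine (le_abs_self _).trans ?_
      rw [dns_abs hp hy, abs_of_nonneg h0]
      apply mul_le_mul_of_nonneg_left _ (by linarith)
      exact Real.rpow_le_rpow h0 ((hq y hy.le).trans (le_max_right _ _)) (by linarith)
    · rw [dns_in hy]
      refine le_trans ?_ h1
      have : 0 ≤ |v n y| ^ (p n - 1) := by positivity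
      exact mul_nonpos_of_nonneg_of_nonpos (by linarith) (mul_nonpos_of_nonneg_of_nonpos this h0)
  · rw [dns_out (not_lt.1 hy)]; exact h1

lemma nk_le (H : Loc p v e b L h) (n : ℕ) {q : ℝ} (hq : ∀ y, ‖y‖ ≤ b → -v n y ≤ q) (y : ℂ) :
    -dns b (p n) (v n) y ≤ p n * (max 1 q) ^ p n := by
  have hp := H.hp1 n
  have h1 : 0 ≤ p n * (max 1 q) ^ p n := by linarith [(log_lam (q := q) hp).1]
  by_cases hy : ‖y‖ < b
  · rcases le_total (v n y) 0 with h0 | h0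
    · refine (neg_le_abs _).trans ?_
      rw [dns_abs hp hy, abs_of_nonpos h0]
      apply mul_le_mul_of_nonneg_left _ (by linarith)
      exact Real.rpow_le_rpow (by linarith) ((hq y hy.le).trans (le_max_right _ _)) (by linarith)
    · rw [dns_in hy]
      refine le_trans ?_ h1
      have : 0 ≤ |v n y| ^ (p n - 1) := by positivity
      have : 0 ≤ p n * (|v n y| ^ (p n - 1) * v n y) := by positivity
      linarith
  · rw [dns_out (not_lt.1 hy)]; simpa using h1

def err (p : ℕ → ℝ) (K0 T : ℝ) (n : ℕ) : ℝ := (cK / (2 * π) + T) / p n + K0 / (4 * π) * (Real.log (p n) / p n)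

lemma err_lim (hp : Tendsto p atTop atTop) (K0 T : ℝ) : Tendsto (err p K0 T) atTop (𝓝 0) := by
  have h1 : Tendsto (fun n => (cK / (2 * π) + T) / p n) atTop (𝓝 0) := tendsto_const_nhds.div_atTop hp
  have h2 : Tendsto (fun x : ℝ => Real.log x / x) atTop (𝓝 0) := by
    have := Real.isLittleO_log_id_atTop.tendsto_div_nhds_zero; simpa using this
  have := h1.add ((h2.comp hp).const_mul (K0 / (4 * π)))
  rw [mul_zero, add_zero] at this
  exact this

lemma arith_bd {P q lg pp K0 T : ℝ} (hpp : 0 < pp) (hlog : 0 ≤ Real.log pp) (hP : P ≤ K0)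
    (h : pp * q ≤ 1 / (2 * π) * (cK + P / 2 * (Real.log pp + pp * lg)) + T) :
    q ≤ P / (4 * π) * lg + ((cK / (2 * π) + T) / pp + K0 / (4 * π) * (Real.log pp / pp)) := by
  have hpi := Real.pi_pos
  have h2 : P / (4 * π) * (Real.log pp / pp) ≤ K0 / (4 * π) * (Real.log pp / pp) := by gcongr
  have h3 : q ≤ P / (4 * π) * lg + ((cK / (2 * π) + T) / pp + P / (4 * π) * (Real.log pp / pp)) := by
    have e1 : P / (4 * π) * lg + ((cK / (2 * π) + T) / pp + P / (4 * π) * (Real.log pp / pp)) = (1 / (2 * π) * (cK + P / 2 * (Real.log pp + pp * lg)) + T) / pp := by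
      field_simp; ring
    rw [e1, le_div_iff₀ hpp]; linarith
  linarith

lemma sup_bd (H : Loc p v e b L h) (n : ℕ) {K0 T q : ℝ} (hK : Ca p v b n ≤ K0) (hT : ∀ x : ℂ, ‖x‖ ≤ b → |e n x| ≤ T)
    (hq : ∀ y, ‖y‖ ≤ b → v n y ≤ q) {x : ℂ} (hx : ‖x‖ ≤ b) :
    v n x ≤ Pos p v b n / (4 * π) * Real.log (max 1 q) + err p K0 T n := by
  have hp := H.hp1 n
  obtain ⟨l1, l2⟩ := log_lam (q := q) hp
  have h1 := H.bath_signed (H.kint n) hx (fun y hy => dns_out hy) (H.logk_int n hx) l1 (H.k_le n hq)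
  rw [l2] at h1
  have hr := H.rep n x hx
  refine arith_bd (by linarith) (Real.log_nonneg hp.le) (by have := H.pn_add n; have := Neg_nonneg (p := p) (v := v) (b := b) n; linarith) ?_
  rw [hr]
  have := mul_le_mul_of_nonneg_left h1 (by have := Real.pi_pos; positivity : 0 ≤ 1 / (2 * π))
  have := (abs_le.1 (hT x hx)).2
  rw [← Pos] at *
  linarith

lemma inf_bd (H : Loc p v e b L h) (n : ℕ) {K0 T q : ℝ} (hK : Ca p v b n ≤ K0) (hT : ∀ x : ℂ, ‖x‖ ≤ b → |e n x| ≤ T)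
    (hq : ∀ y, ‖y‖ ≤ b → -v n y ≤ q) {x : ℂ} (hx : ‖x‖ ≤ b) :
    -v n x ≤ Neg p v b n / (4 * π) * Real.log (max 1 q) + err p K0 T n := by
  have hp := H.hp1 n
  obtain ⟨l1, l2⟩ := log_lam (q := q) hp
  have hgi : Integrable (fun y => Real.log ‖x - y‖ * -dns b (p n) (v n) y) := by
    refine (H.logk_int n hx).neg.congr (ae_of_all _ fun y => ?_)
    simp
  have h1 := H.bath_signed (H.kint n).neg hx (fun y hy => by simp [dns_out hy]) hgi l1 (H.nk_le n hq)
  rw [l2] at h1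
  have hr := H.rep n x hx
  refine arith_bd (by linarith) (Real.log_nonneg hp.le) (by have := H.pn_add n; have := Pos_nonneg (p := p) (v := v) (b := b) n; linarith) ?_
  rw [mul_neg, hr]
  simp only [Pi.neg_apply, mul_neg, integral_neg, neg_neg] at h1
  have := mul_le_mul_of_nonneg_left h1 (by have := Real.pi_pos; positivity : 0 ≤ 1 / (2 * π))
  have := (abs_le.1 (hT x hx)).1
  rw [← Neg] at *
  linarith

lemma neg_small (H : Loc p v e b L h) (hA : ∀ᶠ n in atTop, A p v b n ≤ 32 * π) {δ : ℝ} (hδ : 0 < δ) :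
    ∀ᶠ n in atTop, ∀ x : ℂ, ‖x‖ ≤ b → -δ ≤ v n x := by
  have hpi := Real.pi_pos
  have hCa := H.Ca_ev hA (show 0 < 0.1 * π by positivity)
  obtain ⟨T, hT0, hT⟩ := H.e_bdd hCa
  have hC := H.C_lim hCa
  have he := err_lim H.hp (32 * π + 0.1 * π) T
  have hs := sqrt_e_bd
  filter_upwards [hCa, hT, hC.eventually (lt_mem_nhds (show 8 * π * 1.6 < 8 * π * √(Real.exp 1) by nlinarith)), he.eventually (gt_mem_nhds (show 0 < δ / 20 by positivity))] with n h1 h2 h3 h4 x hx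
  obtain ⟨x0, hx0, hmin⟩ := (isCompact_closedBall (0:ℂ) b).exists_isMinOn ⟨0, by simp [H.b0.le]⟩ (H.cont n)
  have hx0' : ‖x0‖ ≤ b := by simpa using hx0
  have hmin' : ∀ y : ℂ, ‖y‖ ≤ b → v n x0 ≤ v n y := fun y hy => hmin (by simpa using hy)
  refine le_trans ?_ (hmin' x hx)
  by_contra hcon
  push Not at hcon
  set q := -v n x0 with hq
  have hb := H.inf_bd n h1 h2 (q := q) (fun y hy => by have := hmin' y hy; linarith) hx0'
  rw [← hq] at hb
  have hq0 : δ < q := by linarith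
  have hl := logp_le (q := q) (by linarith)
  have hNeg : Neg p v b n / (4 * π) ≤ 2.5 := by
    rw [div_le_iff₀ (by positivity)]
    have := H.pn_add n; have := H.pn_sub n
    linarith
  have hl0 : 0 ≤ Real.log (max 1 q) := Real.log_nonneg (le_max_left _ _)
  have h5 : Neg p v b n / (4 * π) * Real.log (max 1 q) ≤ 2.5 * (q / Real.exp 1) := mul_le_mul hNeg hl hl0 (by norm_num)
  have h6 : 2.5 * (q / Real.exp 1) ≤ 0.93 * q := by
    rw [← mul_div_assoc, div_le_iff₀ (Real.exp_pos 1)]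
    have := Real.exp_one_gt_d9
    nlinarith
  linarith

lemma int_ball_le (H : Loc p v e b L h) (n : ℕ) {g : ℂ → ℝ} (hg : Integrable g) {c : ℝ} (hc : 0 ≤ c) (h1 : ∀ y, ‖y‖ < b → g y ≤ c) (h2 : ∀ y, b ≤ ‖y‖ → g y = 0) :
    ∫ y, g y ≤ c := by
  have e1 : ∫ y, g y = ∫ y in ball (0:ℂ) b, g y := by
    rw [← integral_indicator measurableSet_ball]
    congr 1; ext y
    by_cases hy : ‖y‖ < b
    · rw [Set.indicator_of_mem (by simpa using hy)]
    · rw [Set.indicator_of_notMem (by simpa using hy), h2 y (not_lt.1 hy)]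
  rw [e1]
  have := setIntegral_mono_on (s := ball (0:ℂ) b) (μ := volume) hg.integrableOn (integrableOn_const measure_ball_lt_top.ne) measurableSet_ball (g := fun _ => c) (fun y hy => h1 y (by simpa using hy))
  refine this.trans ?_
  rw [setIntegral_const, smul_eq_mul]
  have h1 := vol_ball b H.b0 H.b1
  calc _ ≤ 1 * c := mul_le_mul_of_nonneg_right h1 hc
    _ = c := one_mul c

lemma Neg_lim (H : Loc p v e b L h) (hA : ∀ᶠ n in atTop, A p v b n ≤ 32 * π) : Tendsto (Neg p v b) atTop (𝓝 0) := by
  have h1 := pow_geom H.hp 1 (t := 1/2) (by norm_num) (by norm_num)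
  refine tendsto_of_tendsto_of_tendsto_of_le_of_le' tendsto_const_nhds h1 (Eventually.of_forall fun n => Neg_nonneg n) ?_
  filter_upwards [H.neg_small hA (δ := 1/2) (by norm_num)] with n hn
  have hp := H.hp1 n
  have h0 : 0 ≤ p n ^ 1 * (1/2:ℝ) ^ p n := by positivity
  refine H.int_ball_le n (H.kint n).neg_part h0 (fun y hy => max_le ?_ h0) (fun y hy => by simp [dns_out hy])
  rcases le_total 0 (v n y) with h2 | h2
  · rw [dns_in hy]
    have : 0 ≤ p n * (|v n y| ^ (p n - 1) * v n y) := by positivity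
    linarith
  · refine (neg_le_abs _).trans ?_
    rw [dns_abs hp hy, pow_one]
    apply mul_le_mul_of_nonneg_left _ (by linarith)
    apply Real.rpow_le_rpow (abs_nonneg _) _ (by linarith)
    rw [abs_of_nonpos h2]; linarith [hn y hy.le]

lemma Ca_lim (H : Loc p v e b L h) (hA : ∀ᶠ n in atTop, A p v b n ≤ 32 * π) : Tendsto (Ca p v b) atTop (𝓝 (8 * π * √(Real.exp 1))) := by
  have h1 := (H.C_lim (H.Ca_ev hA one_pos)).add ((H.Neg_lim hA).const_mul 2)
  rw [mul_zero, add_zero] at h1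
  exact h1.congr fun n => by have := H.pn_add n; have := H.pn_sub n; linarith

lemma Pos_lim (H : Loc p v e b L h) (hA : ∀ᶠ n in atTop, A p v b n ≤ 32 * π) : Tendsto (Pos p v b) atTop (𝓝 (8 * π * √(Real.exp 1))) := by
  have h1 := (H.C_lim (H.Ca_ev hA one_pos)).add (H.Neg_lim hA)
  rw [add_zero] at h1
  exact h1.congr fun n => by have := H.pn_sub n; linarith

/-- maximum points -/
lemma max_ex (H : Loc p v e b L h) : ∃ x : ℕ → ℂ, ∀ n, ‖x n‖ ≤ b ∧ ∀ y, ‖y‖ ≤ b → v n y ≤ v n (x n) := by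
  have : ∀ n, ∃ x : ℂ, ‖x‖ ≤ b ∧ ∀ y, ‖y‖ ≤ b → v n y ≤ v n x := by
    intro n
    obtain ⟨x0, hx0, hmax⟩ := (isCompact_closedBall (0:ℂ) b).exists_isMaxOn ⟨0, by simp [H.b0.le]⟩ (H.cont n)
    exact ⟨x0, by simpa using hx0, fun y hy => hmax (by simpa using hy)⟩
  choose x hx using this
  exact ⟨x, hx⟩

lemma M_half (H : Loc p v e b L h) (hA : ∀ᶠ n in atTop, A p v b n ≤ 32 * π) {x : ℕ → ℂ}
    (hx : ∀ n, ‖x n‖ ≤ b ∧ ∀ y, ‖y‖ ≤ b → v n y ≤ v n (x n)) : ∀ᶠ n in atTop, 1 / 2 ≤ v n (x n) := by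
  have h1 := pow_geom H.hp 1 (t := 1/2) (by norm_num) (by norm_num)
  have hs := sqrt_e_bd
  have hpi := Real.pi_gt_three
  filter_upwards [H.neg_small hA (δ := 1/2) (by norm_num), h1.eventually (gt_mem_nhds one_pos), (H.Ca_lim hA).eventually (lt_mem_nhds (show 1 < 8 * π * √(Real.exp 1) by nlinarith))] with n hn h2 h3
  by_contra hcon
  push Not at hcon
  have hp := H.hp1 n
  have h0 : 0 ≤ p n ^ 1 * (1/2:ℝ) ^ p n := by positivity
  have : Ca p v b n ≤ p n ^ 1 * (1/2:ℝ) ^ p n := by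
    refine H.int_ball_le n (H.kint n).abs h0 (fun y hy => ?_) (fun y hy => by simp [dns_out hy])
    rw [dns_abs hp hy, pow_one]
    apply mul_le_mul_of_nonneg_left _ (by linarith)
    apply Real.rpow_le_rpow (abs_nonneg _) _ (by linarith)
    rw [abs_le]; exact ⟨hn y hy.le, ((hx n).2 y hy.le).trans hcon.le⟩
  linarith

lemma M_lower (H : Loc p v e b L h) (hA : ∀ᶠ n in atTop, A p v b n ≤ 32 * π) {x : ℕ → ℂ}
    (hx : ∀ n, ‖x n‖ ≤ b ∧ ∀ y, ‖y‖ ≤ b → v n y ≤ v n (x n)) {δ : ℝ} (hδ : 0 < δ) :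
    ∀ᶠ n in atTop, √(Real.exp 1) - δ ≤ v n (x n) := by
  have hpi := Real.pi_pos
  have hCa := H.Ca_ev hA one_pos
  obtain ⟨T, hT0, hT⟩ := H.e_bdd hCa
  have he := err_lim H.hp (32 * π + 1) T
  have hs := sqrt_e_bd
  have hP : Tendsto (fun n => Pos p v b n / (4 * π)) atTop (𝓝 (2 * √(Real.exp 1))) := by
    have := (H.Pos_lim hA).div_const (4 * π)
    refine this.trans (le_of_eq ?_)
    congr 1; field_simp; norm_num
  set η := min (1/4) (δ / 8) with hη
  have hη0 : 0 < η := by rw [hη]; apply lt_min <;> positivity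
  have hη1 : η ≤ 1/4 := min_le_left _ _
  have hη2 : η ≤ δ / 8 := min_le_right _ _
  filter_upwards [hCa, hT, he.eventually (gt_mem_nhds hη0), H.M_half hA hx, hP.eventually (gt_mem_nhds (show 2 * √(Real.exp 1) < 2 * √(Real.exp 1) + η by linarith))] with n h1 h2 h3 h4 h5
  set M := v n (x n) with hM
  have hb := H.sup_bd n h1 h2 (q := M) (hx n).2 (hx n).1
  rw [← hM] at hb
  by_contra hcon
  push Not at hcon
  rcases le_total M 1 with h6 | h6
  · rw [max_eq_left h6, Real.log_one] at hb; linarith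
  rw [max_eq_right h6] at hb
  have hl0 : 0 ≤ Real.log M := Real.log_nonneg h6
  have hl1 : Real.log M ≤ M := (Real.log_le_sub_one_of_pos (by linarith)).trans (by linarith)
  have h7 : Pos p v b n / (4 * π) * Real.log M ≤ 2 * √(Real.exp 1) * Real.log M + η * M := by
    calc _ ≤ (2 * √(Real.exp 1) + η) * Real.log M := mul_le_mul_of_nonneg_right h5.le hl0
      _ ≤ _ := by nlinarith
  have h8 : 2 * √(Real.exp 1) * Real.log M ≤ 2 * M - √(Real.exp 1) := by
    have hs0 : 0 < √(Real.exp 1) := by positivity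
    have a := Real.log_le_sub_one_of_pos (show 0 < M / √(Real.exp 1) by positivity)
    rw [Real.log_div (by linarith) hs0.ne', Real.log_sqrt (Real.exp_pos 1).le, Real.log_exp] at a
    have b' := mul_le_mul_of_nonneg_left a (show 0 ≤ 2 * √(Real.exp 1) by positivity)
    have c' : 2 * √(Real.exp 1) * (M / √(Real.exp 1) - 1) = 2 * M - 2 * √(Real.exp 1) := by field_simp
    rw [c'] at b'
    linarith
  nlinarith

lemma x_lim (H : Loc p v e b L h) (hA : ∀ᶠ n in atTop, A p v b n ≤ 32 * π) {x : ℕ → ℂ}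
    (hx : ∀ n, ‖x n‖ ≤ b ∧ ∀ y, ‖y‖ ≤ b → v n y ≤ v n (x n)) : Tendsto x atTop (𝓝 0) := by
  rw [tendsto_zero_iff_norm_tendsto_zero, Metric.tendsto_atTop']
  intro s hs
  obtain ⟨K, hK0, hK⟩ := H.ann hs
  obtain ⟨N, hN⟩ := eventually_atTop.1 (hK.and ((H.M_half hA hx).and (H.hp.eventually_gt_atTop (2 * K))))
  refine ⟨N, fun n hn => ?_⟩
  obtain ⟨h1, h2, h3⟩ := hN n hn.le
  rw [dist_zero_right, norm_norm]
  by_contra hcon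
  push Not at hcon
  have := (le_abs_self _).trans (h1 (x n) hcon (hx n).1)
  have hp := H.hp1 n
  have : K / p n < 1 / 2 := by rw [div_lt_iff₀ (by linarith)]; linarith
  linarith

end Loc

lemma cov {ε : ℝ} (hε : 0 < ε) (x : ℂ) (F : ℂ → ℝ) : ∫ ζ, F (x + ε * ζ) = (ε ^ 2)⁻¹ * ∫ y, F y := by
  have e1 : (fun ζ => F (x + ε * ζ)) = fun ζ => (fun z => F (x + z)) (ε • ζ) := by ext ζ; simp
  rw [e1, Measure.integral_comp_smul volume (fun z => F (x + z)) ε, integral_add_left_eq_self (fun z => F z) x]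
  simp

lemma cov_int {ε : ℝ} (hε : 0 < ε) (x : ℂ) {F : ℂ → ℝ} (hF : Integrable F) : Integrable (fun ζ => F (x + ε * ζ)) := by
  have e1 : (fun ζ => F (x + ε * ζ)) = fun ζ => (fun z => F (x + z)) (ε • ζ) := by ext ζ; simp
  rw [e1]
  exact (hF.comp_add_left x).comp_smul hε.ne'

structure LM (p : ℕ → ℝ) (v e : ℕ → ℂ → ℝ) (b L : ℝ) (h : ℂ → ℝ) (x : ℕ → ℂ) : Prop where
  H : Loc p v e b L h
  hA : ∀ᶠ n in atTop, Loc.A p v b n ≤ 32 * π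
  hx : ∀ n, ‖x n‖ ≤ b ∧ ∀ y, ‖y‖ ≤ b → v n y ≤ v n (x n)

namespace LM
variable {p : ℕ → ℝ} {v e : ℕ → ℂ → ℝ} {b L : ℝ} {h : ℂ → ℝ} {x : ℕ → ℂ}

def M (v : ℕ → ℂ → ℝ) (x : ℕ → ℂ) (n : ℕ) : ℝ := v n (x n)
def eps (p : ℕ → ℝ) (v : ℕ → ℂ → ℝ) (x : ℕ → ℂ) (n : ℕ) : ℝ := (√(p n * M v x n ^ (p n - 1)))⁻¹
def kap (p : ℕ → ℝ) (v : ℕ → ℂ → ℝ) (b : ℝ) (x : ℕ → ℂ) (n : ℕ) (ζ : ℂ) : ℝ :=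
  dns b (p n) (v n) (x n + eps p v x n * ζ) / (p n * M v x n ^ p n)
def EE (p : ℕ → ℝ) (v e : ℕ → ℂ → ℝ) (x : ℕ → ℂ) (n : ℕ) (z : ℂ) : ℝ :=
  (e n (x n + eps p v x n * z) - e n (x n)) / M v x n
def ww (p : ℕ → ℝ) (v e : ℕ → ℂ → ℝ) (b : ℝ) (x : ℕ → ℂ) (n : ℕ) (z : ℂ) : ℝ :=
  -(1 / (2 * π)) * Pot (kap p v b x n) z + EE p v e x n z

lemma M_ge (S : LM p v e b L h x) : ∀ᶠ n in atTop, 1.5 ≤ M v x n := by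
  filter_upwards [S.H.M_lower S.hA S.hx (δ := 0.1) (by norm_num)] with n hn
  have := sqrt_e_bd; rw [M]; linarith

lemma eps_pos (S : LM p v e b L h x) : ∀ᶠ n in atTop, 0 < eps p v x n := by
  filter_upwards [S.M_ge] with n hn
  have := S.H.hp1 n
  rw [eps]; positivity

lemma eps_sq (S : LM p v e b L h x) : ∀ᶠ n in atTop, eps p v x n ^ 2 = (p n * M v x n ^ (p n - 1))⁻¹ := by
  filter_upwards [S.M_ge] with n hn
  have := S.H.hp1 n
  rw [eps, inv_pow, Real.sq_sqrt (by positivity)]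

lemma eps_M (S : LM p v e b L h x) : ∀ᶠ n in atTop, eps p v x n ^ 2 * (p n * M v x n ^ p n) = M v x n := by
  filter_upwards [S.M_ge, S.eps_sq] with n hn h1
  have := S.H.hp1 n
  rw [h1, Real.rpow_sub_one (by positivity)]
  have : M v x n ^ p n ≠ 0 := by positivity
  have : M v x n ≠ 0 := by positivity
  have : p n ≠ 0 := by positivity
  field_simp

lemma p_eps (S : LM p v e b L h x) : Tendsto (fun n => p n * eps p v x n) atTop (𝓝 0) := by
  have h1 : Tendsto (fun n => (p n * eps p v x n) ^ 2) atTop (𝓝 0) := by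
    have h2 := (pow_geom S.H.hp 1 (t := 2/3) (by norm_num) (by norm_num)).mul_const (3/2)
    rw [zero_mul] at h2
    refine tendsto_of_tendsto_of_tendsto_of_le_of_le' tendsto_const_nhds h2 (Eventually.of_forall fun n => sq_nonneg _) ?_
    filter_upwards [S.M_ge, S.eps_sq] with n hn h3
    have hp := S.H.hp1 n
    rw [mul_pow, h3]
    have hM : 0 < M v x n ^ (p n - 1) := by positivity
    have e1 : p n ^ 2 * (p n * M v x n ^ (p n - 1))⁻¹ = p n * (M v x n ^ (p n - 1))⁻¹ := by field_simp
    rw [e1, pow_one, mul_assoc]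
    apply mul_le_mul_of_nonneg_left _ (by linarith)
    have e2 : (2/3:ℝ) ^ p n * (3/2) = ((1.5:ℝ) ^ (p n - 1))⁻¹ := by
      rw [Real.rpow_sub_one (by norm_num), inv_div, show (2/3:ℝ) = (1.5)⁻¹ by norm_num, Real.inv_rpow (by norm_num)]
      rw [div_eq_mul_inv, mul_comm]; norm_num; exact (div_eq_mul_inv _ _).symm
    rw [e2]
    apply inv_anti₀ (by positivity)
    exact Real.rpow_le_rpow (by norm_num) hn (by linarith)
  have h2 := (Real.continuous_sqrt.tendsto 0).comp h1
  rw [Real.sqrt_zero] at h2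
  refine h2.congr' ?_
  filter_upwards [S.eps_pos] with n hn
  have hp := S.H.hp1 n
  simp only [Function.comp]
  rw [Real.sqrt_sq (by positivity)]

lemma eps_lim (S : LM p v e b L h x) : Tendsto (eps p v x) atTop (𝓝 0) := by
  refine tendsto_of_tendsto_of_tendsto_of_le_of_le' tendsto_const_nhds S.p_eps ?_ ?_
  · filter_upwards [S.eps_pos] with n hn using hn.le
  · filter_upwards [S.eps_pos] with n hn
    have := S.H.hp1 n; nlinarith

/-- change of variables -/
lemma cv (S : LM p v e b L h x) : ∀ᶠ n in atTop, ∀ g : ℂ → ℝ,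
    ∫ y, g y * dns b (p n) (v n) y = M v x n * ∫ ζ, g (x n + eps p v x n * ζ) * kap p v b x n ζ := by
  filter_upwards [S.M_ge, S.eps_pos, S.eps_M] with n hn he hm g
  have hp := S.H.hp1 n
  have hB : 0 < p n * M v x n ^ p n := by positivity
  have h1 := cov he (x n) (fun y => g y * dns b (p n) (v n) y)
  have h2 : ∫ ζ, g (x n + eps p v x n * ζ) * kap p v b x n ζ = (p n * M v x n ^ p n)⁻¹ * ∫ ζ, (fun y => g y * dns b (p n) (v n) y) (x n + eps p v x n * ζ) := by
    rw [← integral_const_mul]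
    congr 1; ext ζ; rw [kap]; ring
  rw [h2, h1]
  have hI : (p n * M v x n ^ p n)⁻¹ * (eps p v x n ^ 2)⁻¹ = (M v x n)⁻¹ := by
    rw [← mul_inv, mul_comm, hm]
  rw [← mul_assoc (p n * M v x n ^ p n)⁻¹, hI, ← mul_assoc, mul_inv_cancel₀ (by linarith), one_mul]

lemma kap_int (S : LM p v e b L h x) : ∀ᶠ n in atTop, Integrable (kap p v b x n) := by
  filter_upwards [S.eps_pos] with n he
  exact (cov_int he (x n) (S.H.kint n)).div_const _

lemma kap_mass (S : LM p v e b L h x) : ∀ᶠ n in atTop, ∫ ζ, kap p v b x n ζ = Loc.C p v b n / M v x n := by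
  filter_upwards [S.cv, S.M_ge] with n h1 h2
  have := h1 (fun _ => 1)
  simp only [one_mul] at this
  rw [Loc.C, this]; field_simp

lemma kap_massa (S : LM p v e b L h x) : ∀ᶠ n in atTop, ∫ ζ, |kap p v b x n ζ| = Loc.Ca p v b n / M v x n := by
  filter_upwards [S.M_ge, S.eps_pos, S.eps_M] with n hn he hm
  have hp := S.H.hp1 n
  have hB : 0 < p n * M v x n ^ p n := by positivity
  have h1 := cov he (x n) (fun y => |dns b (p n) (v n) y|)
  have h2 : ∫ ζ, |kap p v b x n ζ| = (p n * M v x n ^ p n)⁻¹ * ∫ ζ, (fun y => |dns b (p n) (v n) y|) (x n + eps p v x n * ζ) := by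
    rw [← integral_const_mul]
    congr 1; ext ζ; rw [kap, abs_div, abs_of_pos hB]; ring
  rw [h2, h1, Loc.Ca]
  have hI : (p n * M v x n ^ p n)⁻¹ * (eps p v x n ^ 2)⁻¹ = (M v x n)⁻¹ := by
    rw [← mul_inv, mul_comm, hm]
  rw [← mul_assoc (p n * M v x n ^ p n)⁻¹, hI]; ring

lemma v_abs (S : LM p v e b L h x) : ∀ᶠ n in atTop, ∀ y, ‖y‖ ≤ b → |v n y| ≤ M v x n := by
  filter_upwards [S.M_ge, S.H.neg_small S.hA one_pos] with n h1 h2 y hy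
  rw [abs_le]
  exact ⟨by have := h2 y hy; linarith, (S.hx n).2 y hy⟩

lemma kap_le (S : LM p v e b L h x) : ∀ᶠ n in atTop, ∀ ζ, |kap p v b x n ζ| ≤ 1 := by
  filter_upwards [S.M_ge, S.v_abs] with n hn hv ζ
  have hp := S.H.hp1 n
  have hB : 0 < p n * M v x n ^ p n := by positivity
  rw [kap, abs_div, abs_of_pos hB, div_le_one hB]
  by_cases hy : ‖x n + eps p v x n * ζ‖ < b
  · rw [dns_abs hp hy]
    apply mul_le_mul_of_nonneg_left _ (by linarith)
    exact Real.rpow_le_rpow (abs_nonneg _) (hv _ hy.le) (by linarith)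
  · rw [dns_out (not_lt.1 hy)]; simpa using hB.le

lemma kap_dens (S : LM p v e b L h x) : ∀ᶠ n in atTop, Dens (kap p v b x n) 1 (32 * π + 1) := by
  filter_upwards [S.kap_int, S.kap_le, S.kap_massa, S.M_ge, S.H.Ca_ev S.hA one_pos] with n h1 h2 h3 h4 h5
  refine ⟨h1, h2, ?_⟩
  simp_rw [Real.norm_eq_abs]
  rw [h3, div_le_iff₀ (by linarith)]
  have := Loc.Ca_nonneg (p := p) (v := v) (b := b) n
  nlinarith

lemma w_form (S : LM p v e b L h x) : ∀ᶠ n in atTop, ∀ z, ‖x n + eps p v x n * z‖ ≤ b →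
    ww p v e b x n z = p n * (v n (x n + eps p v x n * z) / M v x n - 1) := by
  filter_upwards [S.M_ge, S.eps_pos, S.cv] with n hn he hcv z hz
  have hr1 := S.H.rep n _ hz
  have hr2 := S.H.rep n _ (S.hx n).1
  set ε := eps p v x n
  have h1 : (∫ y, Real.log ‖x n + ε * z - y‖ * dns b (p n) (v n) y) - (∫ y, Real.log ‖x n - y‖ * dns b (p n) (v n) y) = M v x n * Pot (kap p v b x n) z := by
    rw [← integral_sub (S.H.logk_int n hz) (S.H.logk_int n (S.hx n).1)]
    simp_rw [← sub_mul]
    rw [hcv (fun y => Real.log ‖x n + ε * z - y‖ - Real.log ‖x n - y‖), Pot]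
    congr 1
    apply integral_congr_ae
    filter_upwards [ae_ne z, ae_ne 0] with ζ h1 h2
    have a1 : x n + ε * z - (x n + ε * ζ) = ε * (z - ζ) := by ring
    have a2 : x n - (x n + ε * ζ) = -(ε * ζ) := by ring
    have hne : ‖(ε:ℂ)‖ ≠ 0 := by simp [he.ne']
    have hz1 : ‖z - ζ‖ ≠ 0 := by rw [norm_ne_zero_iff]; exact sub_ne_zero.2 (Ne.symm h1)
    have hz2 : ‖ζ‖ ≠ 0 := by rwa [norm_ne_zero_iff]
    simp only [a1, a2, norm_neg, norm_mul]
    rw [Real.log_mul hne hz1, Real.log_mul hne hz2]; ring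
  have h2 : p n * v n (x n + ε * z) - p n * M v x n = -(1 / (2 * π)) * (M v x n * Pot (kap p v b x n) z) + (e n (x n + ε * z) - e n (x n)) := by
    rw [← h1, hr1, M, hr2]; ring
  have hM : M v x n ≠ 0 := by linarith
  have h3 : p n * (v n (x n + ε * z) / M v x n - 1) = (p n * v n (x n + ε * z) - p n * M v x n) / M v x n := by field_simp
  rw [h3, h2, ww, EE, add_div]
  congr 1
  field_simp

lemma E_lip (S : LM p v e b L h x) : ∀ᶠ n in atTop, ∀ z z', |EE p v e x n z - EE p v e x n z'| ≤ L * eps p v x n * ‖z - z'‖ := by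
  filter_upwards [S.M_ge, S.eps_pos, S.H.elip] with n hn he hl z z'
  rw [EE, EE, ← sub_div, abs_div, abs_of_pos (by linarith : 0 < M v x n), div_le_iff₀ (by linarith)]
  have h1 := hl (x n + eps p v x n * z) (x n + eps p v x n * z')
  have h2 : ‖x n + eps p v x n * z - (x n + eps p v x n * z')‖ = eps p v x n * ‖z - z'‖ := by
    rw [show x n + eps p v x n * z - (x n + eps p v x n * z') = eps p v x n * (z - z') by ring, norm_mul, Complex.norm_real, Real.norm_eq_abs, abs_of_pos he]
  rw [h2] at h1
  have h3 : e n (x n + eps p v x n * z) - e n (x n) - (e n (x n + eps p v x n * z') - e n (x n)) = e n (x n + eps p v x n * z) - e n (x n + eps p v x n * z') := by ring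
  rw [h3]
  have : 0 ≤ L * (eps p v x n * ‖z - z'‖) := by have := S.H.L0; positivity
  nlinarith

lemma kap_form (S : LM p v e b L h x) : ∀ᶠ n in atTop, ∀ z, ‖x n + eps p v x n * z‖ < b →
    kap p v b x n z = |1 + ww p v e b x n z / p n| ^ (p n - 1) * (1 + ww p v e b x n z / p n) := by
  filter_upwards [S.M_ge, S.w_form] with n hn hw z hz
  have hp := S.H.hp1 n
  have hM : 0 < M v x n := by linarith
  have hp0 : p n ≠ 0 := by linarith
  rw [hw z hz.le]
  have e1 : 1 + p n * (v n (x n + eps p v x n * z) / M v x n - 1) / p n = v n (x n + eps p v x n * z) / M v x n := by field_simp; ring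
  rw [e1, kap, dns_in hz, abs_div, abs_of_pos hM, Real.div_rpow (abs_nonneg _) hM.le, Real.rpow_sub_one hM.ne']
  have : M v x n ^ p n ≠ 0 := by positivity
  field_simp

lemma dom (S : LM p v e b L h x) (R : ℝ) : ∀ᶠ n in atTop, ∀ z : ℂ, ‖z‖ ≤ R → ‖x n + eps p v x n * z‖ < b := by
  have h1 : Tendsto (fun n => ‖x n‖ + eps p v x n * |R|) atTop (𝓝 (‖(0:ℂ)‖ + 0 * |R|)) :=
    (S.H.x_lim S.hA S.hx).norm.add (S.eps_lim.mul_const _)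
  rw [norm_zero, zero_mul, add_zero] at h1
  filter_upwards [h1.eventually (gt_mem_nhds S.H.b0), S.eps_pos] with n h2 he z hz
  refine lt_of_le_of_lt (norm_add_le _ _) (lt_of_le_of_lt ?_ h2)
  rw [norm_mul, Complex.norm_real, Real.norm_eq_abs, abs_of_pos he]
  have : ‖z‖ ≤ |R| := hz.trans (le_abs_self _)
  gcongr

lemma w_nonpos (S : LM p v e b L h x) : ∀ᶠ n in atTop, ∀ z, ‖x n + eps p v x n * z‖ ≤ b → ww p v e b x n z ≤ 0 := by
  filter_upwards [S.w_form, S.M_ge] with n h1 h2 z hz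
  rw [h1 z hz]
  have hp := S.H.hp1 n
  apply mul_nonpos_of_nonneg_of_nonpos (by linarith)
  rw [sub_nonpos, div_le_one (by linarith)]
  exact (S.hx n).2 _ hz

lemma blow (S : LM p v e b L h x) : BlowSeq p (kap p v b x) (ww p v e b x) (EE p v e x) (fun n => L * eps p v x n) (32 * π + 1) where
  hp := S.H.hp
  dens := S.kap_dens
  rep := Eventually.of_forall fun n z => rfl
  E0 := Eventually.of_forall fun n => by simp [EE]
  Elip := S.E_lip
  hτ := by have := S.eps_lim.const_mul L; rwa [mul_zero] at this
  loc := by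
    intro R
    filter_upwards [S.dom R, S.kap_form, S.w_nonpos] with n h1 h2 h3 z hz
    exact ⟨h3 z (h1 z hz).le, h2 z (h1 z hz)⟩

lemma conv (S : LM p v e b L h x) (z : ℂ) : Tendsto (fun n => ww p v e b x n z) atTop (𝓝 (Ub z)) := S.blow.conv z
lemma conv_kap (S : LM p v e b L h x) (z : ℂ) : Tendsto (fun n => kap p v b x n z) atTop (𝓝 (Real.exp (Ub z))) := S.blow.conv_kappa z

end LM

namespace LM
variable {p : ℕ → ℝ} {v e : ℕ → ℂ → ℝ} {b L : ℝ} {h : ℂ → ℝ} {x : ℕ → ℂ}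

lemma ball_mass (S : LM p v e b L h x) (R : ℝ) :
    Tendsto (fun n => ∫ ζ in ball (0:ℂ) R, kap p v b x n ζ) atTop (𝓝 (∫ ζ in ball (0:ℂ) R, Real.exp (Ub ζ))) := by
  apply tendsto_integral_filter_of_dominated_convergence (fun _ => 1)
  · filter_upwards [S.kap_int] with n hn using hn.1.restrict
  · filter_upwards [S.kap_le] with n hn using ae_of_all _ hn
  · exact integrableOn_const measure_ball_lt_top.ne
  · exact ae_of_all _ fun z => S.conv_kap z

lemma expU_ball {δ : ℝ} (hδ : 0 < δ) : ∃ R : ℝ, 1 ≤ R ∧ 8 * π - δ < ∫ ζ in ball (0:ℂ) R, Real.exp (Ub ζ) := by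
  have h1 : Tendsto (fun k : ℕ => ∫ ζ in ball (0:ℂ) (k:ℝ), Real.exp (Ub ζ)) atTop (𝓝 (∫ ζ in ⋃ k : ℕ, ball (0:ℂ) (k:ℝ), Real.exp (Ub ζ))) := by
    apply tendsto_setIntegral_of_monotone (fun _ => measurableSet_ball)
    · intro i j hij; exact ball_subset_ball (by exact_mod_cast hij)
    · exact expU_int.integrableOn
  have h2 : (⋃ k : ℕ, ball (0:ℂ) (k:ℝ)) = Set.univ := by
    ext z; simp
  rw [h2, setIntegral_univ, expU_mass] at h1
  obtain ⟨k, hk1, hk2⟩ := ((h1.eventually (lt_mem_nhds (show 8 * π - δ < 8 * π by linarith))).and (eventually_ge_atTop 1)).exists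
  exact ⟨k, by exact_mod_cast hk2, hk1⟩

lemma M_lim (S : LM p v e b L h x) : Tendsto (M v x) atTop (𝓝 (√(Real.exp 1))) := by
  have hs := sqrt_e_bd
  have hpi := Real.pi_gt_three
  rw [tendsto_order]
  constructor
  · intro a ha
    filter_upwards [S.H.M_lower S.hA S.hx (δ := (√(Real.exp 1) - a) / 2) (by linarith)] with n hn
    rw [M]; linarith
  · intro a ha
    set δ := min 1 (a - √(Real.exp 1)) with hδ
    have hδ0 : 0 < δ := by rw [hδ]; exact lt_min one_pos (by linarith)
    have hδ1 : δ ≤ 1 := min_le_left _ _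
    have hδ2 : δ ≤ a - √(Real.exp 1) := min_le_right _ _
    obtain ⟨R, hR, hR2⟩ := expU_ball hδ0
    filter_upwards [(S.ball_mass R).eventually (lt_mem_nhds hR2), S.kap_massa, S.M_ge, S.kap_int, (S.H.Ca_lim S.hA).eventually (gt_mem_nhds (show 8 * π * √(Real.exp 1) < 8 * π * √(Real.exp 1) + δ by linarith))] with n h1 h2 h3 h4 h5
    have h6 : ∫ ζ in ball (0:ℂ) R, kap p v b x n ζ ≤ ∫ ζ, |kap p v b x n ζ| :=
      (integral_mono h4.integrableOn h4.abs.integrableOn fun ζ => le_abs_self _).trans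
        (setIntegral_le_integral h4.abs (ae_of_all _ fun _ => abs_nonneg _))
    rw [h2] at h6
    have h7 : (8 * π - δ) * M v x n < 8 * π * √(Real.exp 1) + δ := by
      have := h1.trans_le h6
      rw [lt_div_iff₀ (by linarith)] at this
      linarith
    by_contra hcon
    push Not at hcon
    nlinarith

lemma M_le_two (S : LM p v e b L h x) : ∀ᶠ n in atTop, M v x n ≤ 2 := by
  filter_upwards [S.M_lim.eventually (gt_mem_nhds (show √(Real.exp 1) < 2 by linarith [sqrt_e_bd.2]))] with n hn using hn.le

lemma C_lim (S : LM p v e b L h x) : Tendsto (Loc.C p v b) atTop (𝓝 (8 * π * √(Real.exp 1))) :=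
  S.H.C_lim (S.H.Ca_ev S.hA one_pos)

lemma Ca_M_lim (S : LM p v e b L h x) : Tendsto (fun n => Loc.Ca p v b n / M v x n) atTop (𝓝 (8 * π)) := by
  have hs := sqrt_e_bd
  have := (S.H.Ca_lim S.hA).div S.M_lim (by linarith)
  rw [mul_div_assoc, div_self (by linarith), mul_one] at this
  exact this

/-- tail mass -/
lemma tails (S : LM p v e b L h x) : ∃ R : ℝ, 1 ≤ R ∧ ∀ᶠ n in atTop, 8 * π - π / 4 ≤ ∫ ζ in ball (0:ℂ) R, kap p v b x n ζ ∧
    ∫ ζ in (ball (0:ℂ) R)ᶜ, |kap p v b x n ζ| ≤ π / 2 := by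
  have hpi := Real.pi_pos
  obtain ⟨R, hR, hR2⟩ := expU_ball (show 0 < π / 4 by positivity)
  refine ⟨R, hR, ?_⟩
  filter_upwards [(S.ball_mass R).eventually (lt_mem_nhds hR2), S.kap_massa, S.kap_int, S.Ca_M_lim.eventually (gt_mem_nhds (show 8 * π < 8 * π + π / 4 by linarith))] with n h1 h2 h3 h4
  refine ⟨h1.le, ?_⟩
  have h5 := integral_add_compl (measurableSet_ball (x := (0:ℂ)) (ε := R)) h3.abs
  have h6 : ∫ ζ in ball (0:ℂ) R, kap p v b x n ζ ≤ ∫ ζ in ball (0:ℂ) R, |kap p v b x n ζ| :=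
    integral_mono h3.integrableOn h3.abs.integrableOn fun ζ => le_abs_self _
  linarith

lemma log_quot {a c : ℝ} (ha : 1 ≤ a) (hc : 1 ≤ c) {r : ℝ} (hr : 0 ≤ r) (h1 : a ≤ c + r) (h2 : c ≤ a + r) :
    |Real.log a - Real.log c| ≤ Real.log (1 + r) := by
  have g : ∀ {a c : ℝ}, 1 ≤ a → 1 ≤ c → a ≤ c + r → Real.log a ≤ Real.log c + Real.log (1 + r) := by
    intro a c ha hc h
    rw [← Real.log_mul (by linarith) (by linarith)]
    apply Real.log_le_log (by linarith); nlinarith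
  have := g ha hc h1; have := g hc ha h2
  rw [abs_le]; constructor <;> linarith

lemma pot_lower {κ : ℂ → ℝ} {K R : ℝ} (hd : Dens κ 1 K) (hR : 1 ≤ R) (h1 : 8 * π - π / 4 ≤ ∫ ζ in ball (0:ℂ) R, κ ζ)
    (h2 : ∫ ζ in (ball (0:ℂ) R)ᶜ, |κ ζ| ≤ π / 2) {z : ℂ} (hz : 2 * R ≤ ‖z‖) :
    7 * π * Real.log ‖z‖ - ((1 + R) * K + 2 * cK + π) ≤ Pot κ z := by
  have hpi := Real.pi_pos
  have hz1 : 2 ≤ ‖z‖ := by linarith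
  have hlz : 0 ≤ Real.log ‖z‖ := Real.log_nonneg (by linarith)
  have hI := hd.Pot_int z
  have hk1 : ∀ ζ, |κ ζ| ≤ 1 := hd.bd
  have hmass : ∫ ζ, |κ ζ| ≤ K := hd.mass
  rw [Pot, ← integral_add_compl (measurableSet_ball (x := (0:ℂ)) (ε := R)) hI]
  -- inside
  have hin : Real.log ‖z‖ * (∫ ζ in ball (0:ℂ) R, κ ζ) - ((1 + R) * K + cK) ≤ ∫ ζ in ball (0:ℂ) R, (Real.log ‖z - ζ‖ - Real.log ‖ζ‖) * κ ζ := by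
    have hi1 : IntegrableOn (fun ζ => Real.log ‖z‖ * κ ζ - ((1 + R) * |κ ζ| + sker ζ)) (ball (0:ℂ) R) :=
      ((hd.int.const_mul _).sub ((hd.int.abs.const_mul _).add ker_integrable)).integrableOn
    have hm := setIntegral_mono_on hi1 hI.integrableOn measurableSet_ball (fun ζ hζ => by
      have hζ : ‖ζ‖ < R := by simpa using hζ
      have a1 : |Real.log ‖z - ζ‖ - Real.log ‖z‖| ≤ 1 := by
        have b1 : ‖z‖ / 2 ≤ ‖z - ζ‖ := by have := norm_sub_norm_le z ζ; linarith
        have b2 : ‖z - ζ‖ ≤ 2 * ‖z‖ := by have := norm_sub_le z ζ; linarith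
        have c1 := Real.log_le_log (by linarith) b1
        have c2 := Real.log_le_log (by linarith) b2
        rw [Real.log_div (by linarith) (by norm_num)] at c1
        rw [Real.log_mul (by norm_num) (by linarith)] at c2
        have := Real.log_two_lt_d9
        rw [abs_le]; constructor <;> linarith
      have a2 := abs_log_le ζ
      have a3 : |(Real.log ‖z - ζ‖ - Real.log ‖z‖ - Real.log ‖ζ‖) * κ ζ| ≤ (1 + R) * |κ ζ| + sker ζ := by
        rw [abs_mul]
        have : |Real.log ‖z - ζ‖ - Real.log ‖z‖ - Real.log ‖ζ‖| ≤ (1 + R) + sker ζ := by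
          refine (abs_sub _ _).trans ?_; linarith
        calc _ ≤ ((1 + R) + sker ζ) * |κ ζ| := mul_le_mul_of_nonneg_right this (abs_nonneg _)
          _ ≤ _ := by have := mul_le_mul_of_nonneg_left (hk1 ζ) (ker_nonneg ζ); linarith
      have a4 := neg_abs_le ((Real.log ‖z - ζ‖ - Real.log ‖z‖ - Real.log ‖ζ‖) * κ ζ)
      have a5 : (Real.log ‖z - ζ‖ - Real.log ‖ζ‖) * κ ζ = Real.log ‖z‖ * κ ζ + (Real.log ‖z - ζ‖ - Real.log ‖z‖ - Real.log ‖ζ‖) * κ ζ := by ring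
      show _ ≤ (Real.log ‖z - ζ‖ - Real.log ‖ζ‖) * κ ζ
      rw [a5]; linarith)
    refine le_trans ?_ hm
    have hj1 : IntegrableOn (fun ζ => Real.log ‖z‖ * κ ζ) (ball (0:ℂ) R) := (hd.int.const_mul _).integrableOn
    have hj2 : IntegrableOn (fun ζ => (1 + R) * |κ ζ| + sker ζ) (ball (0:ℂ) R) := ((hd.int.abs.const_mul _).add ker_integrable).integrableOn
    rw [integral_sub hj1 hj2, integral_const_mul]
    have hj3 : ∫ ζ in ball (0:ℂ) R, ((1 + R) * |κ ζ| + sker ζ) ≤ ∫ ζ, ((1 + R) * |κ ζ| + sker ζ) :=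
      setIntegral_le_integral ((hd.int.abs.const_mul _).add ker_integrable) (ae_of_all _ fun ζ => by
        have := ker_nonneg ζ
        show 0 ≤ (1 + R) * |κ ζ| + sker ζ
        have := abs_nonneg (κ ζ)
        nlinarith)
    rw [integral_add (hd.int.abs.const_mul _) ker_integrable, integral_const_mul, ← cK] at hj3
    have : (1 + R) * ∫ ζ, |κ ζ| ≤ (1 + R) * K := mul_le_mul_of_nonneg_left hmass (by linarith)
    linarith
  have hout : -(Real.log (1 + ‖z‖) * (π / 2) + cK) ≤ ∫ ζ in (ball (0:ℂ) R)ᶜ, (Real.log ‖z - ζ‖ - Real.log ‖ζ‖) * κ ζ := by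
    have hi1 : IntegrableOn (fun ζ => -(Real.log (1 + ‖z‖) * |κ ζ| + sker (z - ζ))) (ball (0:ℂ) R)ᶜ :=
      ((hd.int.abs.const_mul _).add (ker_shift_integrable z)).neg.integrableOn
    have hm := setIntegral_mono_on hi1 hI.integrableOn measurableSet_ball.compl (fun ζ hζ => by
      have hζ : R ≤ ‖ζ‖ := by simpa using hζ
      have hl0 : 0 ≤ Real.log (1 + ‖z‖) := Real.log_nonneg (by linarith)
      have a1 : |Real.log ‖z - ζ‖ - Real.log ‖ζ‖| ≤ Real.log (1 + ‖z‖) + sker (z - ζ) := by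
        rcases lt_or_ge ‖z - ζ‖ 1 with hs | hs
        · have b1 := ker_ge_log hs
          have b2 : |Real.log ‖ζ‖| ≤ Real.log (1 + ‖z‖) := by
            rw [abs_of_nonneg (Real.log_nonneg (by linarith))]
            apply Real.log_le_log (by linarith)
            have := norm_sub_norm_le ζ z; rw [norm_sub_rev] at this; linarith
          exact (abs_sub _ _).trans (by linarith)
        · have := log_quot hs (by linarith : 1 ≤ ‖ζ‖) (norm_nonneg z) (by have := norm_sub_le z ζ; linarith) (by have := norm_sub_norm_le ζ z; rw [norm_sub_rev] at this; linarith)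
          have := ker_nonneg (z - ζ); linarith
      have a3 : |(Real.log ‖z - ζ‖ - Real.log ‖ζ‖) * κ ζ| ≤ Real.log (1 + ‖z‖) * |κ ζ| + sker (z - ζ) := by
        rw [abs_mul]
        calc _ ≤ (Real.log (1 + ‖z‖) + sker (z - ζ)) * |κ ζ| := mul_le_mul_of_nonneg_right a1 (abs_nonneg _)
          _ ≤ _ := by have := mul_le_mul_of_nonneg_left (hk1 ζ) (ker_nonneg (z - ζ)); linarith
      exact (abs_le.1 a3).1)
    refine le_trans ?_ hm
    rw [integral_neg, neg_le_neg_iff, integral_add (hd.int.abs.const_mul _).integrableOn (ker_shift_integrable z).integrableOn, integral_const_mul]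
    have h3 : ∫ ζ in (ball (0:ℂ) R)ᶜ, sker (z - ζ) ≤ cK := by
      rw [← ker_shift_int z]; exact setIntegral_le_integral (ker_shift_integrable z) (ae_of_all _ fun ζ => ker_nonneg _)
    have : Real.log (1 + ‖z‖) * ∫ ζ in (ball (0:ℂ) R)ᶜ, |κ ζ| ≤ Real.log (1 + ‖z‖) * (π / 2) := mul_le_mul_of_nonneg_left h2 (Real.log_nonneg (by linarith))
    linarith
  have hl : Real.log (1 + ‖z‖) ≤ Real.log ‖z‖ + 1 := by
    have := Real.log_le_log (by linarith) (show 1 + ‖z‖ ≤ ‖z‖ * 2 by linarith)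
    rw [Real.log_mul (by linarith) (by norm_num)] at this
    have := Real.log_two_lt_d9
    linarith
  have h5 : Real.log ‖z‖ * (8 * π - π / 4) ≤ Real.log ‖z‖ * (∫ ζ in ball (0:ℂ) R, κ ζ) := mul_le_mul_of_nonneg_left h1 hlz
  have h6 : Real.log (1 + ‖z‖) * (π / 2) ≤ (Real.log ‖z‖ + 1) * (π / 2) := mul_le_mul_of_nonneg_right hl (by positivity)
  have h7 : 0 ≤ Real.log ‖z‖ * π := by positivity
  linarith

lemma eps_z (S : LM p v e b L h x) : ∀ᶠ n in atTop, ∀ z, ‖x n + eps p v x n * z‖ ≤ b → eps p v x n * ‖z‖ ≤ 1 := by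
  filter_upwards [S.eps_pos] with n he z hz
  have h1 : eps p v x n * ‖z‖ = ‖(x n + eps p v x n * z) - x n‖ := by
    rw [add_sub_cancel_left, norm_mul, Complex.norm_real, Real.norm_eq_abs, abs_of_pos he]
  rw [h1]
  have := norm_sub_le (x n + eps p v x n * z) (x n)
  have := (S.hx n).1; have := S.H.b1
  linarith

lemma decay_w (S : LM p v e b L h x) : ∃ R C0 : ℝ, 1 ≤ R ∧ ∀ᶠ n in atTop, ∀ z, ‖x n + eps p v x n * z‖ ≤ b → 2 * R ≤ ‖z‖ →
    ww p v e b x n z ≤ -(7/2) * Real.log ‖z‖ + C0 := by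
  obtain ⟨R, hR, hR2⟩ := S.tails
  refine ⟨R, ((1 + R) * (32 * π + 1) + 2 * cK + π) / (2 * π) + L, hR, ?_⟩
  filter_upwards [hR2, S.kap_dens, S.E_lip, S.eps_z] with n h1 h2 h3 h4 z hz hz2
  have hpi := Real.pi_pos
  have h5 := pot_lower h2 hR h1.1 h1.2 hz2
  have h6 := h3 z 0
  have h7 : EE p v e x n 0 = 0 := by simp [EE]
  rw [h7, sub_zero, sub_zero, mul_assoc] at h6
  have h8 : L * (eps p v x n * ‖z‖) ≤ L * 1 := mul_le_mul_of_nonneg_left (h4 z hz) S.H.L0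
  have h9 := (le_abs_self _).trans h6
  rw [ww]
  have h10 : -(1 / (2 * π)) * Pot (kap p v b x n) z ≤ -(1 / (2 * π)) * (7 * π * Real.log ‖z‖ - ((1 + R) * (32 * π + 1) + 2 * cK + π)) :=
    mul_le_mul_of_nonpos_left h5 (by rw [neg_nonpos]; positivity)
  have h11 : -(1 / (2 * π)) * (7 * π * Real.log ‖z‖ - ((1 + R) * (32 * π + 1) + 2 * cK + π)) = -(7/2) * Real.log ‖z‖ + ((1 + R) * (32 * π + 1) + 2 * cK + π) / (2 * π) := by
    field_simp; ring
  linarith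

lemma decay (S : LM p v e b L h x) : ∃ D : ℝ, 0 ≤ D ∧ ∀ᶠ n in atTop, ∀ z, |kap p v b x n z| ≤ D * (1 + ‖z‖) ^ (-(7/2:ℝ)) := by
  obtain ⟨R, C0, hR, hw⟩ := S.decay_w
  set D1 := (1 + 2 * R) ^ (7/2:ℝ) with hD1
  set D2 := Real.exp C0 * 2 ^ (7/2:ℝ) with hD2
  have hp2 := pow_geom S.H.hp 2 (t := 1/2) (by norm_num) (by norm_num)
  refine ⟨D1 + D2 + 16, by positivity, ?_⟩
  filter_upwards [hw, S.kap_le, S.kap_form, S.eps_z, S.M_ge, S.M_le_two, S.eps_pos, S.eps_sq, S.H.neg_small S.hA (δ := 1/4) (by norm_num), S.w_form, hp2.eventually (gt_mem_nhds one_pos)] with n h1 h2 h3 h4 h5 h6 h7 h8 h9 h10 h11 z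
  have hp := S.H.hp1 n
  have hz0 := norm_nonneg z
  have hzp : 0 < (1 + ‖z‖) ^ (-(7/2:ℝ)) := by positivity
  have hD1p : 0 ≤ D1 := by positivity
  have hD2p : 0 ≤ D2 := by positivity
  rcases lt_or_ge ‖z‖ (2 * R) with hz | hz
  · have a1 : 1 ≤ D1 * (1 + ‖z‖) ^ (-(7/2:ℝ)) := by
      rw [Real.rpow_neg (by positivity), ← div_eq_mul_inv, one_le_div (by positivity)]
      exact Real.rpow_le_rpow (by positivity) (by linarith) (by norm_num)
    refine (h2 z).trans (a1.trans ?_)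
    apply mul_le_mul_of_nonneg_right _ hzp.le
    linarith
  by_cases hyb : ‖x n + eps p v x n * z‖ < b
  swap
  · rw [kap, dns_out (not_lt.1 hyb)]; simp; positivity
  have hz1 : 2 ≤ ‖z‖ := by linarith
  rw [h3 z hyb]
  set t := 1 + ww p v e b x n z / p n with ht
  have hp0 : p n ≠ 0 := by linarith
  rw [abs_mul, abs_of_nonneg (by positivity : 0 ≤ |t| ^ (p n - 1)), abs_pow_mul hp]
  rcases le_total 0 t with ht0 | ht0
  · have a1 : |t| ^ p n ≤ Real.exp (ww p v e b x n z) := by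
      rw [abs_of_nonneg ht0]
      have : t ≤ Real.exp (ww p v e b x n z / p n) := by have := Real.add_one_le_exp (ww p v e b x n z / p n); linarith
      calc t ^ p n ≤ Real.exp (ww p v e b x n z / p n) ^ p n := Real.rpow_le_rpow ht0 this (by linarith)
        _ = _ := by rw [← Real.exp_mul, div_mul_cancel₀ _ hp0]
    have a2 : Real.exp (ww p v e b x n z) ≤ Real.exp C0 * ‖z‖ ^ (-(7/2:ℝ)) := by
      rw [Real.rpow_def_of_pos (by linarith), ← Real.exp_add]
      apply Real.exp_le_exp.2
      have := h1 z hyb.le hz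
      linarith
    have a3 : ‖z‖ ^ (-(7/2:ℝ)) ≤ 2 ^ (7/2:ℝ) * (1 + ‖z‖) ^ (-(7/2:ℝ)) := by
      have : ‖z‖ ^ (-(7/2:ℝ)) ≤ ((1 + ‖z‖) / 2) ^ (-(7/2:ℝ)) :=
        Real.rpow_le_rpow_of_nonpos (by positivity) (by linarith) (by norm_num)
      refine this.trans (le_of_eq ?_)
      rw [Real.div_rpow (by positivity) (by norm_num), Real.rpow_neg (by norm_num : (0:ℝ) ≤ 2), div_inv_eq_mul, mul_comm]
    calc _ ≤ _ := a1.trans a2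
      _ ≤ Real.exp C0 * (2 ^ (7/2:ℝ) * (1 + ‖z‖) ^ (-(7/2:ℝ))) := by gcongr
      _ = D2 * (1 + ‖z‖) ^ (-(7/2:ℝ)) := by rw [hD2]; ring
      _ ≤ _ := by apply mul_le_mul_of_nonneg_right _ hzp.le; linarith
  · -- negative values
    have hMp : 0 < M v x n := by linarith
    have a0 : t = v n (x n + eps p v x n * z) / M v x n := by rw [ht, h10 z hyb.le]; field_simp; ring
    have hv0 : v n (x n + eps p v x n * z) ≤ 0 := by
      by_contra hcon; push Not at hcon
      have : 0 < t := by rw [a0]; positivity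
      linarith
    have a1 : |t| ≤ (1/4) / M v x n := by
      rw [a0, abs_div, abs_of_pos hMp]
      apply div_le_div_of_nonneg_right _ hMp.le
      rw [abs_of_nonpos hv0]; linarith [h9 _ hyb.le]
    have a2 : |t| ^ p n ≤ (1/4) ^ p n / M v x n ^ p n := by
      rw [← Real.div_rpow (by norm_num) hMp.le]
      exact Real.rpow_le_rpow (abs_nonneg _) a1 (by linarith)
    set Q := M v x n ^ p n with hQ
    have hQp : 0 < Q := by positivity
    have a3 : ‖z‖ ^ 2 ≤ p n * Q := by
      have b1 := pow_le_pow_left₀ (by positivity) (h4 z hyb.le) 2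
      rw [mul_pow, h8, one_pow, inv_mul_le_iff₀ (by positivity), mul_one] at b1
      refine b1.trans ?_
      apply mul_le_mul_of_nonneg_left _ (by linarith)
      exact Real.rpow_le_rpow_of_exponent_le (by linarith) (by linarith)
    have a4 : (1 + ‖z‖) ^ 4 ≤ 16 * (p n * Q) ^ 2 := by
      have b1 : (1 + ‖z‖) ^ 2 ≤ 4 * (p n * Q) := by nlinarith
      calc (1 + ‖z‖) ^ 4 = ((1 + ‖z‖) ^ 2) ^ 2 := by ring
        _ ≤ (4 * (p n * Q)) ^ 2 := pow_le_pow_left₀ (by positivity) b1 2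
        _ = _ := by ring
    have a5 : (1/4:ℝ) ^ p n * Q ≤ (1/2) ^ p n := by
      rw [hQ, ← Real.mul_rpow (by norm_num) hMp.le]
      exact Real.rpow_le_rpow (by positivity) (by linarith) (by linarith)
    have a6 : |t| ^ p n * (1 + ‖z‖) ^ 4 ≤ 16 := by
      calc _ ≤ ((1/4) ^ p n / Q) * (16 * (p n * Q) ^ 2) := mul_le_mul a2 a4 (by positivity) (by positivity)
        _ = 16 * (p n ^ 2 * ((1/4) ^ p n * Q)) := by field_simp
        _ ≤ 16 * (p n ^ 2 * (1/2) ^ p n) := by gcongr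
        _ ≤ 16 := by linarith
    have a7 : |t| ^ p n ≤ 16 * (1 + ‖z‖) ^ (-(4:ℝ)) := by
      rw [Real.rpow_neg (by positivity), show (4:ℝ) = ((4:ℕ):ℝ) by norm_num, Real.rpow_natCast, ← div_eq_mul_inv, le_div_iff₀ (by positivity)]
      exact_mod_cast a6
    have a8 : (1 + ‖z‖) ^ (-(4:ℝ)) ≤ (1 + ‖z‖) ^ (-(7/2:ℝ)) := Real.rpow_le_rpow_of_exponent_le (by linarith) (by norm_num)
    calc _ ≤ _ := a7
      _ ≤ 16 * (1 + ‖z‖) ^ (-(7/2:ℝ)) := by gcongr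
      _ ≤ _ := by apply mul_le_mul_of_nonneg_right _ hzp.le; linarith

lemma mom_le {D : ℝ} (_hD : 0 ≤ D) {k : ℝ} {z : ℂ} (hk : |k| ≤ D * (1 + ‖z‖) ^ (-(7/2:ℝ))) : |k| * ‖z‖ ≤ D * (1 + ‖z‖) ^ (-(5/2:ℝ)) := by
  have hz := norm_nonneg z
  calc _ ≤ |k| * (1 + ‖z‖) := by gcongr; linarith
    _ ≤ D * (1 + ‖z‖) ^ (-(7/2:ℝ)) * (1 + ‖z‖) := by gcongr
    _ = _ := by
      rw [mul_assoc, show (-(5/2:ℝ)) = -(7/2) + 1 by norm_num, Real.rpow_add_one (by positivity)]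

lemma w_abs (S : LM p v e b L h x) : ∃ L1, 0 ≤ L1 ∧ ∀ᶠ n in atTop, Continuous (ww p v e b x n) ∧ ∀ z, |ww p v e b x n z| ≤ L1 * ‖z‖ := by
  refine ⟨2 * (cK + (32 * π + 1)) + 1, by have := cK_nonneg; have := Real.pi_pos; positivity, ?_⟩
  filter_upwards [S.blow.lip, S.blow.w0] with n h1 h2
  refine ⟨?_, fun z => ?_⟩
  · have : LipschitzWith (Real.toNNReal (2 * (cK + (32 * π + 1)) + 1)) (ww p v e b x n) := by
      apply LipschitzWith.of_dist_le_mul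
      intro z z'
      rw [Real.dist_eq, dist_eq_norm, Real.coe_toNNReal _ (by have := cK_nonneg; have := Real.pi_pos; positivity)]
      exact h1 z z'
    exact this.continuous
  · have := h1 z 0
    rwa [h2, sub_zero, sub_zero] at this

lemma I_lim (S : LM p v e b L h x) : Tendsto (fun n => ∫ ζ, kap p v b x n ζ * ww p v e b x n ζ) atTop (𝓝 (-16 * π)) := by
  obtain ⟨D, hD, hdec⟩ := S.decay
  obtain ⟨L1, hL1, hw⟩ := S.w_abs
  rw [← expU_U]
  apply tendsto_integral_filter_of_dominated_convergence (fun z => L1 * (D * (1 + ‖z‖) ^ (-(5/2:ℝ))))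
  · filter_upwards [S.kap_int, hw] with n h1 h2 using h1.1.mul h2.1.aestronglyMeasurable
  · filter_upwards [hdec, hw] with n h1 h2
    refine ae_of_all _ fun z => ?_
    rw [norm_mul, Real.norm_eq_abs, Real.norm_eq_abs]
    calc _ ≤ |kap p v b x n z| * (L1 * ‖z‖) := by gcongr; exact h2.2 z
      _ = L1 * (|kap p v b x n z| * ‖z‖) := by ring
      _ ≤ _ := mul_le_mul_of_nonneg_left (mom_le hD (h1 z)) hL1
  · exact ((int_dec (by norm_num)).const_mul D).const_mul L1
  · exact ae_of_all _ fun z => (S.conv_kap z).mul (S.conv z)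

lemma l_lim (S : LM p v e b L h x) : Tendsto (fun n => ∫ ζ, kap p v b x n ζ * Real.log ‖ζ‖) atTop (𝓝 (12 * π * Real.log 2)) := by
  obtain ⟨D, hD, hdec⟩ := S.decay
  rw [← expU_log]
  apply tendsto_integral_filter_of_dominated_convergence (fun z => sker z + D * (1 + ‖z‖) ^ (-(5/2:ℝ)))
  · filter_upwards [S.kap_int] with n h1
    exact h1.1.mul (Real.measurable_log.comp measurable_norm).aestronglyMeasurable
  · filter_upwards [hdec, S.kap_le] with n h1 h2
    refine ae_of_all _ fun z => ?_
    rw [norm_mul, Real.norm_eq_abs, Real.norm_eq_abs]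
    have h3 := mul_le_mul_of_nonneg_right (h2 z) (ker_nonneg z)
    calc _ ≤ |kap p v b x n z| * (sker z + ‖z‖) := by gcongr; exact abs_log_le z
      _ = |kap p v b x n z| * sker z + |kap p v b x n z| * ‖z‖ := by ring
      _ ≤ _ := add_le_add (by linarith) (mom_le hD (h1 z))
  · exact ker_integrable.add ((int_dec (by norm_num)).const_mul D)
  · exact ae_of_all _ fun z => (S.conv_kap z).mul_const _

lemma mom (S : LM p v e b L h x) : ∃ D, ∀ᶠ n in atTop, Integrable (fun ζ => |kap p v b x n ζ| * ‖ζ‖) ∧ ∫ ζ, |kap p v b x n ζ| * ‖ζ‖ ≤ D := by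
  obtain ⟨D, hD, hdec⟩ := S.decay
  refine ⟨∫ z : ℂ, D * (1 + ‖z‖) ^ (-(5/2:ℝ)), ?_⟩
  filter_upwards [hdec, S.kap_int] with n h1 h2
  have hi : Integrable (fun z : ℂ => D * (1 + ‖z‖) ^ (-(5/2:ℝ))) := (int_dec (by norm_num)).const_mul D
  have h3 : Integrable (fun ζ => |kap p v b x n ζ| * ‖ζ‖) := by
    refine hi.mono' (h2.abs.1.mul continuous_norm.aestronglyMeasurable) (ae_of_all _ fun z => ?_)
    rw [Real.norm_eq_abs, abs_of_nonneg (by positivity)]; exact mom_le hD (h1 z)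
  exact ⟨h3, integral_mono h3 hi fun z => mom_le hD (h1 z)⟩

end LM

lemma euler_half {W f : ℂ → ℝ} (hW : ContDiff ℝ 1 W) (hs : HasCompactSupport W) (hf : ContDiff ℝ 1 f) (c : ℂ) (hc : ∀ y, fderiv ℝ f y c = 1) :
    Integrable (fun y => f y * fderiv ℝ W y c) ∧ ∫ y, f y * fderiv ℝ W y c = -∫ y, W y := by
  have hW' : Continuous (fun y => fderiv ℝ W y c) := (hW.continuous_fderiv one_ne_zero).clm_apply continuous_const
  have hs' : HasCompactSupport (fun y => fderiv ℝ W y c) := hs.fderiv_apply ℝ c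
  have h2 : Integrable (fun y => f y * fderiv ℝ W y c) :=
    (hf.continuous.mul hW').integrable_of_hasCompactSupport hs'.mul_left
  refine ⟨h2, ?_⟩
  rw [integral_mul_fderiv_eq_neg_fderiv_mul_of_integrable]
  · simp_rw [hc, one_mul]
  · simp_rw [hc, one_mul]; exact hW.continuous.integrable_of_hasCompactSupport hs
  · exact h2
  · exact (hf.continuous.mul hW.continuous).integrable_of_hasCompactSupport hs.mul_left
  · exact fun x _ => (hf.differentiable one_ne_zero) x
  · exact fun x _ => (hW.differentiable one_ne_zero) x

lemma euler_id {W : ℂ → ℝ} (hW : ContDiff ℝ 1 W) (hs : HasCompactSupport W) (x : ℂ) :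
    Integrable (fun y => fderiv ℝ W y (y - x)) ∧ ∫ y, fderiv ℝ W y (y - x) = -2 * ∫ y, W y := by
  have d1 : ∀ y, fderiv ℝ (fun y : ℂ => (y - x).re) y 1 = 1 := fun y => by
    have : HasFDerivAt (fun y : ℂ => (y - x).re) Complex.reCLM y := Complex.reCLM.hasFDerivAt.comp y ((hasFDerivAt_id y).sub_const x)
    rw [this.fderiv]; simp
  have d2 : ∀ y, fderiv ℝ (fun y : ℂ => (y - x).im) y Complex.I = 1 := fun y => by
    have : HasFDerivAt (fun y : ℂ => (y - x).im) Complex.imCLM y := Complex.imCLM.hasFDerivAt.comp y ((hasFDerivAt_id y).sub_const x)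
    rw [this.fderiv]; simp
  have h1 := euler_half hW hs (f := fun y => (y - x).re) (Complex.reCLM.contDiff.comp (contDiff_id.sub contDiff_const)) 1 d1
  have h2 := euler_half hW hs (f := fun y => (y - x).im) (Complex.imCLM.contDiff.comp (contDiff_id.sub contDiff_const)) Complex.I d2
  have e1 : (fun y => fderiv ℝ W y (y - x)) = fun y => (y - x).re * fderiv ℝ W y 1 + (y - x).im * fderiv ℝ W y Complex.I := by
    ext y
    conv_lhs => rw [show y - x = (y - x).re • (1:ℂ) + (y - x).im • Complex.I by
      rw [Complex.real_smul, Complex.real_smul, mul_one]; exact (Complex.re_add_im _).symm]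
    rw [map_add, map_smul, map_smul, smul_eq_mul, smul_eq_mul]
  rw [e1]
  refine ⟨h1.1.add h2.1, ?_⟩
  rw [integral_add h1.1 h2.1, h1.2, h2.2]; ring

namespace Loc
variable {p : ℕ → ℝ} {v e : ℕ → ℂ → ℝ} {b L : ℝ} {h : ℂ → ℝ}

/-- gradient representation -/
lemma grad (H : Loc p v e b L h) : ∀ᶠ n in atTop, ∀ y, ‖y‖ < b → ∀ w,
    |p n * fderiv ℝ (v n) y w + 1 / (2 * π) * (w * Cau (fun ζ => (dns b (p n) (v n) ζ : ℂ)) y).re| ≤ L * ‖w‖ := by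
  filter_upwards [H.elip] with n hl y hy w
  obtain ⟨B, K, hd⟩ := H.dens n
  have hb : ball (0:ℂ) b ∈ 𝓝 y := isOpen_ball.mem_nhds (by simpa using hy)
  have hv : HasFDerivAt (v n) (fderiv ℝ (v n) y) y :=
    (((H.smooth n).contDiffAt hb).differentiableAt one_ne_zero).hasFDerivAt
  have hP := hd.Pot_deriv y
  have he : HasFDerivAt (e n) (p n • fderiv ℝ (v n) y + (1 / (2 * π)) • reMul (Cau (fun ζ => (dns b (p n) (v n) ζ : ℂ)) y)) y := by
    have h1 := (hv.const_mul (p n)).add ((hP.add_const (∫ ζ, Real.log ‖(0:ℂ) - ζ‖ * dns b (p n) (v n) ζ)).const_mul (1 / (2 * π)))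
    refine h1.congr_of_eventuallyEq ?_
    filter_upwards [hb] with z hz
    have hz' : ‖z‖ ≤ b := by simpa using (ball_subset_closedBall hz)
    have := H.rep n z hz'
    have e2 : Pot (dns b (p n) (v n)) z = (∫ ζ, Real.log ‖z - ζ‖ * dns b (p n) (v n) ζ) - ∫ ζ, Real.log ‖(0:ℂ) - ζ‖ * dns b (p n) (v n) ζ := by
      rw [← integral_sub (H.logk_int n hz') (H.logk_int n (x := 0) (by simpa using H.b0.le)), Pot]
      congr 1; ext ζ; rw [zero_sub, norm_neg]; ring
    simp only [Pi.add_apply]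
    rw [e2, this]; ring
  have hlip : ‖(p n • fderiv ℝ (v n) y + (1 / (2 * π)) • reMul (Cau (fun ζ => (dns b (p n) (v n) ζ : ℂ)) y))‖ ≤ L := by
    refine he.le_of_lip' H.L0 (Eventually.of_forall fun z => ?_)
    rw [Real.norm_eq_abs]; exact hl z y
  have h3 := (ContinuousLinearMap.le_opNorm (p n • fderiv ℝ (v n) y + (1 / (2 * π)) • reMul (Cau (fun ζ => (dns b (p n) (v n) ζ : ℂ)) y)) w).trans
    (mul_le_mul_of_nonneg_right hlip (norm_nonneg w))
  rw [Real.norm_eq_abs] at h3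
  simpa [smul_apply, add_apply] using h3
end Loc

namespace LM
variable {p : ℕ → ℝ} {v e : ℕ → ℂ → ℝ} {b L : ℝ} {h : ℂ → ℝ} {x : ℕ → ℂ}

lemma kdens (S : LM p v e b L h x) : ∀ᶠ n in atTop, Dens (dns b (p n) (v n)) (p n * 2 ^ p n) (32 * π + 1) := by
  filter_upwards [S.v_abs, S.M_le_two, S.H.Ca_ev S.hA one_pos] with n h1 h2 h3
  have hp := S.H.hp1 n
  refine ⟨S.H.kint n, fun ζ => ?_, h3⟩
  rw [Real.norm_eq_abs]
  by_cases hz : ‖ζ‖ < b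
  · rw [dns_abs hp hz]
    apply mul_le_mul_of_nonneg_left _ (by linarith)
    exact Real.rpow_le_rpow (abs_nonneg _) ((h1 ζ hz.le).trans h2) (by linarith)
  · rw [dns_out (not_lt.1 hz), abs_zero]; positivity

lemma kmom (S : LM p v e b L h x) : ∃ D, ∀ᶠ n in atTop, Integrable (fun y => ‖y - x n‖ * |dns b (p n) (v n) y|) ∧
    ∫ y, ‖y - x n‖ * |dns b (p n) (v n) y| ≤ D * eps p v x n := by
  obtain ⟨D, hD⟩ := S.mom
  refine ⟨2 * D, ?_⟩
  filter_upwards [hD, S.M_ge, S.M_le_two, S.eps_pos, S.eps_M] with n h1 hM hM2 he hm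
  have hp := S.H.hp1 n
  have hB : 0 < p n * M v x n ^ p n := by positivity
  constructor
  · refine ((S.H.kint n).abs.const_mul 1).mono' ?_ ?_
    · exact (by fun_prop : Measurable fun y : ℂ => ‖y - x n‖).aestronglyMeasurable.mul (S.H.kint n).abs.1
    · refine ae_of_all _ fun y => ?_
      rw [Real.norm_eq_abs, abs_mul, abs_abs, abs_of_nonneg (norm_nonneg _)]
      by_cases hy : ‖y‖ < b
      · apply mul_le_mul_of_nonneg_right _ (abs_nonneg _)
        rw [norm_sub_rev]; exact (S.H.lt_one (S.hx n).1 hy).le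
      · rw [dns_out (not_lt.1 hy)]; simp
  · have h2 := cov he (x n) (fun y => ‖y - x n‖ * |dns b (p n) (v n) y|)
    have e1 : (fun ζ => ‖x n + eps p v x n * ζ - x n‖ * |dns b (p n) (v n) (x n + eps p v x n * ζ)|) =
        fun ζ => (eps p v x n * (p n * M v x n ^ p n)) * (|kap p v b x n ζ| * ‖ζ‖) := by
      ext ζ
      rw [add_sub_cancel_left, norm_mul, Complex.norm_real, Real.norm_eq_abs, abs_of_pos he, kap, abs_div, abs_of_pos hB]
      field_simp
    rw [e1, integral_const_mul] at h2
    have h3 : ∫ y, ‖y - x n‖ * |dns b (p n) (v n) y| = eps p v x n * (eps p v x n ^ 2 * (p n * M v x n ^ p n)) * ∫ ζ, |kap p v b x n ζ| * ‖ζ‖ := by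
      have : eps p v x n ^ 2 ≠ 0 := by positivity
      field_simp at h2
      rw [← h2]; ring
    rw [h3, hm]
    have h4 : 0 ≤ ∫ ζ, |kap p v b x n ζ| * ‖ζ‖ := integral_nonneg fun _ => by positivity
    calc _ ≤ eps p v x n * 2 * ∫ ζ, |kap p v b x n ζ| * ‖ζ‖ := by gcongr
      _ ≤ eps p v x n * 2 * D := by apply mul_le_mul_of_nonneg_left h1.2; positivity
      _ = _ := by ring
end LM

lemma abs_rpow_fderiv {v : ℂ → ℝ} {y : ℂ} {p : ℝ} (hp : 1 < p) {v' : ℂ →L[ℝ] ℝ} (hv : HasFDerivAt v v' y) :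
    HasFDerivAt (fun y => |v y| ^ (p + 1)) (((p + 1) * (|v y| ^ (p - 1) * v y)) • v') y := by
  have h := (hasDerivAt_abs_rpow (v y) (p := p + 1) (by linarith)).comp_hasFDerivAt y hv
  have : p + 1 - 2 = p - 1 := by ring
  rw [this, mul_assoc] at h
  exact h

namespace LM
variable {p : ℕ → ℝ} {v e : ℕ → ℂ → ℝ} {b L : ℝ} {h : ℂ → ℝ} {x : ℕ → ℂ}

/-- cut-off version of the density -/
def WW (p : ℕ → ℝ) (v : ℕ → ℂ → ℝ) (η : ContDiffBump (0:ℂ)) (n : ℕ) (y : ℂ) : ℝ := η y * |v n y| ^ (p n + 1)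

lemma WW_smooth (H : Loc p v e b L h) (η : ContDiffBump (0:ℂ)) (hη : η.rOut < b) (n : ℕ) : ContDiff ℝ 1 (WW p v η n) := by
  have hp := H.hp1 n
  rw [contDiff_iff_contDiffAt]
  intro y
  by_cases hy : ‖y‖ < b
  · have hb : ball (0:ℂ) b ∈ 𝓝 y := isOpen_ball.mem_nhds (by simpa using hy)
    have h1 := (H.smooth n).contDiffAt hb
    have h2 := (contDiff_norm_rpow (E := ℝ) (p := p n + 1) (by linarith)).contDiffAt (x := v n y)
    have h3 := h2.comp y h1
    exact η.contDiff.contDiffAt.mul h3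
  · have : WW p v η n =ᶠ[𝓝 y] fun _ => 0 := by
      have : (closedBall (0:ℂ) η.rOut)ᶜ ∈ 𝓝 y := by
        apply isClosed_closedBall.isOpen_compl.mem_nhds
        simp; linarith
      filter_upwards [this] with z hz
      have : η z = 0 := η.zero_of_le_dist (by simp at hz; simpa using hz.le)
      rw [WW, this, zero_mul]
    exact contDiffAt_const.congr_of_eventuallyEq this

lemma WW_supp (η : ContDiffBump (0:ℂ)) (n : ℕ) : HasCompactSupport (WW p v η n) :=
  η.hasCompactSupport.mul_right

lemma WW_fderiv (H : Loc p v e b L h) (η : ContDiffBump (0:ℂ)) (n : ℕ) {y : ℂ} (hy : ‖y‖ < b) (w : ℂ) :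
    p n ^ 2 / (p n + 1) * fderiv ℝ (WW p v η n) y w = η y * (dns b (p n) (v n) y * (p n * fderiv ℝ (v n) y w)) +
      p n ^ 2 / (p n + 1) * (|v n y| ^ (p n + 1) * fderiv ℝ η y w) := by
  have hp := H.hp1 n
  have hb : ball (0:ℂ) b ∈ 𝓝 y := isOpen_ball.mem_nhds (by simpa using hy)
  have hv : HasFDerivAt (v n) (fderiv ℝ (v n) y) y :=
    (((H.smooth n).contDiffAt hb).differentiableAt one_ne_zero).hasFDerivAt
  have h1 := abs_rpow_fderiv hp hv
  have h2 : HasFDerivAt η (fderiv ℝ η y) y := ((η.contDiff (n := 1)).differentiable one_ne_zero y).hasFDerivAt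
  have h3 := (h2.mul h1).fderiv
  have : WW p v η n = (fun y => η y) * (fun y => |v n y| ^ (p n + 1)) := rfl
  rw [this, h3, dns_in hy]
  simp only [add_apply, smul_apply, smul_eq_mul]
  field_simp

set_option maxHeartbeats 800000 in
lemma pohoz_pt (S : LM p v e b L h x) (η : ContDiffBump (0:ℂ)) (hη : η.rOut < b) : ∃ K Cη, 0 ≤ K ∧ 0 ≤ Cη ∧ ∀ᶠ n in atTop, ∀ y,
    |p n ^ 2 / (p n + 1) * fderiv ℝ (WW p v η n) y (y - x n) + 1 / (2 * π) *
      ((y - x n) * (dns b (p n) (v n) y : ℂ) * Cau (fun ζ => (dns b (p n) (v n) ζ : ℂ)) y).re| ≤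
    L * (‖y - x n‖ * |dns b (p n) (v n) y|) + (ball (0:ℂ) b).indicator (fun _ =>
      p n * (K / p n) ^ p n * (L + (p n * 2 ^ p n * cK + (32 * π + 1)) + 2 * Cη)) y := by
  obtain ⟨K, hK, hann⟩ := S.H.ann η.rIn_pos
  obtain ⟨Cη, hC⟩ := (η.hasCompactSupport.fderiv (𝕜 := ℝ)).exists_bound_of_continuous ((η.contDiff (n := 1)).continuous_fderiv one_ne_zero)
  have hC0 : 0 ≤ Cη := (norm_nonneg _).trans (hC 0)
  refine ⟨K, Cη, hK, hC0, ?_⟩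
  filter_upwards [hann, S.H.grad, S.kdens, S.v_abs, S.M_le_two] with n ha hg hd hv hM y
  have hp := S.H.hp1 n
  have hL := S.H.L0
  have hcK := cK_nonneg
  have hpi := Real.pi_gt_three
  by_cases hy : ‖y‖ < b
  swap
  · rw [dns_out (not_lt.1 hy)]
    have : fderiv ℝ (WW p v η n) y = 0 := by
      apply image_eq_zero_of_notMem_tsupport
      intro hc
      have h2 := tsupport_mul_subset_left ((tsupport_fderiv_subset ℝ) hc)
      rw [η.tsupport_eq] at h2
      simp at h2; linarith
    rw [this]
    simp
    exact Set.indicator_nonneg (fun _ _ => by positivity) _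
  rw [Set.indicator_of_mem (by simpa using hy), WW_fderiv S.H η n hy]
  have hg1 := hg y hy (y - x n)
  set k := dns b (p n) (v n) y with hk
  set c := Cau (fun ζ => (dns b (p n) (v n) ζ : ℂ)) y with hc
  set G := p n * fderiv ℝ (v n) y (y - x n) with hG
  set T := p n * (K / p n) ^ p n * (L + (p n * 2 ^ p n * cK + (32 * π + 1)) + 2 * Cη) with hT
  have hT0 : 0 ≤ T := by positivity
  have e1 : ((y - x n) * (k : ℂ) * c).re = k * ((y - x n) * c).re := by
    rw [show (y - x n) * (k : ℂ) * c = (k:ℂ) * ((y - x n) * c) by ring, Complex.re_ofReal_mul]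
  rw [e1]
  have e2 : η y * (k * G) + p n ^ 2 / (p n + 1) * (|v n y| ^ (p n + 1) * fderiv ℝ η y (y - x n)) + 1 / (2 * π) * (k * ((y - x n) * c).re)
    = k * (G + 1 / (2 * π) * ((y - x n) * c).re) + ((η y - 1) * (k * G) + p n ^ 2 / (p n + 1) * (|v n y| ^ (p n + 1) * fderiv ℝ η y (y - x n))) := by ring
  rw [e2]
  refine (abs_add_le _ _).trans (add_le_add ?_ ?_)
  · rw [abs_mul]
    calc _ ≤ |k| * (L * ‖y - x n‖) := by gcongr
      _ = _ := by ring
  by_cases hy2 : ‖y‖ < η.rIn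
  · have h1 : η y = 1 := η.one_of_mem_closedBall (by simpa using hy2.le)
    have h2 : fderiv ℝ η y = 0 := by
      have := (η.eventuallyEq_one_of_mem_ball (x := y) (by simpa using hy2)).fderiv_eq (𝕜 := ℝ)
      rw [this]; exact fderiv_const_apply _
    rw [h1, h2]; simp; exact hT0
  push Not at hy2
  have hnorm : ‖y - x n‖ ≤ 1 := by rw [norm_sub_rev]; exact (S.H.lt_one (S.hx n).1 hy).le
  have hvy := ha y hy2 hy.le
  have hpw : |v n y| ^ p n ≤ (K / p n) ^ p n := Real.rpow_le_rpow (abs_nonneg _) hvy (by linarith)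
  have hk1 : |k| ≤ p n * (K / p n) ^ p n := by
    rw [hk, dns_abs hp hy]; exact mul_le_mul_of_nonneg_left hpw (by linarith)
  have hc1 : ‖c‖ ≤ p n * 2 ^ p n * cK + (32 * π + 1) := hd.ofReal.Cau_le y
  have hG1 : |G| ≤ L + (p n * 2 ^ p n * cK + (32 * π + 1)) := by
    have h1 : |1 / (2 * π) * ((y - x n) * c).re| ≤ ‖c‖ := by
      rw [abs_mul, abs_of_pos (by positivity : 0 < 1 / (2 * π))]
      have h2 : |((y - x n) * c).re| ≤ ‖c‖ := (Complex.abs_re_le_norm _).trans (by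
        rw [norm_mul]; nlinarith [norm_nonneg c])
      have h3 : 1 / (2 * π) ≤ 1 := by rw [div_le_one (by positivity)]; linarith
      nlinarith [abs_nonneg ((y - x n) * c).re]
    have h4 : L * ‖y - x n‖ ≤ L := by nlinarith
    have h5 : |G| ≤ |G + 1 / (2 * π) * ((y - x n) * c).re| + |1 / (2 * π) * ((y - x n) * c).re| := by
      have := abs_sub (G + 1 / (2 * π) * ((y - x n) * c).re) (1 / (2 * π) * ((y - x n) * c).re)
      simpa using this
    linarith
  have hF : |v n y| ^ (p n + 1) ≤ (K / p n) ^ p n * 2 := by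
    rw [Real.rpow_add_one' (abs_nonneg _) (by linarith)]
    have := (hv y hy.le).trans hM
    gcongr
  have hD : |fderiv ℝ η y (y - x n)| ≤ Cη := by
    have := (fderiv ℝ η y).le_opNorm (y - x n)
    rw [Real.norm_eq_abs] at this
    refine this.trans ?_
    calc _ ≤ Cη * 1 := mul_le_mul (hC y) hnorm (norm_nonneg _) hC0
      _ = Cη := mul_one _
  have hη1 : |η y - 1| ≤ 1 := by
    have := η.nonneg (x := y); have := η.le_one (x := y); rw [abs_le]; constructor <;> linarith
  have hP : p n ^ 2 / (p n + 1) ≤ p n := by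
    rw [div_le_iff₀ (by linarith)]; nlinarith
  have hX : 0 ≤ (K / p n) ^ p n := by positivity
  calc _ ≤ |(η y - 1) * (k * G)| + |p n ^ 2 / (p n + 1) * (|v n y| ^ (p n + 1) * fderiv ℝ η y (y - x n))| := abs_add_le _ _
    _ = |η y - 1| * (|k| * |G|) + p n ^ 2 / (p n + 1) * (|v n y| ^ (p n + 1) * |fderiv ℝ η y (y - x n)|) := by
        rw [abs_mul (η y - 1), abs_mul k G, abs_mul (p n ^ 2 / (p n + 1)), abs_mul (|v n y| ^ (p n + 1)), abs_of_nonneg (by positivity : 0 ≤ p n ^ 2 / (p n + 1)), abs_of_nonneg (by positivity : 0 ≤ |v n y| ^ (p n + 1))]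
    _ ≤ 1 * ((p n * (K / p n) ^ p n) * (L + (p n * 2 ^ p n * cK + (32 * π + 1)))) + p n * (((K / p n) ^ p n * 2) * Cη) := by
        gcongr
    _ = T := by rw [hT]; ring

lemma WW_int (S : LM p v e b L h x) (η : ContDiffBump (0:ℂ)) (hη : η.rOut < b) : ∃ K, 0 ≤ K ∧ ∀ᶠ n in atTop,
    |p n * (∫ y, WW p v η n y) - Loc.A p v b n| ≤ 2 * (p n * (K / p n) ^ p n) := by
  obtain ⟨K, hK, hann⟩ := S.H.ann η.rIn_pos
  refine ⟨K, hK, ?_⟩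
  filter_upwards [hann, S.v_abs, S.M_le_two] with n ha hv hM
  have hp := S.H.hp1 n
  have e1 : ∫ y, WW p v η n y = ∫ y in ball (0:ℂ) b, WW p v η n y := by
    rw [setIntegral_eq_integral_of_forall_compl_eq_zero]
    intro y hy
    have : η y = 0 := η.zero_of_le_dist (by simp at hy; simp; linarith)
    rw [WW, this, zero_mul]
  have hW : IntegrableOn (WW p v η n) (ball (0:ℂ) b) :=
    ((WW_smooth S.H η hη n).continuous.integrable_of_hasCompactSupport (WW_supp η n)).integrableOn
  rw [e1, Loc.A, ← mul_sub, ← integral_sub hW (S.H.vint n), abs_mul, abs_of_pos (by linarith : 0 < p n)]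
  have h2 := norm_setIntegral_le_of_norm_le_const (μ := volume) (s := ball (0:ℂ) b) (C := (K / p n) ^ p n * 2) (f := fun y => WW p v η n y - |v n y| ^ (p n + 1)) measure_ball_lt_top ?_
  · rw [Real.norm_eq_abs] at h2
    have h3 := Loc.vol_ball b S.H.b0 S.H.b1
    have h4 : (K / p n) ^ p n * 2 * (volume.real (ball (0:ℂ) b)) ≤ (K / p n) ^ p n * 2 * 1 := by
      apply mul_le_mul_of_nonneg_left h3; positivity
    calc _ ≤ p n * ((K / p n) ^ p n * 2) := by apply mul_le_mul_of_nonneg_left _ (by linarith); linarith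
      _ = _ := by ring
  · intro y hy
    have hy : ‖y‖ < b := by simpa using hy
    have : WW p v η n y - |v n y| ^ (p n + 1) = (η y - 1) * |v n y| ^ (p n + 1) := by rw [WW]; ring
    rw [this]
    by_cases hy2 : ‖y‖ < η.rIn
    · rw [η.one_of_mem_closedBall (by simpa using hy2.le)]; simp; positivity
    push Not at hy2
    have hpw : |v n y| ^ p n ≤ (K / p n) ^ p n := Real.rpow_le_rpow (abs_nonneg _) (ha y hy2 hy.le) (by linarith)
    have hF : |v n y| ^ (p n + 1) ≤ (K / p n) ^ p n * 2 := by
      rw [Real.rpow_add_one' (abs_nonneg _) (by linarith)]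
      have := (hv y hy.le).trans hM
      gcongr
    have hη1 : |η y - 1| ≤ 1 := by
      have := η.nonneg (x := y); have := η.le_one (x := y); rw [abs_le]; constructor <;> linarith
    rw [norm_mul, Real.norm_eq_abs, Real.norm_eq_abs, abs_of_nonneg (by positivity : 0 ≤ |v n y| ^ (p n + 1))]
    calc _ ≤ 1 * ((K / p n) ^ p n * 2) := by gcongr
      _ = _ := one_mul _

lemma pohoz_int (S : LM p v e b L h x) (η : ContDiffBump (0:ℂ)) (hη : η.rOut < b) : ∃ K Cη D, 0 ≤ K ∧ 0 ≤ Cη ∧ ∀ᶠ n in atTop,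
    |p n ^ 2 / (p n + 1) * (-2 * ∫ y, WW p v η n y) + Loc.C p v b n ^ 2 / (4 * π)| ≤
    L * (D * eps p v x n) + 
      p n * (K / p n) ^ p n * (L + (p n * 2 ^ p n * cK + (32 * π + 1)) + 2 * Cη) := by
  obtain ⟨K, Cη, hK, hC, hpt⟩ := S.pohoz_pt η hη
  obtain ⟨D, hD⟩ := S.kmom
  refine ⟨K, Cη, D, hK, hC, ?_⟩
  filter_upwards [hpt, hD, S.kdens] with n h1 h2 hd
  have hp := S.H.hp1 n
  have hL := S.H.L0
  have hcK := cK_nonneg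
  have hpi := Real.pi_gt_three
  obtain ⟨i1, e1⟩ := euler_id (WW_smooth S.H η hη n) (WW_supp η n) (x n)
  have hi : Integrable (fun a => (a - x n) * (dns b (p n) (v n) a : ℂ)) := by
    refine h2.1.mono' ?_ (ae_of_all _ fun a => ?_)
    · exact (by fun_prop : Measurable fun a : ℂ => a - x n).aestronglyMeasurable.mul hd.ofReal.int.1
    · rw [norm_mul, Complex.norm_real, Real.norm_eq_abs]
  have hm := hd.ofReal.Cau_moment (x n) hi
  have i2 : Integrable (fun a => (a - x n) * (dns b (p n) (v n) a : ℂ) * Cau (fun ζ => (dns b (p n) (v n) ζ : ℂ)) a) := by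
    refine (hi.norm.mul_const (p n * 2 ^ p n * cK + (32 * π + 1))).mono' (hi.1.mul hd.ofReal.Cau_cont.aestronglyMeasurable) (ae_of_all _ fun a => ?_)
    rw [norm_mul]
    exact mul_le_mul_of_nonneg_left (hd.ofReal.Cau_le a) (norm_nonneg _)
  have e2 : ∫ a, ((a - x n) * (dns b (p n) (v n) a : ℂ) * Cau (fun ζ => (dns b (p n) (v n) ζ : ℂ)) a).re = Loc.C p v b n ^ 2 / 2 := by
    have h3 := integral_re i2
    have h4 : ∫ a, (a - x n) * (dns b (p n) (v n) a : ℂ) * Cau (fun ζ => (dns b (p n) (v n) ζ : ℂ)) a = ((Loc.C p v b n ^ 2 / 2 : ℝ) : ℂ) := by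
      have h6 : ∫ a, (dns b (p n) (v n) a : ℂ) = ((∫ a, dns b (p n) (v n) a : ℝ) : ℂ) := integral_ofReal
      rw [h6] at hm
      rw [Loc.C]; push_cast; rw [← hm]; ring
    have h5 : ∀ z : ℂ, RCLike.re z = z.re := fun _ => rfl
    simp only [h5] at h3
    rw [h3, h4, Complex.ofReal_re]
  have i3 : Integrable (fun a => ((a - x n) * (dns b (p n) (v n) a : ℂ) * Cau (fun ζ => (dns b (p n) (v n) ζ : ℂ)) a).re) := i2.re
  have e3 : p n ^ 2 / (p n + 1) * (-2 * ∫ y, WW p v η n y) + Loc.C p v b n ^ 2 / (4 * π) =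
      ∫ y, (p n ^ 2 / (p n + 1) * fderiv ℝ (WW p v η n) y (y - x n) + 1 / (2 * π) *
      ((y - x n) * (dns b (p n) (v n) y : ℂ) * Cau (fun ζ => (dns b (p n) (v n) ζ : ℂ)) y).re) := by
    rw [integral_add (i1.const_mul _) (i3.const_mul _), integral_const_mul, integral_const_mul, e1, e2]
    field_simp; ring
  rw [e3]
  set T := p n * (K / p n) ^ p n * (L + (p n * 2 ^ p n * cK + (32 * π + 1)) + 2 * Cη) with hT
  have hT0 : 0 ≤ T := by positivity
  have i4 : Integrable ((ball (0:ℂ) b).indicator (fun _ => T)) :=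
    (integrableOn_const measure_ball_lt_top.ne).integrable_indicator measurableSet_ball
  refine (norm_integral_le_of_norm_le ((h2.1.const_mul L).add i4) (ae_of_all _ fun y => (Real.norm_eq_abs _).trans_le (h1 y))).trans ?_
  simp only [Pi.add_apply]
  rw [integral_add (h2.1.const_mul L) i4, integral_const_mul, integral_indicator measurableSet_ball, setIntegral_const]
  apply add_le_add
  · exact mul_le_mul_of_nonneg_left h2.2 hL
  · have h3 := Loc.vol_ball b S.H.b0 S.H.b1
    rw [smul_eq_mul]
    exact mul_le_of_le_one_left hT0 h3

lemma R1 (S : LM p v e b L h x) : Tendsto (fun n => p n * (2 * p n / (p n + 1) * Loc.A p v b n - Loc.C p v b n ^ 2 / (4 * π))) atTop (𝓝 0) := by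
  have hb := S.H.b0
  have hL := S.H.L0
  set η : ContDiffBump (0:ℂ) := ⟨b/2, 3*b/4, by linarith, by linarith⟩ with hη
  have hη1 : η.rOut < b := by show 3*b/4 < b; linarith
  obtain ⟨K, Cη, D, hK, hC, h1⟩ := S.pohoz_int η hη1
  obtain ⟨K', hK', h2⟩ := S.WW_int η hη1
  have l1 : Tendsto (fun n => L * D * (p n * eps p v x n) + ((L + (32 * π + 1) + 2 * Cη) * (p n ^ 2 * (K / p n) ^ p n) + cK * (p n ^ 3 * (2 * K / p n) ^ p n))
      + 4 * (p n ^ 2 * (K' / p n) ^ p n)) atTop (𝓝 (L * D * 0 + ((L + (32 * π + 1) + 2 * Cη) * 0 + cK * 0) + 4 * 0)) :=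
    ((S.p_eps.const_mul _).add (((pow_super S.H.hp 2 hK).const_mul _).add ((pow_super S.H.hp 3 (by positivity)).const_mul _))).add ((pow_super S.H.hp 2 hK').const_mul _)
  simp only [mul_zero, add_zero] at l1
  refine squeeze_zero_norm' ?_ l1
  filter_upwards [h1, h2] with n h1 h2
  have hp := S.H.hp1 n
  rw [Real.norm_eq_abs, abs_mul, abs_of_pos (by linarith : 0 < p n)]
  set W := ∫ y, WW p v η n y
  set A := Loc.A p v b n
  set C := Loc.C p v b n
  have e1 : 2 * p n / (p n + 1) * A - C ^ 2 / (4 * π) = -(p n ^ 2 / (p n + 1) * (-2 * W) + C ^ 2 / (4 * π)) - 2 * p n / (p n + 1) * (p n * W - A) := by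
    field_simp; ring
  have hq : 2 * p n / (p n + 1) ≤ 2 := by rw [div_le_iff₀ (by linarith)]; linarith
  have h3 : |2 * p n / (p n + 1) * A - C ^ 2 / (4 * π)| ≤ (L * (D * eps p v x n) + 
      p n * (K / p n) ^ p n * (L + (p n * 2 ^ p n * cK + (32 * π + 1)) + 2 * Cη)) + 2 * (2 * (p n * (K' / p n) ^ p n)) := by
    rw [e1]
    refine (abs_sub _ _).trans (add_le_add ?_ ?_)
    · rw [abs_neg]; exact h1
    · rw [abs_mul, abs_of_nonneg (by positivity : 0 ≤ 2 * p n / (p n + 1))]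
      gcongr
  have e2 : (2 * K / p n) ^ p n = 2 ^ p n * (K / p n) ^ p n := by
    rw [mul_div_assoc, Real.mul_rpow (by norm_num) (by positivity)]
  calc _ ≤ p n * ((L * (D * eps p v x n) + 
      p n * (K / p n) ^ p n * (L + (p n * 2 ^ p n * cK + (32 * π + 1)) + 2 * Cη)) + 2 * (2 * (p n * (K' / p n) ^ p n))) := by
        apply mul_le_mul_of_nonneg_left h3; linarith
    _ = _ := by rw [e2]; ring
end LM

namespace LM
variable {p : ℕ → ℝ} {v e : ℕ → ℂ → ℝ} {b L : ℝ} {h : ℂ → ℝ} {x : ℕ → ℂ}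

lemma kw_int (S : LM p v e b L h x) : ∀ᶠ n in atTop, Integrable (fun ζ => kap p v b x n ζ * ww p v e b x n ζ) := by
  obtain ⟨L1, hL1, hw⟩ := S.w_abs
  obtain ⟨D, hD⟩ := S.mom
  filter_upwards [hw, hD, S.kap_int] with n h1 h2 h3
  refine (h2.1.const_mul L1).mono' (h3.1.mul h1.1.aestronglyMeasurable) (ae_of_all _ fun ζ => ?_)
  rw [norm_mul, Real.norm_eq_abs, Real.norm_eq_abs]
  calc _ ≤ |kap p v b x n ζ| * (L1 * ‖ζ‖) := mul_le_mul_of_nonneg_left (h1.2 ζ) (abs_nonneg _)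
    _ = _ := by ring

lemma klog_int (S : LM p v e b L h x) : ∀ᶠ n in atTop, Integrable (fun ζ => kap p v b x n ζ * Real.log ‖ζ‖) := by
  obtain ⟨D, hD⟩ := S.mom
  filter_upwards [hD, S.kap_int, S.kap_le] with n h2 h3 h4
  refine (ker_integrable.add h2.1).mono' (h3.1.mul (by fun_prop : Measurable fun ζ : ℂ => Real.log ‖ζ‖).aestronglyMeasurable) (ae_of_all _ fun ζ => ?_)
  rw [norm_mul, Real.norm_eq_abs, Real.norm_eq_abs, Pi.add_apply]
  by_cases hz : ‖ζ‖ < 1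
  · have := ker_ge_log hz
    have h5 := h4 ζ
    have : 0 ≤ |kap p v b x n ζ| * ‖ζ‖ := by positivity
    nlinarith [abs_nonneg (Real.log ‖ζ‖), abs_nonneg (kap p v b x n ζ)]
  · push Not at hz
    have h5 : |Real.log ‖ζ‖| ≤ ‖ζ‖ := by
      rw [abs_of_nonneg (Real.log_nonneg hz)]; have := Real.log_le_sub_one_of_pos (by linarith : 0 < ‖ζ‖); linarith
    have := mul_le_mul_of_nonneg_left h5 (abs_nonneg (kap p v b x n ζ))
    have := ker_nonneg ζ
    linarith

lemma R2 (S : LM p v e b L h x) : ∀ᶠ n in atTop, Loc.A p v b n = M v x n * Loc.C p v b n +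
    M v x n ^ 2 / p n * ∫ ζ, kap p v b x n ζ * ww p v e b x n ζ := by
  filter_upwards [S.cv, S.w_form, S.kw_int, S.kap_int, S.kap_mass, S.M_ge, S.eps_pos] with n hcv hw h1 h2 h3 h4 he
  have hp := S.H.hp1 n
  have e1 : Loc.A p v b n = ∫ y, v n y * dns b (p n) (v n) y := by
    rw [Loc.A, ← integral_const_mul, ← integral_indicator measurableSet_ball]
    congr 1; ext y
    by_cases hy : ‖y‖ < b
    · rw [Set.indicator_of_mem (by simpa using hy), mul_comm (v n y), dns_mul hp hy]
    · rw [Set.indicator_of_notMem (by simpa using hy), dns_out (not_lt.1 hy), mul_zero]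
  have e2 : (fun ζ => v n (x n + eps p v x n * ζ) * kap p v b x n ζ) = fun ζ => M v x n * kap p v b x n ζ + M v x n / p n * (kap p v b x n ζ * ww p v e b x n ζ) := by
    ext ζ
    by_cases hy : ‖x n + eps p v x n * ζ‖ < b
    · rw [hw ζ hy.le]; field_simp; ring
    · have : kap p v b x n ζ = 0 := by rw [kap, dns_out (not_lt.1 hy), zero_div]
      rw [this]; ring
  rw [e1, hcv, e2, integral_add (h2.const_mul _) (h1.const_mul _), integral_const_mul, integral_const_mul, h3]
  field_simp

lemma R3 (S : LM p v e b L h x) : ∀ᶠ n in atTop, p n * M v x n = Loc.C p v b n / (4 * π) * (Real.log (p n) + (p n - 1) * Real.log (M v x n))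
    - M v x n / (2 * π) * (∫ ζ, kap p v b x n ζ * Real.log ‖ζ‖) + e n (x n) := by
  filter_upwards [S.cv, S.klog_int, S.kap_int, S.kap_mass, S.M_ge, S.eps_pos] with n hcv h1 h2 h3 h4 he
  have hp := S.H.hp1 n
  have hM : 0 < M v x n := by linarith
  have hr := S.H.rep n (x n) (S.hx n).1
  have e1 : ∫ ζ, Real.log ‖x n - (x n + eps p v x n * ζ)‖ * kap p v b x n ζ =
      ∫ ζ, (Real.log (eps p v x n) * kap p v b x n ζ + kap p v b x n ζ * Real.log ‖ζ‖) := by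
    apply integral_congr_ae
    filter_upwards [ae_ne 0] with ζ hζ
    have : ‖x n - (x n + eps p v x n * ζ)‖ = eps p v x n * ‖ζ‖ := by
      rw [sub_add_cancel_left, norm_neg, norm_mul, Complex.norm_real, Real.norm_eq_abs, abs_of_pos he]
    rw [this, Real.log_mul he.ne' (norm_ne_zero_iff.2 hζ)]; ring
  rw [hcv (fun y => Real.log ‖x n - y‖), e1, integral_add (h2.const_mul _) h1, integral_const_mul, h3] at hr
  have hle : Real.log (eps p v x n) = -(1/2) * (Real.log (p n) + (p n - 1) * Real.log (M v x n)) := by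
    rw [eps, Real.log_inv, Real.log_sqrt (by positivity), Real.log_mul (by linarith) (by positivity), Real.log_rpow hM]; ring
  rw [hle] at hr
  have : v n (x n) = M v x n := rfl
  rw [this] at hr
  rw [hr]; field_simp; ring

lemma h_e_lim (S : LM p v e b L h x) : Tendsto (fun n => e n (x n)) atTop (𝓝 (h 0)) :=
  S.H.e_lim_zero (S.H.Ca_ev S.hA one_pos) (S.H.x_lim S.hA S.hx)

lemma inv_lim (S : LM p v e b L h x) : Tendsto (fun n => 1 / p n) atTop (𝓝 0) := tendsto_const_nhds.div_atTop S.H.hp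

def gam (p : ℕ → ℝ) (v : ℕ → ℂ → ℝ) (b : ℝ) (x : ℕ → ℂ) (n : ℕ) : ℝ := Loc.C p v b n / (8 * π * M v x n)

lemma gam_lim (S : LM p v e b L h x) : Tendsto (gam p v b x) atTop (𝓝 1) := by
  have hs := sqrt_e_bd
  have hpi := Real.pi_pos
  have hs0 : 0 < √(Real.exp 1) := by linarith
  have hne : 8 * π * √(Real.exp 1) ≠ 0 := by positivity
  have := S.C_lim.div (S.M_lim.const_mul (8 * π)) hne
  rw [div_self hne] at this
  exact this

lemma pq_lim (S : LM p v e b L h x) : Tendsto (fun n => p n / (p n + 1)) atTop (𝓝 1) := by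
  have h1 : Tendsto (fun n => 1 / (1 + 1 / p n)) atTop (𝓝 (1 / (1 + 0))) := tendsto_const_nhds.div (tendsto_const_nhds.add S.inv_lim) (by norm_num)
  rw [add_zero, div_one] at h1
  refine h1.congr fun n => ?_
  have := S.H.hp1 n
  field_simp

lemma gam_rate (S : LM p v e b L h x) : Tendsto (fun n => p n * (gam p v b x n - 1)) atTop (𝓝 (-3)) := by
  have hs := sqrt_e_bd
  have hpi := Real.pi_pos
  have hs0 : 0 < √(Real.exp 1) := by linarith
  have hne : 16 * π * √(Real.exp 1) ^ 2 ≠ 0 := by positivity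
  have l1 := S.R1.div ((S.M_lim.pow 2).const_mul (16 * π)) hne
  rw [zero_div] at l1
  have l2 : Tendsto (fun n => p n / (p n + 1) * gam p v b x n - p n / (p n + 1) * ((∫ ζ, kap p v b x n ζ * ww p v e b x n ζ) / (8 * π))) atTop
      (𝓝 (1 * 1 - 1 * (-16 * π / (8 * π)))) := (S.pq_lim.mul S.gam_lim).sub (S.pq_lim.mul (S.I_lim.div_const _))
  have l3 := (l1.add l2).div S.gam_lim one_ne_zero
  have l4 := l3.neg
  have e : -((0 + (1 * 1 - 1 * (-16 * π / (8 * π)))) / 1) = (-3:ℝ) := by field_simp; norm_num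
  rw [e] at l4
  refine l4.congr' ?_
  filter_upwards [S.R2, S.M_ge, S.gam_lim.eventually_ne one_ne_zero] with n h2 hM hg
  have hp := S.H.hp1 n
  simp only [Pi.div_apply]
  rw [h2]
  have hC : Loc.C p v b n = gam p v b x n * (8 * π * M v x n) := by rw [gam]; field_simp
  rw [hC]
  generalize gam p v b x n = g at hg
  field_simp
  ring

lemma a_rate (S : LM p v e b L h x) : Tendsto (fun n => p n * (Loc.A p v b n / (8 * π * M v x n ^ 2) - 1)) atTop (𝓝 (-5)) := by
  have hpi := Real.pi_pos
  have l := S.gam_rate.add (S.I_lim.div_const (8 * π))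
  have e : (-3:ℝ) + -16 * π / (8 * π) = -5 := by field_simp; norm_num
  rw [e] at l
  refine l.congr' ?_
  filter_upwards [S.R2, S.M_ge] with n h2 hM
  have hp := S.H.hp1 n
  rw [h2]
  have hC : Loc.C p v b n = gam p v b x n * (8 * π * M v x n) := by rw [gam]; field_simp
  rw [hC]
  field_simp; ring

lemma s_lim (S : LM p v e b L h x) : Tendsto (fun n => 2 * Real.log (M v x n) - 1) atTop (𝓝 0) := by
  have hs := sqrt_e_bd
  have h1 := ((S.M_lim.log (by linarith)).const_mul 2).sub_const 1
  rw [Real.log_sqrt (Real.exp_pos 1).le, Real.log_exp] at h1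
  norm_num at h1
  exact h1

lemma s_rate (S : LM p v e b L h x) : Tendsto (fun n => p n * (2 * Real.log (M v x n) - 1) + 2 * Real.log (p n)) atTop
    (𝓝 (4 + 6 * Real.log 2 - h 0 / √(Real.exp 1))) := by
  have hpi := Real.pi_pos
  have hs := sqrt_e_bd
  have l1 : Tendsto (fun n => (-(p n * (gam p v b x n - 1)) + gam p v b x n + (∫ ζ, kap p v b x n ζ * Real.log ‖ζ‖) / (2 * π) - e n (x n) / M v x n) / gam p v b x n + (2 * Real.log (M v x n) - 1)) atTop
     (𝓝 ((-(-3) + 1 + 12 * π * Real.log 2 / (2 * π) - h 0 / √(Real.exp 1)) / 1 + 0)) :=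
    ((((S.gam_rate.neg.add S.gam_lim).add (S.l_lim.div_const _)).sub (S.h_e_lim.div S.M_lim (by linarith))).div S.gam_lim one_ne_zero).add S.s_lim
  have e1 : ((-(-3) + 1 + 12 * π * Real.log 2 / (2 * π) - h 0 / √(Real.exp 1)) / 1 + 0) = 4 + 6 * Real.log 2 - h 0 / √(Real.exp 1) := by
    field_simp; ring
  rw [e1] at l1
  refine l1.congr' ?_
  filter_upwards [S.R3, S.M_ge, S.gam_lim.eventually_ne one_ne_zero] with n h2 hM hg
  have hp := S.H.hp1 n
  have hC : Loc.C p v b n = gam p v b x n * (8 * π * M v x n) := by rw [gam]; field_simp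
  rw [hC] at h2
  generalize gam p v b x n = g at hg h2
  generalize (∫ ζ, kap p v b x n ζ * Real.log ‖ζ‖) = l at h2
  have h3 : p n = 2 * g * (Real.log (p n) + (p n - 1) * Real.log (M v x n)) - l / (2 * π) + e n (x n) / M v x n := by
    have hM0 : M v x n ≠ 0 := by linarith
    apply mul_right_cancel₀ hM0
    rw [h2]
    generalize Real.log (p n) = lp
    generalize Real.log (M v x n) = lM
    field_simp
    ring
  have h5 : (-(p n * (g - 1)) + g + l / (2 * π) - e n (x n) / M v x n) = g * ((p n - 1) * (2 * Real.log (M v x n) - 1) + 2 * Real.log (p n)) := by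
    linear_combination h3
  rw [h5, mul_div_cancel_left₀ _ hg]; ring

/-- The local expansion. -/
theorem main_local (S : LM p v e b L h x) : Tendsto (fun n => p n * (Loc.A p v b n / (8 * π * Real.exp 1) - 1) + 2 * Real.log (p n)) atTop
    (𝓝 (-1 + 6 * Real.log 2 - h 0 / √(Real.exp 1))) := by
  have hpi := Real.pi_pos
  set s : ℕ → ℝ := fun n => 2 * Real.log (M v x n) - 1 with hsdef
  have hs0 : Tendsto s atTop (𝓝 0) := S.s_lim
  have hexp : Tendsto (fun n => Real.exp (s n)) atTop (𝓝 1) := by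
    have := (Real.continuous_exp.tendsto 0).comp hs0
    rw [Real.exp_zero] at this; exact this
  have hlog : Tendsto (fun n => Real.log (p n) ^ 2 / p n) atTop (𝓝 0) := by
    have := (isLittleO_pow_log_id_atTop (n := 2)).tendsto_div_nhds_zero.comp S.H.hp
    exact this
  have hlog1 : Tendsto (fun n => Real.log (p n) / p n) atTop (𝓝 0) := by
    have := (Real.isLittleO_log_id_atTop).tendsto_div_nhds_zero.comp S.H.hp
    exact this
  have hps : Tendsto (fun n => p n * s n ^ 2) atTop (𝓝 0) := by
    have hsr := S.s_rate
    have l := (((hsr.pow 2).mul S.inv_lim).sub ((hsr.mul hlog1).const_mul 4)).add (hlog.const_mul 4)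
    simp only [mul_zero, sub_zero, add_zero] at l
    refine l.congr fun n => ?_
    have := S.H.hp1 n
    simp only [hsdef]
    field_simp; ring
  have hrem : Tendsto (fun n => p n * (Real.exp (s n) - 1 - s n)) atTop (𝓝 0) := by
    refine squeeze_zero_norm' ?_ hps
    have h1 : ∀ᶠ n in atTop, |s n| ≤ 1 := by
      have := hs0.abs; rw [abs_zero] at this
      filter_upwards [this.eventually (gt_mem_nhds one_pos)] with n hn using hn.le
    filter_upwards [h1] with n h1
    have := S.H.hp1 n
    rw [norm_mul, Real.norm_eq_abs, Real.norm_eq_abs, abs_of_pos (by linarith : 0 < p n)]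
    apply mul_le_mul_of_nonneg_left _ (by linarith)
    exact Real.abs_exp_sub_one_sub_id_le h1
  have l := ((S.a_rate.mul hexp).add hrem).add S.s_rate
  have e1 : (-5 * 1 + 0 + (4 + 6 * Real.log 2 - h 0 / √(Real.exp 1))) = -1 + 6 * Real.log 2 - h 0 / √(Real.exp 1) := by ring
  rw [e1] at l
  refine l.congr' ?_
  filter_upwards [S.M_ge] with n hM
  have hM0 : 0 < M v x n := by linarith
  have hes : Real.exp (s n) = M v x n ^ 2 / Real.exp 1 := by
    simp only [hsdef]
    rw [Real.exp_sub, two_mul, Real.exp_add, Real.exp_log hM0]; ring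
  have : Loc.A p v b n / (8 * π * M v x n ^ 2) * Real.exp (s n) = Loc.A p v b n / (8 * π * Real.exp 1) := by
    rw [hes]; have := Real.exp_pos 1; field_simp
  simp only [hsdef] at this ⊢
  linear_combination p n * this
end LM

theorem Loc.main {p : ℕ → ℝ} {v e : ℕ → ℂ → ℝ} {b L : ℝ} {h : ℂ → ℝ} (H : Loc p v e b L h) (hA : ∀ᶠ n in atTop, Loc.A p v b n ≤ 32 * π) :
    Tendsto (fun n => p n * (Loc.A p v b n / (8 * π * Real.exp 1) - 1) + 2 * Real.log (p n)) atTop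
    (𝓝 (-1 + 6 * Real.log 2 - h 0 / √(Real.exp 1))) := by
  choose x hx using H.max_ex
  exact (LM.main_local (x := x) ⟨H, hA, hx⟩)

lemma ibp_cpt {E : Type*} [NormedAddCommGroup E] [NormedSpace ℝ E] [MeasurableSpace E] [BorelSpace E] [FiniteDimensional ℝ E]
    (μ : Measure E) [μ.IsAddHaarMeasure] {f g : E → ℝ} (hf : ContDiff ℝ 1 f) (hg : ContDiff ℝ 1 g) (hc : HasCompactSupport g) (w : E) :
    ∫ y, f y * fderiv ℝ g y w ∂μ = -∫ y, fderiv ℝ f y w * g y ∂μ := by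
  have cf : Continuous (fun y => fderiv ℝ f y w) := (hf.continuous_fderiv one_ne_zero).clm_apply continuous_const
  have cg : Continuous (fun y => fderiv ℝ g y w) := (hg.continuous_fderiv one_ne_zero).clm_apply continuous_const
  have sg : HasCompactSupport (fun y => fderiv ℝ g y w) := hc.fderiv_apply (𝕜 := ℝ) w
  apply integral_mul_fderiv_eq_neg_fderiv_mul_of_integrable
  · exact (cf.mul hg.continuous).integrable_of_hasCompactSupport hc.mul_left
  · exact (hf.continuous.mul cg).integrable_of_hasCompactSupport sg.mul_left
  · exact (hf.continuous.mul hg.continuous).integrable_of_hasCompactSupport hc.mul_left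
  · intro x _; exact hf.differentiable one_ne_zero x
  · intro x _; exact hg.differentiable one_ne_zero x

def lapC (f : ℂ → ℝ) (z : ℂ) : ℝ :=
  fderiv ℝ (fun y => fderiv ℝ f y 1) z 1 + fderiv ℝ (fun y => fderiv ℝ f y Complex.I) z Complex.I

namespace FS
def q (x : ℂ) (δ : ℝ) (y : ℂ) : ℝ := ‖y - x‖ ^ 2 + δ ^ 2
def LD (x : ℂ) (δ : ℝ) (y : ℂ) : ℝ := 1 / 2 * Real.log (q x δ y)
def DL (x : ℂ) (δ : ℝ) (w y : ℂ) : ℝ := inner ℝ (y - x) w / q x δ y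

variable {x : ℂ} {δ : ℝ}
lemma q_pos (hδ : 0 < δ) (y : ℂ) : 0 < q x δ y := by unfold q; positivity

lemma q_smooth {n : WithTop ℕ∞} : ContDiff ℝ n (q x δ) := by
  unfold q
  exact ((contDiff_id.sub contDiff_const).norm_sq ℝ).add contDiff_const

lemma LD_smooth (hδ : 0 < δ) {n : WithTop ℕ∞} : ContDiff ℝ n (LD x δ) :=
  contDiff_const.mul (q_smooth.log fun y => (q_pos hδ y).ne')

lemma DL_smooth (hδ : 0 < δ) (w : ℂ) {n : WithTop ℕ∞} : ContDiff ℝ n (DL x δ w) :=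
  ContDiff.div ((contDiff_id.sub contDiff_const).inner ℝ contDiff_const) q_smooth fun y => (q_pos hδ y).ne'

lemma q_deriv (y w : ℂ) : HasDerivAt (fun t : ℝ => q x δ (y + t • w)) (2 * inner ℝ (y - x) w) 0 := by
  have h0 : HasDerivAt (fun t : ℝ => y + t • w - x) w 0 := by
    have := (((hasDerivAt_id (0:ℝ)).smul_const w).const_add y).sub_const x
    simpa using this
  have := h0.norm_sq.add_const (δ ^ 2)
  simpa [q] using this

lemma LD_fderiv (hδ : 0 < δ) (y w : ℂ) : fderiv ℝ (LD x δ) y w = DL x δ w y := by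
  have h1 := ((LD_smooth (x := x) hδ (n := 1)).differentiable one_ne_zero y).hasFDerivAt.hasLineDerivAt w
  have h2 : HasLineDerivAt ℝ (LD x δ) (DL x δ w y) y w := by
    have := ((q_deriv (x := x) (δ := δ) y w).log (by have := q_pos (x := x) hδ (y + (0:ℝ) • w); exact this.ne')).const_mul (1/2)
    refine HasDerivAt.congr_deriv this ?_
    simp [DL]; ring
  exact h1.unique h2

lemma DL_fderiv (hδ : 0 < δ) (y w : ℂ) : fderiv ℝ (DL x δ w) y w = ‖w‖ ^ 2 / q x δ y - 2 * inner ℝ (y - x) w ^ 2 / q x δ y ^ 2 := by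
  have h1 := ((DL_smooth (x := x) hδ w (n := 1)).differentiable one_ne_zero y).hasFDerivAt.hasLineDerivAt w
  have h2 : HasLineDerivAt ℝ (DL x δ w) (‖w‖ ^ 2 / q x δ y - 2 * inner ℝ (y - x) w ^ 2 / q x δ y ^ 2) y w := by
    have h0 : HasDerivAt (fun t : ℝ => y + t • w - x) w 0 := by
      have := (((hasDerivAt_id (0:ℝ)).smul_const w).const_add y).sub_const x
      simpa using this
    have hq := q_pos (x := x) hδ (y + (0:ℝ) • w)
    have h3 := (h0.inner ℝ (hasDerivAt_const (0:ℝ) w)).div (q_deriv (x := x) (δ := δ) y w) hq.ne'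
    refine HasDerivAt.congr_deriv h3 ?_
    have hq := q_pos (x := x) hδ y
    simp
    field_simp
  exact h1.unique h2

lemma DL_sum (hδ : 0 < δ) (y : ℂ) : fderiv ℝ (DL x δ 1) y 1 + fderiv ℝ (DL x δ Complex.I) y Complex.I = 2 * δ ^ 2 / q x δ y ^ 2 := by
  have hq := q_pos (x := x) hδ y
  rw [DL_fderiv hδ, DL_fderiv hδ]
  have h1 : inner ℝ (y - x) (1:ℂ) = (y - x).re := by simp [Complex.inner]; try ring
  have h2 : inner ℝ (y - x) Complex.I = (y - x).im := by simp [Complex.inner]; try ring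
  have h3 : q x δ y = (y-x).re ^ 2 + (y-x).im ^ 2 + δ ^ 2 := by
    rw [q, ← Complex.normSq_eq_norm_sq, Complex.normSq_apply]; ring
  rw [h1, h2]
  have : (q x δ y) * (q x δ y) ≠ 0 := by positivity
  simp only [norm_one, Complex.norm_I]
  field_simp
  rw [h3]; ring

lemma part_smooth {f : ℂ → ℝ} (hf : ContDiff ℝ 2 f) (w : ℂ) : ContDiff ℝ 1 (fun y => fderiv ℝ f y w) :=
  (hf.fderiv_right (m := 1) (by norm_num)).clm_apply contDiff_const

lemma lapC_cont {f : ℂ → ℝ} (hf : ContDiff ℝ 2 f) : Continuous (lapC f) :=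
  (((part_smooth hf 1).continuous_fderiv one_ne_zero).clm_apply continuous_const).add
    (((part_smooth hf Complex.I).continuous_fderiv one_ne_zero).clm_apply continuous_const)

lemma lapC_supp {f : ℂ → ℝ} (hc : HasCompactSupport f) : HasCompactSupport (lapC f) :=
  ((hc.fderiv_apply (𝕜 := ℝ) 1).fderiv_apply (𝕜 := ℝ) 1).add ((hc.fderiv_apply (𝕜 := ℝ) Complex.I).fderiv_apply (𝕜 := ℝ) Complex.I)

lemma approx {f : ℂ → ℝ} (hf : ContDiff ℝ 2 f) (hc : HasCompactSupport f) (hδ : 0 < δ) :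
    ∫ y, LD x δ y * lapC f y = ∫ y, 2 * δ ^ 2 / q x δ y ^ 2 * f y := by
  have key : ∀ w : ℂ, ∫ y, LD x δ y * fderiv ℝ (fun y => fderiv ℝ f y w) y w = ∫ y, fderiv ℝ (DL x δ w) y w * f y := by
    intro w
    rw [ibp_cpt volume (LD_smooth hδ) (part_smooth hf w) (hc.fderiv_apply (𝕜 := ℝ) w)]
    simp_rw [LD_fderiv hδ]
    rw [ibp_cpt volume (DL_smooth hδ w) (hf.of_le (by norm_num)) hc, neg_neg]
  have i1 : ∀ w : ℂ, Integrable (fun y => LD x δ y * fderiv ℝ (fun y => fderiv ℝ f y w) y w) := fun w =>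
    ((LD_smooth hδ (n := 1)).continuous.mul (((part_smooth hf w).continuous_fderiv one_ne_zero).clm_apply continuous_const)).integrable_of_hasCompactSupport
      ((hc.fderiv_apply (𝕜 := ℝ) w).fderiv_apply (𝕜 := ℝ) w).mul_left
  have i2 : ∀ w : ℂ, Integrable (fun y => fderiv ℝ (DL x δ w) y w * f y) := fun w =>
    ((((DL_smooth hδ w (n := 1)).continuous_fderiv one_ne_zero).clm_apply continuous_const).mul hf.continuous).integrable_of_hasCompactSupport hc.mul_left
  simp_rw [← DL_sum hδ, lapC, mul_add, add_mul]
  rw [integral_add (i1 _) (i1 _), integral_add (i2 _) (i2 _), key, key]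

lemma log_int {ρ : ℂ → ℝ} (hf : Continuous ρ) (hc : HasCompactSupport ρ) (x : ℂ) : Integrable (fun y => Real.log ‖x - y‖ * ρ y) := by
  obtain ⟨B, hB⟩ := hf.bounded_above_of_compact_support hc
  have hi : Integrable ρ := hf.integrable_of_hasCompactSupport hc
  have hk : Integrable (fun y => sker (x - y)) := ker_integrable.comp_sub_left x
  have hg : Integrable (fun y => ‖x - y‖ * ‖ρ y‖) :=
    ((continuous_const.sub continuous_id).norm.mul hf.norm).integrable_of_hasCompactSupport hc.norm.mul_left
  refine ((hk.const_mul B).add hg).mono' ((by fun_prop : Measurable fun y => Real.log ‖x - y‖).aestronglyMeasurable.mul hf.aestronglyMeasurable) (ae_of_all _ fun y => ?_)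
  rw [norm_mul, Real.norm_eq_abs]
  simp only [Pi.add_apply]
  have h0 := ker_nonneg (x - y)
  have hB0 : 0 ≤ B := (norm_nonneg _).trans (hB y)
  rcases lt_or_ge ‖x - y‖ 1 with h | h
  · have := mul_le_mul (ker_ge_log h) (hB y) (norm_nonneg _) h0
    have : 0 ≤ ‖x - y‖ * ‖ρ y‖ := by positivity
    linarith
  · have h1 : |Real.log ‖x - y‖| ≤ ‖x - y‖ := by
      rw [abs_of_nonneg (Real.log_nonneg h)]
      exact (Real.log_le_sub_one_of_pos (by linarith)).trans (by linarith)
    have := mul_le_mul_of_nonneg_right h1 (norm_nonneg (ρ y))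
    have : 0 ≤ B * sker (x - y) := by positivity
    linarith

lemma lhs_lim {ρ : ℂ → ℝ} (hf : Continuous ρ) (hc : HasCompactSupport ρ) (x : ℂ) :
    Tendsto (fun k : ℕ => ∫ y, LD x (1 / ((k:ℝ) + 1)) y * ρ y) atTop (𝓝 (∫ y, Real.log ‖x - y‖ * ρ y)) := by
  have hd : Integrable (fun y => ‖Real.log ‖x - y‖ * ρ y‖ + ‖LD x 1 y * ρ y‖) :=
    (log_int hf hc x).norm.add (((LD_smooth one_pos (n := 1)).continuous.mul hf).integrable_of_hasCompactSupport hc.mul_left).norm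
  refine tendsto_integral_of_dominated_convergence _ (fun k => ?_) hd (fun k => ?_) ?_
  · exact ((LD_smooth (by positivity) (n := 1)).continuous.mul hf).aestronglyMeasurable
  · filter_upwards [ae_ne x] with y hy
    have h0 : 0 < ‖y - x‖ := norm_pos_iff.2 (sub_ne_zero.2 hy)
    rw [norm_mul, norm_mul, norm_mul, ← add_mul]
    apply mul_le_mul_of_nonneg_right _ (norm_nonneg _)
    have hk : 1 / ((k:ℝ) + 1) ≤ 1 := by rw [div_le_one (by positivity)]; have : (0:ℝ) ≤ k := by positivity
                                        linarith
    have hk0 : 0 < 1 / ((k:ℝ) + 1) := by positivity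
    have e1 : Real.log ‖x - y‖ = 1 / 2 * Real.log (‖y - x‖ ^ 2) := by rw [Real.log_pow, norm_sub_rev]; push_cast; ring
    have h1 : Real.log ‖x - y‖ ≤ LD x (1 / ((k:ℝ) + 1)) y := by
      rw [e1, LD, q]; gcongr; exact le_add_of_nonneg_right (by positivity)
    have h2 : LD x (1 / ((k:ℝ) + 1)) y ≤ LD x 1 y := by
      rw [LD, LD, q, q]; gcongr
    rw [Real.norm_eq_abs, Real.norm_eq_abs, Real.norm_eq_abs, abs_le]
    constructor
    · have := neg_abs_le (Real.log ‖x - y‖); have := abs_nonneg (LD x 1 y); linarith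
    · have := le_abs_self (LD x 1 y); have := abs_nonneg (Real.log ‖x - y‖); linarith
  · filter_upwards [ae_ne x] with y hy
    have h0 : 0 < ‖y - x‖ := norm_pos_iff.2 (sub_ne_zero.2 hy)
    apply Tendsto.mul_const
    have e1 : Real.log ‖x - y‖ = 1 / 2 * Real.log (‖y - x‖ ^ 2 + 0 ^ 2) := by
      rw [zero_pow two_ne_zero, add_zero, Real.log_pow, norm_sub_rev]; push_cast; ring
    rw [e1]
    exact ((((tendsto_one_div_add_atTop_nhds_zero_nat (𝕜 := ℝ)).pow 2).const_add (‖y - x‖ ^ 2)).log (by positivity)).const_mul _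

lemma rhs_eq {f : ℂ → ℝ} (hδ : 0 < δ) : ∫ y, 2 * δ ^ 2 / q x δ y ^ 2 * f y = ∫ z : ℂ, 2 * ((1 + 1 * ‖z‖ ^ 2) ^ 2)⁻¹ * f (x + δ • z) := by
  have h1 := integral_add_left_eq_self (μ := volume) (fun y => 2 * δ ^ 2 / q x δ y ^ 2 * f y) x
  have h2 := Measure.integral_comp_smul (volume : Measure ℂ) (fun y => 2 * δ ^ 2 / q x δ (x + y) ^ 2 * f (x + y)) δ
  rw [← h1]
  rw [Complex.finrank_real_complex, abs_of_pos (by positivity), smul_eq_mul] at h2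
  have h3 : (∫ y, 2 * δ ^ 2 / q x δ (x + y) ^ 2 * f (x + y)) = δ ^ 2 * ∫ y : ℂ, 2 * δ ^ 2 / q x δ (x + δ • y) ^ 2 * f (x + δ • y) := by
    rw [h2]; field_simp
  rw [h3, ← integral_const_mul]
  congr 1; ext z
  have : q x δ (x + δ • z) = δ ^ 2 * (1 + ‖z‖ ^ 2) := by
    rw [q, add_sub_cancel_left, norm_smul, Real.norm_eq_abs, mul_pow, sq_abs]; ring
  rw [this]
  have : 0 < 1 + ‖z‖ ^ 2 := by positivity
  field_simp

lemma rhs_lim {f : ℂ → ℝ} (hf : Continuous f) (hc : HasCompactSupport f) (x : ℂ) :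
    Tendsto (fun k : ℕ => ∫ y, 2 * (1 / ((k:ℝ) + 1)) ^ 2 / q x (1 / ((k:ℝ) + 1)) y ^ 2 * f y) atTop (𝓝 (2 * π * f x)) := by
  obtain ⟨B, hB⟩ := hf.bounded_above_of_compact_support hc
  have hi := bub_int (c := 1) one_pos
  have e : 2 * π * f x = ∫ z : ℂ, 2 * ((1 + 1 * ‖z‖ ^ 2) ^ 2)⁻¹ * f x := by
    rw [integral_mul_const, integral_const_mul, bub_mass one_pos]; ring
  rw [e]
  have e2 : ∀ k : ℕ, ∫ y, 2 * (1 / ((k:ℝ) + 1)) ^ 2 / q x (1 / ((k:ℝ) + 1)) y ^ 2 * f y = ∫ z : ℂ, 2 * ((1 + 1 * ‖z‖ ^ 2) ^ 2)⁻¹ * f (x + (1 / ((k:ℝ) + 1)) • z) :=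
    fun k => rhs_eq (by positivity)
  simp_rw [e2]
  refine tendsto_integral_of_dominated_convergence _ (fun k => ?_) ((hi.const_mul 2).mul_const B) (fun k => ?_) ?_
  · have : Continuous fun z : ℂ => f (x + (1 / ((k:ℝ) + 1)) • z) := hf.comp (by fun_prop)
    exact (by fun_prop : Measurable fun z : ℂ => 2 * ((1 + 1 * ‖z‖ ^ 2) ^ 2)⁻¹).aestronglyMeasurable.mul this.aestronglyMeasurable
  · refine ae_of_all _ fun z => ?_
    rw [norm_mul, Real.norm_eq_abs, abs_of_nonneg (by positivity)]
    exact mul_le_mul_of_nonneg_left (hB _) (by positivity)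
  · refine ae_of_all _ fun z => ?_
    apply Tendsto.const_mul
    have h1 : Tendsto (fun k : ℕ => x + (1 / ((k:ℝ) + 1)) • z) atTop (𝓝 (x + (0:ℝ) • z)) :=
      ((tendsto_one_div_add_atTop_nhds_zero_nat (𝕜 := ℝ)).smul_const z).const_add x
    rw [zero_smul, add_zero] at h1
    exact (hf.tendsto x).comp h1

theorem main {f : ℂ → ℝ} (hf : ContDiff ℝ 2 f) (hc : HasCompactSupport f) (x : ℂ) :
    ∫ y, Real.log ‖x - y‖ * lapC f y = 2 * π * f x := by
  have h1 := lhs_lim (lapC_cont hf) (lapC_supp hc) x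
  have h2 := rhs_lim hf.continuous hc x
  refine tendsto_nhds_unique (h1.congr fun k => ?_) h2
  exact approx hf hc (by positivity)
end FS

lemma part_diff {f : ℂ → ℝ} {z : ℂ} (hf : ContDiffAt ℝ 2 f z) (w : ℂ) : DifferentiableAt ℝ (fun y => fderiv ℝ f y w) z :=
  ((hf.fderiv_right (m := 1) (by norm_num)).clm_apply contDiffAt_const).differentiableAt one_ne_zero

lemma second_mul {f g : ℂ → ℝ} {z : ℂ} (hf : ContDiffAt ℝ 2 f z) (hg : ContDiffAt ℝ 2 g z) (w : ℂ) :
    fderiv ℝ (fun y => fderiv ℝ (fun t => f t * g t) y w) z w =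
      f z * fderiv ℝ (fun y => fderiv ℝ g y w) z w + 2 * (fderiv ℝ f z w * fderiv ℝ g z w) + g z * fderiv ℝ (fun y => fderiv ℝ f y w) z w := by
  have h1 : (fun y => fderiv ℝ (fun t => f t * g t) y w) =ᶠ[𝓝 z] fun y => f y * fderiv ℝ g y w + g y * fderiv ℝ f y w := by
    filter_upwards [hf.eventually (by simp), hg.eventually (by simp)] with y h1 h2
    rw [fderiv_fun_mul (h1.differentiableAt two_ne_zero) (h2.differentiableAt two_ne_zero)]
    simp [smul_eq_mul]
  have df := hf.differentiableAt two_ne_zero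
  have dg := hg.differentiableAt two_ne_zero
  rw [h1.fderiv_eq, fderiv_fun_add (df.fun_mul (part_diff hg w)) (dg.fun_mul (part_diff hf w)), fderiv_fun_mul df (part_diff hg w), fderiv_fun_mul dg (part_diff hf w)]
  simp [smul_eq_mul]; ring

lemma lapC_mul {f g : ℂ → ℝ} {z : ℂ} (hf : ContDiffAt ℝ 2 f z) (hg : ContDiffAt ℝ 2 g z) :
    lapC (fun t => f t * g t) z = f z * lapC g z + 2 * (fderiv ℝ f z 1 * fderiv ℝ g z 1 + fderiv ℝ f z Complex.I * fderiv ℝ g z Complex.I) + g z * lapC f z := by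
  rw [lapC, second_mul hf hg, second_mul hf hg, lapC, lapC]; ring

lemma lapC_congr {f g : ℂ → ℝ} {z : ℂ} (h : f =ᶠ[𝓝 z] g) : lapC f z = lapC g z := by
  have : ∀ w, (fun y => fderiv ℝ f y w) =ᶠ[𝓝 z] fun y => fderiv ℝ g y w := by
    intro w
    filter_upwards [h.fderiv (𝕜 := ℝ)] with y hy
    rw [hy]
  rw [lapC, lapC, (this _).fderiv_eq, (this _).fderiv_eq]

theorem Loc.of_pde {p : ℕ → ℝ} {v : ℕ → ℂ → ℝ} {b : ℝ} {h : ℂ → ℝ} (b0 : 0 < b) (b1 : b ≤ 1 / 2)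
    (hp1 : ∀ n, 1 < p n) (hp : Tendsto p atTop atTop)
    (hC2 : ∀ n, ContDiffOn ℝ 2 (v n) (ball 0 (3 * b)))
    (hpde : ∀ n z, ‖z‖ < 3 * b → lapC (v n) z = -(|v n z| ^ (p n - 1) * v n z))
    (hb0 : ∀ s, 0 < s → ∃ K, ∀ᶠ n in atTop, ∀ x : ℂ, s ≤ ‖x‖ → ‖x‖ ≤ 2 * b → |p n * v n x| ≤ K)
    (hb1 : ∃ K, ∀ᶠ n in atTop, ∀ x : ℂ, b ≤ ‖x‖ → ‖x‖ ≤ 2 * b → ∀ w : ℂ, ‖w‖ = 1 → |p n * fderiv ℝ (v n) x w| ≤ K)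
    (lim : ∀ x : ℂ, 0 < ‖x‖ → ‖x‖ < b → Tendsto (fun n => p n * v n x) atTop (𝓝 (-(4 * √(Real.exp 1)) * Real.log ‖x‖ + h x)))
    (hc : ContinuousAt h 0) : ∃ e L, Loc p v e b L h := by
  have hpi := Real.pi_pos
  let χ : ContDiffBump (0:ℂ) := ⟨b, 2 * b, b0, by linarith⟩
  have hsm : ContDiff ℝ 2 (fun z => χ z) := χ.contDiff
  have hcs : HasCompactSupport (fun z => χ z) := χ.hasCompactSupport
  have hat : ∀ n z, ‖z‖ < 3 * b → ContDiffAt ℝ 2 (v n) z := fun n z hz =>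
    (hC2 n).contDiffAt (isOpen_ball.mem_nhds (by simpa using hz))
  have hzero : ∀ z : ℂ, 2 * b ≤ ‖z‖ → χ z = 0 := fun z hz => χ.zero_of_le_dist (by simpa using hz)
  have hF : ∀ n, ContDiff ℝ 2 (fun z => χ z * v n z) := by
    intro n
    rw [contDiff_iff_contDiffAt]
    intro y
    by_cases hy : ‖y‖ < 3 * b
    · exact hsm.contDiffAt.mul (hat n y hy)
    · have : (fun z => χ z * v n z) =ᶠ[𝓝 y] fun _ => 0 := by
        have : (closedBall (0:ℂ) (2 * b))ᶜ ∈ 𝓝 y := by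
          apply isClosed_closedBall.isOpen_compl.mem_nhds
          simp; linarith
        filter_upwards [this] with z hz
        rw [hzero z (by simp at hz; linarith), zero_mul]
      exact contDiffAt_const.congr_of_eventuallyEq this
  have hFc : ∀ n, HasCompactSupport (fun z => χ z * v n z) := fun n => hcs.mul_right
  have hloc : ∀ n z, ‖z‖ < b → lapC (fun z => χ z * v n z) z = -(|v n z| ^ (p n - 1) * v n z) := by
    intro n z hz
    rw [← hpde n z (by linarith)]
    apply lapC_congr
    have : (ball (0:ℂ) b) ∈ 𝓝 z := isOpen_ball.mem_nhds (by simpa using hz)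
    filter_upwards [this] with y hy
    rw [χ.one_of_mem_closedBall (ball_subset_closedBall hy), one_mul]
  have hout : ∀ n z, 2 * b < ‖z‖ → lapC (fun z => χ z * v n z) z = 0 := by
    intro n z hz
    have : (fun z => χ z * v n z) =ᶠ[𝓝 z] fun _ => 0 := by
      have : (closedBall (0:ℂ) (2 * b))ᶜ ∈ 𝓝 z := by
        apply isClosed_closedBall.isOpen_compl.mem_nhds
        simp; linarith
      filter_upwards [this] with z hz
      rw [hzero z (by simp at hz; linarith), zero_mul]
    rw [lapC_congr this]; simp [lapC]
  set ψ : ℕ → ℂ → ℝ := fun n => (ball (0:ℂ) b)ᶜ.indicator (fun z => p n * lapC (fun z => χ z * v n z) z) with hψ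
  have hdec : ∀ n z, p n * lapC (fun z => χ z * v n z) z = -dns b (p n) (v n) z + ψ n z := by
    intro n z
    by_cases hz : ‖z‖ < b
    · rw [dns_in hz, hloc n z hz]
      have : ψ n z = 0 := by simp only [hψ]; rw [Set.indicator_of_notMem]; simpa using hz
      rw [this]; ring
    · rw [dns_out (not_lt.1 hz)]
      have : ψ n z = p n * lapC (fun z => χ z * v n z) z := by simp only [hψ]; rw [Set.indicator_of_mem]; simpa using hz
      rw [this]; ring
  have hli : ∀ n x, Integrable (fun y => Real.log ‖x - y‖ * (p n * lapC (fun z => χ z * v n z) y)) := fun n x =>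
    FS.log_int (continuous_const.mul (FS.lapC_cont (hF n))) ((FS.lapC_supp (hFc n)).mul_left) x
  have hpl : ∀ n, Continuous (fun z => p n * lapC (fun z => χ z * v n z) z) := fun n => continuous_const.mul (FS.lapC_cont (hF n))
  have hψl : ∀ n x, Integrable (fun y => Real.log ‖x - y‖ * ψ n y) := by
    intro n x
    refine ((hli n x).indicator (measurableSet_ball (x := (0:ℂ)) (ε := b)).compl).congr (ae_of_all _ fun y => ?_)
    by_cases hy : y ∈ (ball (0:ℂ) b)ᶜ
    · simp only [hψ]; rw [Set.indicator_of_mem hy, Set.indicator_of_mem hy]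
    · simp only [hψ]; rw [Set.indicator_of_notMem hy, Set.indicator_of_notMem hy, mul_zero]
  have hdl : ∀ n x, Integrable (fun y => Real.log ‖x - y‖ * dns b (p n) (v n) y) := by
    intro n x
    refine ((hψl n x).sub (hli n x)).congr (ae_of_all _ fun y => ?_)
    simp only [Pi.sub_apply]
    rw [hdec n y]; ring
  obtain ⟨K0, hK0⟩ := hb0 b b0
  obtain ⟨K1, hK1⟩ := hb1
  obtain ⟨C1, hC1⟩ := ((hsm.continuous_fderiv two_ne_zero).clm_apply continuous_const (g := fun _ => (1:ℂ))).bounded_above_of_compact_support (hcs.fderiv_apply (𝕜 := ℝ) 1)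
  obtain ⟨C2, hC2'⟩ := ((hsm.continuous_fderiv two_ne_zero).clm_apply continuous_const (g := fun _ => Complex.I)).bounded_above_of_compact_support (hcs.fderiv_apply (𝕜 := ℝ) Complex.I)
  obtain ⟨C3, hC3⟩ := (FS.lapC_cont hsm).bounded_above_of_compact_support (FS.lapC_supp hcs)
  set B := |K0| + 2 * (|C1| * |K1| + |C2| * |K1|) + |K0| * |C3| with hB
  have hB0 : 0 ≤ B := by positivity
  have hψb : ∀ᶠ n in atTop, ∀ z, |ψ n z| ≤ (closedBall (0:ℂ) (2 * b)).indicator (fun _ => B) z := by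
    filter_upwards [hK0, hK1, hp.eventually_ge_atTop |K0|] with n k0 k1 hpn z
    by_cases hz2 : 2 * b < ‖z‖
    · rw [Set.indicator_of_notMem (by simpa using hz2)]
      have : ψ n z = 0 := by
        simp only [hψ]; rw [Set.indicator_of_mem (by simp; linarith), hout n z hz2, mul_zero]
      rw [this]; simp
    rw [not_lt] at hz2
    rw [Set.indicator_of_mem (by simpa using hz2)]
    by_cases hz : ‖z‖ < b
    · have : ψ n z = 0 := by simp only [hψ]; rw [Set.indicator_of_notMem]; simpa using hz
      rw [this]; simpa using hB0
    rw [not_lt] at hz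
    have e1 : ψ n z = p n * lapC (fun z => χ z * v n z) z := by simp only [hψ]; rw [Set.indicator_of_mem]; simpa using hz
    have hp0 := hp1 n
    have hpv := k0 z hz hz2
    have hv1 : |v n z| ≤ 1 := by
      rw [abs_mul, abs_of_pos (by linarith : 0 < p n)] at hpv
      have : p n * |v n z| ≤ p n * 1 := by rw [mul_one]; exact hpv.trans ((le_abs_self _).trans hpn)
      exact le_of_mul_le_mul_left this (by linarith)
    have a1 : |χ z * (p n * lapC (v n) z)| ≤ |K0| := by
      rw [hpde n z (by linarith), abs_mul, abs_of_nonneg χ.nonneg]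
      have : |p n * -(|v n z| ^ (p n - 1) * v n z)| ≤ |K0| := by
        have : |p n * -(|v n z| ^ (p n - 1) * v n z)| = |v n z| ^ (p n - 1) * |p n * v n z| := by
          rw [mul_neg, abs_neg, mul_left_comm, abs_mul, abs_of_nonneg (by positivity : 0 ≤ |v n z| ^ (p n - 1))]
        rw [this]
        calc _ ≤ 1 * |p n * v n z| := by
              apply mul_le_mul_of_nonneg_right _ (abs_nonneg _)
              exact Real.rpow_le_one (abs_nonneg _) hv1 (by linarith)
          _ ≤ _ := by rw [one_mul]; exact hpv.trans (le_abs_self _)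
      calc _ ≤ 1 * |K0| := mul_le_mul χ.le_one this (abs_nonneg _) (by norm_num)
        _ = _ := one_mul _
    have a2 : |fderiv ℝ (fun z => χ z) z 1 * (p n * fderiv ℝ (v n) z 1)| ≤ |C1| * |K1| := by
      rw [abs_mul]
      exact mul_le_mul ((hC1 z).trans (le_abs_self _)) ((k1 z hz hz2 1 (by simp)).trans (le_abs_self _)) (abs_nonneg _) (abs_nonneg _)
    have a3 : |fderiv ℝ (fun z => χ z) z Complex.I * (p n * fderiv ℝ (v n) z Complex.I)| ≤ |C2| * |K1| := by
      rw [abs_mul]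
      exact mul_le_mul ((hC2' z).trans (le_abs_self _)) ((k1 z hz hz2 Complex.I (by simp)).trans (le_abs_self _)) (abs_nonneg _) (abs_nonneg _)
    have a4 : |(p n * v n z) * lapC (fun z => χ z) z| ≤ |K0| * |C3| := by
      rw [abs_mul]
      exact mul_le_mul (hpv.trans (le_abs_self _)) ((hC3 z).trans (le_abs_self _)) (abs_nonneg _) (abs_nonneg _)
    have e2 : ψ n z = χ z * (p n * lapC (v n) z) + 2 * (fderiv ℝ (fun z => χ z) z 1 * (p n * fderiv ℝ (v n) z 1) + fderiv ℝ (fun z => χ z) z Complex.I * (p n * fderiv ℝ (v n) z Complex.I)) + (p n * v n z) * lapC (fun z => χ z) z := by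
      rw [e1, lapC_mul hsm.contDiffAt (hat n z (by linarith))]; ring
    rw [e2, hB]
    rw [abs_le] at *
    constructor <;> linarith [a1.1, a1.2, a2.1, a2.2, a3.1, a3.2, a4.1, a4.2]
  refine ⟨fun n x => (1 / (2 * π)) * ∫ y, Real.log ‖x - y‖ * ψ n y, 2 * (B * cK + B * volume.real (closedBall (0:ℂ) (2 * b))), ?_⟩
  refine ⟨b0, b1, hp1, hp, fun n => (hC2 n).continuousOn.mono (closedBall_subset_ball (by linarith)),
    fun n => ((hC2 n).mono (ball_subset_ball (by linarith))).of_le (by norm_num), ?_, ?_, ?_, ?_, lim, hc⟩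
  · intro n x hx
    have h1 := FS.main (hF n) (hFc n) x
    rw [χ.one_of_mem_closedBall (by simpa using hx), one_mul] at h1
    have h2 : p n * v n x = 1 / (2 * π) * ∫ y, Real.log ‖x - y‖ * (p n * lapC (fun z => χ z * v n z) y) := by
      have : (∫ y, Real.log ‖x - y‖ * (p n * lapC (fun z => χ z * v n z) y)) = p n * (2 * π * v n x) := by
        rw [← h1, ← integral_const_mul]; congr 1; ext y; ring
      rw [this]; field_simp
    have h3 : (∫ y, Real.log ‖x - y‖ * (p n * lapC (fun z => χ z * v n z) y)) =
        -(∫ y, Real.log ‖x - y‖ * dns b (p n) (v n) y) + ∫ y, Real.log ‖x - y‖ * ψ n y := by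
      rw [← integral_neg, ← integral_add (f := fun y => -(Real.log ‖x - y‖ * dns b (p n) (v n) y)) (hdl n x).neg (hψl n x)]
      congr 1; ext y; rw [hdec n y]; ring
    rw [h2, h3]; ring
  · have := cK_nonneg; positivity
  · filter_upwards [hψb] with n hn x x'
    have hic : Integrable ((closedBall (0:ℂ) (2 * b)).indicator (fun _ => B)) :=
      (integrable_indicator_iff measurableSet_closedBall).2 (integrableOn_const (measure_closedBall_lt_top.ne))
    have hψm : AEStronglyMeasurable (ψ n) := (hpl n).aestronglyMeasurable.indicator measurableSet_ball.compl
    have hψi : Integrable (ψ n) := hic.mono' hψm (ae_of_all _ hn)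
    have hD : Dens (ψ n) B (B * volume.real (closedBall (0:ℂ) (2 * b))) := by
      refine ⟨hψi, fun z => (hn z).trans ?_, ?_⟩
      · exact Set.indicator_le_self' (s := closedBall (0:ℂ) (2 * b)) (f := fun _ => B) (fun _ _ => hB0) z
      · refine (integral_mono hψi.norm hic hn).trans ?_
        rw [integral_indicator measurableSet_closedBall, setIntegral_const, smul_eq_mul, mul_comm]
    have h1 := hD.Pot_lip x x'
    have h2 : 1 / (2 * π) * (∫ y, Real.log ‖x - y‖ * ψ n y) - 1 / (2 * π) * (∫ y, Real.log ‖x' - y‖ * ψ n y) = 1 / (2 * π) * (Pot (ψ n) x - Pot (ψ n) x') := by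
      rw [← mul_sub, ← integral_sub (hψl n x) (hψl n x'), hD.Pot_sub]
      congr 2; ext y; ring
    rw [h2, abs_mul, abs_of_pos (by positivity)]
    exact (mul_le_of_le_one_left (abs_nonneg _) Liou.two_pi_inv).trans h1
  · intro s hs
    obtain ⟨K, hK⟩ := hb0 s hs
    exact ⟨K, hK.mono fun n hn x h1 h2 => hn x h1 (by linarith)⟩

def JJ : ℂ ≃ₗᵢ[ℝ] E2 := Complex.orthonormalBasisOneI.repr

lemma JJ_one : JJ 1 = EuclideanSpace.single 0 1 := by
  have := Complex.orthonormalBasisOneI.repr_self 0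
  simpa [JJ] using this
lemma JJ_I : JJ Complex.I = EuclideanSpace.single 1 1 := by
  have := Complex.orthonormalBasisOneI.repr_self 1
  simpa [JJ] using this

lemma fderiv_JJ (u : E2 → ℝ) (c : E2) (z : ℂ) : fderiv ℝ (fun z => u (c + JJ z)) z = (fderiv ℝ u (c + JJ z)).comp (JJ.toContinuousLinearEquiv : ℂ →L[ℝ] E2) := by
  have h1 := JJ.toContinuousLinearEquiv.comp_right_fderiv (f := fun y => u (c + y)) (x := z)
  rw [fderiv_comp_add_left] at h1
  exact h1

lemma fderiv_JJ_apply (u : E2 → ℝ) (c : E2) (z w : ℂ) : fderiv ℝ (fun z => u (c + JJ z)) z w = fderiv ℝ u (c + JJ z) (JJ w) := by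
  rw [fderiv_JJ]; rfl

lemma lapC_JJ (u : E2 → ℝ) (c : E2) (z : ℂ) : lapC (fun z => u (c + JJ z)) z = lap u (c + JJ z) := by
  have : ∀ w, (fun y => fderiv ℝ (fun z => u (c + JJ z)) y w) = fun y => (fun t => fderiv ℝ u t (JJ w)) (c + JJ y) := by
    intro w; ext y; exact fderiv_JJ_apply u c y w
  rw [lapC, this, this, fderiv_JJ_apply (fun t => fderiv ℝ u t (JJ 1)), fderiv_JJ_apply (fun t => fderiv ℝ u t (JJ Complex.I)), JJ_one, JJ_I, lap, Fin.sum_univ_two]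

lemma G_smooth {Ω : Set E2} (hΩo : IsOpen Ω) (gd : GreenData Ω) {a y : E2} (ha : a ∈ Ω) (hy : y ∈ Ω) :
    ContDiffAt ℝ 3 (gd.H a) y := by
  have h1 : ContDiffAt ℝ (⊤ : ℕ∞) (fun q : E2 × E2 => gd.H q.1 q.2) (a, y) :=
    gd.smoothH.contDiffAt ((hΩo.prod hΩo).mem_nhds ⟨ha, hy⟩)
  have h2 : ContDiffAt ℝ 3 (fun q : E2 × E2 => gd.H q.1 q.2) (a, y) := h1.of_le ENat.LEInfty.out
  exact h2.comp y (contDiffAt_const.prodMk contDiffAt_id : ContDiffAt ℝ 3 (fun y : E2 => (a, y)) y)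

lemma GG_smooth {Ω : Set E2} (hΩo : IsOpen Ω) (gd : GreenData Ω) {a y : E2} (ha : a ∈ Ω) (hy : y ∈ Ω) (hne : y ≠ a) :
    ContDiffAt ℝ 3 (gd.G a) y := by
  have : gd.G a = fun y => -(1 / (2 * π)) * Real.log ‖a - y‖ + gd.H a y := by ext y; exact gd.decomp a y
  rw [this]
  have h0 : a - y ≠ 0 := sub_ne_zero.2 hne.symm
  have h1 : ContDiffAt ℝ 3 (fun y => a - y) y := contDiffAt_const.sub contDiffAt_id
  have h2 : ContDiffAt ℝ 3 (fun y => ‖a - y‖) y := h1.norm ℝ h0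
  exact (contDiffAt_const.mul (h2.log (norm_ne_zero_iff.2 h0))).add (G_smooth hΩo gd ha hy)

lemma conc_bd {S : Set E2} {F : ℕ → E2 → ℝ} {g : E2 → ℝ} (h : TendstoC2LocOn S F g) {K : Set E2} (hK : IsCompact K) (hKS : K ⊆ S)
    {k : ℕ} (hk : k ≤ 2) (hg : ContinuousOn (fun x => iteratedFDeriv ℝ k g x) K) : ∃ C, ∀ᶠ n in atTop, ∀ x ∈ K, ‖iteratedFDeriv ℝ k (F n) x‖ ≤ C := by
  obtain ⟨C, hC⟩ := hK.exists_bound_of_continuousOn hg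
  refine ⟨C + 1, ?_⟩
  have := Metric.tendstoUniformlyOn_iff.1 (h K hKS hK k hk) 1 one_pos
  filter_upwards [this] with n hn x hx
  have h1 := hn x hx
  rw [dist_eq_norm, norm_sub_rev] at h1
  have h2 := norm_le_norm_add_norm_sub' (iteratedFDeriv ℝ k (F n) x) (iteratedFDeriv ℝ k g x)
  have h3 := hC x hx
  linarith

lemma conc_zero {S : Set E2} {F : ℕ → E2 → ℝ} {g : E2 → ℝ} (h : TendstoC2LocOn S F g) {K : Set E2} (hK : IsCompact K) (hKS : K ⊆ S) :
    TendstoUniformlyOn F g atTop K := by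
  have h1 := h K hKS hK 0 (by norm_num)
  rw [Metric.tendstoUniformlyOn_iff] at h1 ⊢
  intro ε hε
  filter_upwards [h1 ε hε] with n hn x hx
  have := hn x hx
  rw [iteratedFDeriv_zero_eq_comp, iteratedFDeriv_zero_eq_comp] at this
  simp only [Function.comp_apply, LinearIsometryEquiv.dist_map] at this
  exact this

theorem Loc.ofE2 {Ω : Set E2} (hΩo : IsOpen Ω) {p : ℕ → ℝ} (hp1 : ∀ n, 1 < p n) (hptop : Tendsto p atTop atTop)
    {u : ℕ → E2 → ℝ} (hsol : ∀ n, IsSolution Ω (p n) (u n)) (gd : GreenData Ω) {c a : E2} (hcΩ : c ∈ Ω) (haΩ : a ∈ Ω) (hca : c ≠ a)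
    (hconc : TendstoC2LocOn (closure Ω \ {c, a}) (fun n x => p n * u n x)
      (fun x => 8 * π * Real.sqrt (Real.exp 1) * (gd.G c x - gd.G a x)))
    {b : ℝ} (b0 : 0 < b) (b1 : b ≤ 1 / 2) (hbΩ : closedBall c (3 * b) ⊆ Ω) (hba : 3 * b < ‖c - a‖) :
    ∃ e L, Loc p (fun n z => u n (c + JJ z)) e b L (fun z => 8 * π * √(Real.exp 1) * (gd.H c (c + JJ z) - gd.G a (c + JJ z))) := by
  have hpi := Real.pi_pos
  have hdist : ∀ z : ℂ, dist (c + JJ z) c = ‖z‖ := by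
    intro z; rw [dist_eq_norm, add_sub_cancel_left, JJ.norm_map]
  have hin : ∀ z : ℂ, ‖z‖ ≤ 3 * b → c + JJ z ∈ Ω := fun z hz => hbΩ (by rw [mem_closedBall, hdist]; exact hz)
  set g : E2 → ℝ := fun x => 8 * π * Real.sqrt (Real.exp 1) * (gd.G c x - gd.G a x) with hg
  have hann : ∀ s, 0 < s → ∃ K, IsCompact K ∧ K ⊆ closure Ω \ {c, a} ∧ K ⊆ Ω \ {c, a} ∧ ∀ z : ℂ, s ≤ ‖z‖ → ‖z‖ ≤ 2 * b → c + JJ z ∈ K := by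
    intro s hs
    have hsub : closedBall c (2 * b) \ ball c s ⊆ Ω \ {c, a} := by
      rintro y ⟨h1, h2⟩
      rw [mem_closedBall] at h1
      rw [mem_ball, not_lt] at h2
      refine ⟨hbΩ (by rw [mem_closedBall]; linarith), ?_⟩
      rintro (h | h)
      · rw [h, dist_self] at h2; linarith
      · rw [Set.mem_singleton_iff.1 h, dist_comm, dist_eq_norm] at h1; linarith
    refine ⟨closedBall c (2 * b) \ ball c s, (isCompact_closedBall _ _).diff isOpen_ball, fun y hy => ⟨subset_closure (hsub hy).1, (hsub hy).2⟩, hsub, ?_⟩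
    intro z h1 h2
    refine ⟨by rw [mem_closedBall, hdist]; exact h2, ?_⟩
    rw [mem_ball, hdist]; linarith
  have hgs : ∀ y ∈ Ω \ {c, a}, ContDiffAt ℝ 3 g y := by
    rintro y ⟨hy, hne⟩
    have h1 : y ≠ c := fun h => hne (Or.inl h)
    have h2 : y ≠ a := fun h => hne (Or.inr h)
    exact contDiffAt_const.mul ((GG_smooth hΩo gd hcΩ hy h1).sub (GG_smooth hΩo gd haΩ hy h2))
  have hgk : ∀ k : ℕ, k ≤ 2 → ∀ y ∈ Ω \ {c, a}, ContinuousAt (fun x => iteratedFDeriv ℝ k g x) y := by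
    intro k hk y hy
    have : ContDiffAt ℝ 0 (fun x => iteratedFDeriv ℝ k g x) y := (hgs y hy).iteratedFDeriv_right (by
      rw [zero_add]; exact_mod_cast (by omega : k ≤ 3))
    exact this.continuousAt
  have hdiff : ∀ n, ∀ z : ℂ, ‖z‖ ≤ 3 * b → ContDiffAt ℝ 2 (u n) (c + JJ z) := fun n z hz => (hsol n).1.contDiffAt (hΩo.mem_nhds (hin z hz))
  refine Loc.of_pde b0 b1 hp1 hptop ?_ ?_ ?_ ?_ ?_ ?_
  · intro n
    refine (hsol n).1.comp ((contDiff_const.add JJ.contDiff).contDiffOn) ?_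
    intro z hz; exact hin z (by simpa using (mem_ball.1 hz).le)
  · intro n z hz
    rw [lapC_JJ]
    have := (hsol n).2.2.1 _ (hin z hz.le)
    linarith
  · intro s hs
    obtain ⟨K, hK, hK1, hK2, hK3⟩ := hann s hs
    obtain ⟨C, hC⟩ := conc_bd hconc hK hK1 (k := 0) (by norm_num) (fun y hy => (hgk 0 (by norm_num) y (hK2 hy)).continuousWithinAt)
    refine ⟨C, hC.mono fun n hn x h1 h2 => ?_⟩
    have := hn _ (hK3 x h1 h2)
    rwa [norm_iteratedFDeriv_zero] at this
  · obtain ⟨K, hK, hK1, hK2, hK3⟩ := hann b b0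
    obtain ⟨C, hC⟩ := conc_bd hconc hK hK1 (k := 1) (by norm_num) (fun y hy => (hgk 1 (by norm_num) y (hK2 hy)).continuousWithinAt)
    refine ⟨C, hC.mono fun n hn x h1 h2 w hw => ?_⟩
    have := hn _ (hK3 x h1 h2)
    rw [norm_iteratedFDeriv_one, fderiv_const_mul ((hdiff n x (by linarith)).differentiableAt two_ne_zero)] at this
    rw [fderiv_JJ_apply]
    have h3 := (p n • fderiv ℝ (u n) (c + JJ x)).le_opNorm (JJ w)
    rw [JJ.norm_map, hw, mul_one] at h3
    exact h3.trans this
  · intro x hx hxb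
    obtain ⟨K, hK, hK1, hK2, hK3⟩ := hann ‖x‖ hx
    have h1 := (conc_zero hconc hK hK1).tendsto_at (hK3 x le_rfl (by linarith))
    have h2 : g (c + JJ x) = -(4 * √(Real.exp 1)) * Real.log ‖x‖ + 8 * π * √(Real.exp 1) * (gd.H c (c + JJ x) - gd.G a (c + JJ x)) := by
      simp only [hg]
      rw [gd.decomp c, sub_add_cancel_left, norm_neg, JJ.norm_map]
      field_simp; ring
    rw [← h2]; exact h1
  · have hc0 : c + JJ 0 = c := by simp
    have hT : ContinuousAt (fun z => c + JJ z) (0:ℂ) := (continuous_const.add JJ.continuous).continuousAt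
    have h1 : ContinuousAt (fun z => gd.H c (c + JJ z)) (0:ℂ) :=
      ContinuousAt.comp (g := gd.H c) (by rw [hc0]; exact (G_smooth hΩo gd hcΩ hcΩ).continuousAt) hT
    have h2 : ContinuousAt (fun z => gd.G a (c + JJ z)) (0:ℂ) :=
      ContinuousAt.comp (g := gd.G a) (by rw [hc0]; exact (GG_smooth hΩo gd haΩ hcΩ hca).continuousAt) hT
    exact continuousAt_const.mul (h1.sub h2)

namespace EI

def mm (t : ℝ) : ℝ := max 0 (min 1 (|t| - 1))
lemma mm_cont : Continuous mm := by unfold mm; fun_prop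
lemma mm_nonneg (t : ℝ) : 0 ≤ mm t := le_max_left _ _
lemma mm_le (t : ℝ) : mm t ≤ 1 := max_le zero_le_one (min_le_left _ _)
lemma mm_one {t : ℝ} (h : 2 ≤ |t|) : mm t = 1 := by
  unfold mm; rw [min_eq_left (by linarith)]; simp
lemma mm_zero {t : ℝ} (h : |t| ≤ 1) : mm t = 0 := by
  unfold mm; apply max_eq_left; exact (min_le_right _ _).trans (by linarith)
lemma mm_mono {s t : ℝ} (h : |s| ≤ |t|) : mm s ≤ mm t := by
  unfold mm; exact max_le_max le_rfl (min_le_min le_rfl (by linarith))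

def phi (s : ℝ) : ℝ := ∫ t in (0:ℝ)..s, mm t
lemma phi_deriv (s : ℝ) : HasDerivAt phi (mm s) s :=
  intervalIntegral.integral_hasDerivAt_right (mm_cont.intervalIntegrable _ _) (mm_cont.stronglyMeasurableAtFilter _ _) mm_cont.continuousAt
lemma phi_zero {s : ℝ} (h : |s| ≤ 1) : phi s = 0 := by
  unfold phi
  rw [intervalIntegral.integral_congr (g := fun _ => 0), intervalIntegral.integral_zero]
  intro t ht
  apply mm_zero
  rw [Set.mem_uIcc] at ht
  rw [abs_le] at h ⊢
  rcases ht with ht | ht <;> constructor <;> linarith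

lemma phi_sub (s : ℝ) : |phi s - s| ≤ 2 := by
  have hsm : ∀ s : ℝ, |s| ≤ 2 → |phi s - s| ≤ 2 := by
    intro s hs
    have e : phi s - s = ∫ t in (0:ℝ)..s, (mm t - 1) := by
      rw [intervalIntegral.integral_sub (mm_cont.intervalIntegrable _ _) (by simp), phi]; simp
    have := intervalIntegral.norm_integral_le_of_norm_le_const (a := 0) (b := s) (C := 1) (f := fun t => mm t - 1) (fun t _ => by
      rw [Real.norm_eq_abs, abs_le]; have := mm_nonneg t; have := mm_le t; constructor <;> linarith)
    rw [e]; rw [Real.norm_eq_abs, one_mul, sub_zero] at this; linarith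
  have hadd : ∀ a s : ℝ, phi s = phi a + ∫ t in a..s, mm t := by
    intro a s
    exact (intervalIntegral.integral_add_adjacent_intervals (mm_cont.intervalIntegrable _ _) (mm_cont.intervalIntegrable _ _)).symm
  rcases le_or_gt |s| 2 with h | h
  · exact hsm s h
  rcases lt_abs.1 h with h | h
  · have h1 : ∫ t in (2:ℝ)..s, mm t = s - 2 := by
      rw [intervalIntegral.integral_congr (g := fun _ => 1)]
      · simp
      · intro t ht
        rw [Set.uIcc_of_le h.le] at ht
        exact mm_one (ht.1.trans (le_abs_self _))
    have h2 := hsm 2 (by norm_num)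
    rw [hadd 2 s, h1]
    have : phi 2 + (s - 2) - s = phi 2 - 2 := by ring
    rw [this]; exact h2
  · have h1 : ∫ t in (-2:ℝ)..s, mm t = s - (-2) := by
      rw [intervalIntegral.integral_congr (g := fun _ => 1)]
      · simp
      · intro t ht
        rw [Set.uIcc_of_ge (by linarith)] at ht
        exact mm_one (by have := neg_abs_le t; linarith [ht.2])
    have h2 := hsm (-2) (by norm_num)
    rw [hadd (-2) s, h1]
    have : phi (-2) + (s - (-2)) - s = phi (-2) - (-2) := by ring
    rw [this]; exact h2

def psi (ε t : ℝ) : ℝ := ε * phi (t / ε)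
variable {ε : ℝ}
lemma psi_deriv (hε : 0 < ε) (t : ℝ) : HasDerivAt (psi ε) (mm (t / ε)) t := by
  have := ((phi_deriv (t / ε)).comp t ((hasDerivAt_id t).div_const ε)).const_mul ε
  refine this.congr_deriv ?_
  field_simp
lemma psi_smooth (hε : 0 < ε) : ContDiff ℝ 1 (psi ε) := by
  rw [contDiff_one_iff_deriv]
  refine ⟨fun t => (psi_deriv hε t).differentiableAt, ?_⟩
  have : deriv (psi ε) = fun t => mm (t / ε) := by ext t; exact (psi_deriv hε t).deriv
  rw [this]; exact mm_cont.comp (by fun_prop)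
lemma psi_zero (hε : 0 < ε) {t : ℝ} (h : |t| ≤ ε) : psi ε t = 0 := by
  rw [psi, phi_zero, mul_zero]
  rw [abs_div, abs_of_pos hε, div_le_one hε]; exact h
lemma psi_sub (hε : 0 < ε) (t : ℝ) : |psi ε t - t| ≤ 2 * ε := by
  have h1 := phi_sub (t / ε)
  have : psi ε t - t = ε * (phi (t / ε) - t / ε) := by rw [psi]; field_simp
  rw [this, abs_mul, abs_of_pos hε]
  nlinarith

lemma norm_sq_dual (ℓ : E2 →L[ℝ] ℝ) : ‖ℓ‖ ^ 2 = ∑ i : Fin 2, ℓ (EuclideanSpace.single i 1) ^ 2 := by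
  set v := (InnerProductSpace.toDual ℝ E2).symm ℓ with hv
  have h1 : ‖v‖ = ‖ℓ‖ := (InnerProductSpace.toDual ℝ E2).symm.norm_map ℓ
  have h2 : ∀ i, ℓ (EuclideanSpace.single i 1) = v i := by
    intro i
    rw [← InnerProductSpace.toDual_symm_apply, ← hv, EuclideanSpace.inner_single_right]; simp
  rw [← h1, EuclideanSpace.norm_sq_eq]
  simp [h2]

/-- The gradient vanishes a.e. on the zero set. -/
lemma grad_zero {Ω : Set E2} (hΩo : IsOpen Ω) {u : E2 → ℝ} (hu : ContDiffOn ℝ 2 u Ω) :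
    ∀ᵐ x ∂(volume.restrict Ω), u x = 0 → fderiv ℝ u x = 0 := by
  set s := Ω ∩ u ⁻¹' {0} with hs
  have hsm : MeasurableSet s := by
    obtain ⟨V, hV, hV2⟩ := (continuousOn_iff_isClosed.1 hu.continuousOn) {0} isClosed_singleton
    have : s = V ∩ Ω := by rw [hs, Set.inter_comm, hV2]
    rw [this]; exact hV.measurableSet.inter hΩo.measurableSet
  set e0 : E2 := EuclideanSpace.single 0 1 with he0
  have hap : ApproximatesLinearOn (fun x => u x • e0) (0 : E2 →L[ℝ] E2) s 0 := by
    intro x hx y hy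
    have h1 : u x = 0 := hx.2
    have h2 : u y = 0 := hy.2
    simp [h1, h2]
  have hd : ∀ x ∈ s, HasFDerivWithinAt (fun x => u x • e0) ((fderiv ℝ u x).smulRight e0) s x := by
    intro x hx
    have := ((hu.contDiffAt (hΩo.mem_nhds hx.1)).differentiableAt two_ne_zero).hasFDerivAt
    exact (this.smul_const e0).hasFDerivWithinAt
  have h1 := hap.norm_fderiv_sub_le volume hsm _ hd
  rw [ae_restrict_iff' hsm] at h1
  rw [ae_restrict_iff' hΩo.measurableSet]
  filter_upwards [h1] with x hx hxΩ hux
  have h2 := hx ⟨hxΩ, hux⟩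
  rw [sub_zero] at h2
  have h3 : fderiv ℝ u x = 0 ∨ e0 = 0 := by simpa using h2
  have : e0 ≠ 0 := by rw [he0]; simp
  exact h3.resolve_right this

section
variable {Ω : Set E2} {p : ℝ} {u : E2 → ℝ}

def W (Ω : Set E2) (u : E2 → ℝ) (ε : ℝ) (i : Fin 2) : E2 → ℝ :=
  Ω.indicator fun x => psi ε (u x) * fderiv ℝ u x (EuclideanSpace.single i 1)

lemma K_props (hΩo : IsOpen Ω) (hΩb : IsBounded Ω) (hs : IsSolution Ω p u) (hε : 0 < ε) :
    ∃ K, IsCompact K ∧ K ⊆ Ω ∧ ∀ x ∈ Ω, x ∉ K → |u x| < ε := by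
  have hcl : IsCompact (closure Ω) := hΩb.isCompact_closure
  refine ⟨closure Ω ∩ (fun x => |u x|) ⁻¹' (Set.Ici ε), ?_, ?_, ?_⟩
  · exact hcl.of_isClosed_subset (hs.2.1.abs.preimage_isClosed_of_isClosed isClosed_closure isClosed_Ici) Set.inter_subset_left
  · rintro x ⟨h1, h2⟩
    by_contra hx
    have : x ∈ frontier Ω := by rw [hΩo.frontier_eq]; exact ⟨h1, hx⟩
    have := hs.2.2.2 x this
    simp [this] at h2; linarith
  · intro x hx hK
    by_contra h
    exact hK ⟨subset_closure hx, not_lt.1 h⟩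

lemma part_at (hΩo : IsOpen Ω) (hs : IsSolution Ω p u) {x : E2} (hx : x ∈ Ω) (i : Fin 2) :
    ContDiffAt ℝ 1 (fun x => fderiv ℝ u x (EuclideanSpace.single i 1)) x :=
  ((hs.1.contDiffAt (hΩo.mem_nhds hx)).fderiv_right (m := 1) (by norm_num)).clm_apply contDiffAt_const

lemma W_eq (hΩo : IsOpen Ω) {x : E2} (hx : x ∈ Ω) (i : Fin 2) : W Ω u ε i =ᶠ[𝓝 x] fun x => psi ε (u x) * fderiv ℝ u x (EuclideanSpace.single i 1) := by
  filter_upwards [hΩo.mem_nhds hx] with y hy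
  rw [W, Set.indicator_of_mem hy]

lemma W_zero (hε : 0 < ε) {K : Set E2} (hK : IsCompact K) (hK2 : ∀ x ∈ Ω, x ∉ K → |u x| < ε) {x : E2} (hx : x ∉ K) (i : Fin 2) : W Ω u ε i =ᶠ[𝓝 x] fun _ => 0 := by
  filter_upwards [hK.isClosed.isOpen_compl.mem_nhds hx] with y hy
  by_cases h : y ∈ Ω
  · rw [W, Set.indicator_of_mem h, psi_zero hε (hK2 y h hy).le, zero_mul]
  · rw [W, Set.indicator_of_notMem h]

lemma W_smooth (hΩo : IsOpen Ω) (hΩb : IsBounded Ω) (hs : IsSolution Ω p u) (hε : 0 < ε) (i : Fin 2) : ContDiff ℝ 1 (W Ω u ε i) ∧ HasCompactSupport (W Ω u ε i) := by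
  obtain ⟨K, hK, hK1, hK2⟩ := K_props hΩo hΩb hs hε
  constructor
  · rw [contDiff_iff_contDiffAt]
    intro x
    by_cases hx : x ∈ Ω
    · refine ContDiffAt.congr_of_eventuallyEq ?_ (W_eq hΩo hx i)
      have h1 : ContDiffAt ℝ 1 u x := (hs.1.contDiffAt (hΩo.mem_nhds hx)).of_le (by norm_num)
      exact ((psi_smooth hε).contDiffAt.comp x h1).mul (part_at hΩo hs hx i)
    · exact contDiffAt_const.congr_of_eventuallyEq (W_zero hε hK hK2 (fun h => hx (hK1 h)) i)
  · refine HasCompactSupport.intro hK fun x hx => ?_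
    exact (W_zero hε hK hK2 hx i).eq_of_nhds

lemma W_fderiv (hΩo : IsOpen Ω) (hs : IsSolution Ω p u) (hε : 0 < ε) {x : E2} (hx : x ∈ Ω) (i : Fin 2) :
    fderiv ℝ (W Ω u ε i) x (EuclideanSpace.single i 1) = mm (u x / ε) * fderiv ℝ u x (EuclideanSpace.single i 1) ^ 2 +
      psi ε (u x) * fderiv ℝ (fun y => fderiv ℝ u y (EuclideanSpace.single i 1)) x (EuclideanSpace.single i 1) := by
  rw [(W_eq hΩo hx i).fderiv_eq]
  have h1 := ((hs.1.contDiffAt (hΩo.mem_nhds hx)).differentiableAt two_ne_zero).hasFDerivAt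
  have h2 := (psi_deriv hε (u x)).comp_hasFDerivAt x h1
  have h3 := ((part_at hΩo hs hx i).differentiableAt one_ne_zero).hasFDerivAt
  have h4 := h2.mul h3
  have e : fderiv ℝ (fun x => psi ε (u x) * fderiv ℝ u x (EuclideanSpace.single i 1)) x = _ := h4.fderiv
  rw [e]
  simp [smul_eq_mul]; ring

lemma W_out (hΩo : IsOpen Ω) (hΩb : IsBounded Ω) (hs : IsSolution Ω p u) (hε : 0 < ε) {x : E2} (hx : x ∉ Ω) (i : Fin 2) :
    fderiv ℝ (W Ω u ε i) x = 0 := by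
  obtain ⟨K, hK, hK1, hK2⟩ := K_props hΩo hΩb hs hε
  rw [(W_zero hε hK hK2 (fun h => hx (hK1 h)) i).fderiv_eq]; simp

lemma fu_int (hΩb : IsBounded Ω) (hp : 1 < p) (hs : IsSolution Ω p u) (θ : ℝ → ℝ) (hθ : Continuous θ) :
    IntegrableOn (fun x => θ (u x) * (|u x| ^ (p - 1) * u x)) Ω := by
  have hcl : IsCompact (closure Ω) := hΩb.isCompact_closure
  refine IntegrableOn.mono_set (ContinuousOn.integrableOn_compact hcl ?_) subset_closure
  refine (hθ.comp_continuousOn hs.2.1).mul (ContinuousOn.mul ?_ hs.2.1)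
  exact hs.2.1.abs.rpow_const fun x _ => Or.inr (by linarith)

lemma ident (hΩo : IsOpen Ω) (hΩb : IsBounded Ω) (hp : 1 < p) (hs : IsSolution Ω p u) (hε : 0 < ε) :
    IntegrableOn (fun x => mm (u x / ε) * ‖fderiv ℝ u x‖ ^ 2) Ω ∧
    ∫ x in Ω, mm (u x / ε) * ‖fderiv ℝ u x‖ ^ 2 = ∫ x in Ω, psi ε (u x) * (|u x| ^ (p - 1) * u x) := by
  have hW := fun i => W_smooth hΩo hΩb hs hε i
  have hc : ∀ i : Fin 2, Continuous fun x => fderiv ℝ (W Ω u ε i) x (EuclideanSpace.single i 1) := fun i =>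
    ((hW i).1.continuous_fderiv one_ne_zero).clm_apply continuous_const
  have hi : ∀ i : Fin 2, Integrable fun x => fderiv ℝ (W Ω u ε i) x (EuclideanSpace.single i 1) := fun i =>
    (hc i).integrable_of_hasCompactSupport ((hW i).2.fderiv_apply (𝕜 := ℝ) _)
  have h0 : ∀ i : Fin 2, ∫ x in Ω, fderiv ℝ (W Ω u ε i) x (EuclideanSpace.single i 1) = 0 := by
    intro i
    rw [setIntegral_eq_integral_of_forall_compl_eq_zero (fun x hx => by rw [W_out hΩo hΩb hs hε hx]; simp)]
    have := ibp_cpt (E := E2) volume (f := fun _ => (1:ℝ)) contDiff_const (hW i).1 (hW i).2 (EuclideanSpace.single i 1)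
    simpa using this
  have hf := fu_int hΩb hp hs (psi ε) (psi_smooth hε).continuous
  have hpt : ∀ x ∈ Ω, mm (u x / ε) * ‖fderiv ℝ u x‖ ^ 2 = (∑ i : Fin 2, fderiv ℝ (W Ω u ε i) x (EuclideanSpace.single i 1)) + psi ε (u x) * (|u x| ^ (p - 1) * u x) := by
    intro x hx
    have h1 := hs.2.2.1 x hx
    rw [← h1, norm_sq_dual, lap, Fin.sum_univ_two, Fin.sum_univ_two, Fin.sum_univ_two, W_fderiv hΩo hs hε hx, W_fderiv hΩo hs hε hx]
    ring
  have hsum : IntegrableOn (fun x => ∑ i : Fin 2, fderiv ℝ (W Ω u ε i) x (EuclideanSpace.single i 1)) Ω := integrable_finsetSum _ fun i _ => (hi i).integrableOn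
  constructor
  · exact (integrableOn_congr_fun hpt hΩo.measurableSet).2 (hsum.add hf)
  · rw [setIntegral_congr_fun hΩo.measurableSet hpt, integral_add hsum hf, integral_finsetSum _ fun i _ => (hi i).integrableOn]
    simp [h0]

theorem main (hΩo : IsOpen Ω) (hΩb : IsBounded Ω) (hp : 1 < p) (hs : IsSolution Ω p u) :
    ∫ x in Ω, ‖fderiv ℝ u x‖ ^ 2 = ∫ x in Ω, |u x| ^ (p + 1) := by
  have hε : ∀ k : ℕ, 0 < 1 / ((k:ℝ) + 1) := fun k => by positivity
  have hfd : ContinuousOn (fun x => fderiv ℝ u x) Ω := hs.1.continuousOn_fderiv_of_isOpen hΩo (by norm_num)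
  have hmeas : AEStronglyMeasurable (fun x => ‖fderiv ℝ u x‖ ^ 2) (volume.restrict Ω) := (hfd.norm.pow 2).aestronglyMeasurable hΩo.measurableSet
  have hA : IntegrableOn (fun x => |u x| ^ (p + 1)) Ω ∧ ∀ x, u x * (|u x| ^ (p - 1) * u x) = |u x| ^ (p + 1) := by
    have e : ∀ x, u x * (|u x| ^ (p - 1) * u x) = |u x| ^ (p + 1) := by
      intro x
      rcases eq_or_ne (u x) 0 with h | h
      · rw [h]; simp [Real.zero_rpow (by linarith : p + 1 ≠ 0)]
      · have h0 : 0 < |u x| := abs_pos.2 h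
        have : u x * (|u x| ^ (p - 1) * u x) = |u x| ^ (p - 1) * |u x| ^ (2:ℝ) := by
          rw [Real.rpow_two, sq_abs]; ring
        rw [this, ← Real.rpow_add h0]; congr 1; ring
    refine ⟨?_, e⟩
    exact (fu_int hΩb hp hs id continuous_id).congr (ae_of_all _ fun x => e x)
  -- right side limit
  have hR : Tendsto (fun k : ℕ => ∫ x in Ω, psi (1 / ((k:ℝ) + 1)) (u x) * (|u x| ^ (p - 1) * u x)) atTop (𝓝 (∫ x in Ω, |u x| ^ (p + 1))) := by
    have hf1 := fu_int hΩb hp hs (fun t => |t| + 2) (by fun_prop)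
    refine tendsto_integral_of_dominated_convergence (fun x => ‖(|u x| + 2) * (|u x| ^ (p - 1) * u x)‖) (fun k => ?_) hf1.norm (fun k => ?_) ?_
    · exact (fu_int hΩb hp hs (psi _) (psi_smooth (hε k)).continuous).aestronglyMeasurable
    · refine ae_of_all _ fun x => ?_
      rw [norm_mul (psi (1 / ((k:ℝ) + 1)) (u x)), norm_mul (|u x| + 2)]
      apply mul_le_mul_of_nonneg_right _ (norm_nonneg _)
      have h1 := psi_sub (hε k) (u x)
      have h2 : 1 / ((k:ℝ) + 1) ≤ 1 := by
        rw [div_le_one (by positivity)]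
        have : (0:ℝ) ≤ k := by positivity
        linarith
      rw [Real.norm_eq_abs, Real.norm_eq_abs, abs_of_nonneg (by positivity : 0 ≤ |u x| + 2)]
      have h3 := abs_sub_abs_le_abs_sub (psi (1 / ((k:ℝ) + 1)) (u x)) (u x)
      linarith
    · refine ae_of_all _ fun x => ?_
      rw [← hA.2 x]
      apply Tendsto.mul_const
      rw [tendsto_iff_norm_sub_tendsto_zero]
      have := (tendsto_one_div_add_atTop_nhds_zero_nat (𝕜 := ℝ)).const_mul 2
      rw [mul_zero] at this
      exact squeeze_zero (fun k => norm_nonneg _) (fun k => psi_sub (hε k) (u x)) this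
  have hnn : 0 ≤ ∫ x in Ω, |u x| ^ (p + 1) := integral_nonneg fun x => by positivity
  -- left side limit
  have hL : Tendsto (fun k : ℕ => ∫⁻ x in Ω, ENNReal.ofReal (mm (u x / (1 / ((k:ℝ) + 1))) * ‖fderiv ℝ u x‖ ^ 2)) atTop
      (𝓝 (∫⁻ x in Ω, ENNReal.ofReal (‖fderiv ℝ u x‖ ^ 2))) := by
    apply lintegral_tendsto_of_tendsto_of_monotone
    · intro k
      exact ((ident hΩo hΩb hp hs (hε k)).1.aestronglyMeasurable.aemeasurable).ennreal_ofReal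
    · refine ae_of_all _ fun x => ?_
      intro k l hkl
      apply ENNReal.ofReal_le_ofReal
      apply mul_le_mul_of_nonneg_right _ (by positivity)
      apply mm_mono
      rw [div_div_eq_mul_div, div_div_eq_mul_div, div_one, div_one, abs_mul, abs_mul]
      apply mul_le_mul_of_nonneg_left _ (abs_nonneg _)
      have : (k:ℝ) ≤ l := by exact_mod_cast hkl
      rw [abs_of_nonneg (by positivity), abs_of_nonneg (by positivity)]; linarith
    · filter_upwards [grad_zero hΩo hs.1] with x hx
      apply (ENNReal.continuous_ofReal.tendsto _).comp
      rcases eq_or_ne (u x) 0 with h | h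
      · rw [hx h]; simp
      · apply tendsto_const_nhds.congr'
        have h0 : 0 < |u x| := abs_pos.2 h
        have h1 : ∀ᶠ k : ℕ in atTop, 2 / |u x| ≤ (k:ℝ) := tendsto_natCast_atTop_atTop.eventually_ge_atTop _
        filter_upwards [h1] with k hk
        rw [mm_one, one_mul]
        rw [div_div_eq_mul_div, div_one, abs_mul, abs_of_nonneg (by positivity : (0:ℝ) ≤ k + 1)]
        rw [div_le_iff₀ h0] at hk
        nlinarith
  have hE : ∀ k : ℕ, ∫⁻ x in Ω, ENNReal.ofReal (mm (u x / (1 / ((k:ℝ) + 1))) * ‖fderiv ℝ u x‖ ^ 2) = ENNReal.ofReal (∫ x in Ω, psi (1 / ((k:ℝ) + 1)) (u x) * (|u x| ^ (p - 1) * u x)) := by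
    intro k
    have := ident hΩo hΩb hp hs (hε k)
    rw [← this.2, ofReal_integral_eq_lintegral_ofReal this.1 (ae_of_all _ fun x => mul_nonneg (mm_nonneg _) (by positivity))]
  simp_rw [hE] at hL
  have hfin := tendsto_nhds_unique hL ((ENNReal.continuous_ofReal.tendsto _).comp hR)
  rw [integral_eq_lintegral_of_nonneg_ae (ae_of_all _ fun x => by positivity) hmeas, hfin, ENNReal.toReal_ofReal hnn]
end
end EI

lemma neg_sol {Ω : Set E2} {p : ℝ} {u : E2 → ℝ} (h : IsSolution Ω p u) : IsSolution Ω p (fun x => - u x) := by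
  obtain ⟨h1, h2, h3, h4⟩ := h
  refine ⟨h1.neg, h2.neg, fun x hx => ?_, fun x hx => by simp [h4 x hx]⟩
  have e1 : lap (fun x => - u x) x = - lap u x := by
    unfold lap
    rw [← Finset.sum_neg_distrib]
    refine Finset.sum_congr rfl fun i _ => ?_
    have : (fun y => fderiv ℝ (fun x => - u x) y (EuclideanSpace.single i 1)) = fun y => -(fderiv ℝ u y (EuclideanSpace.single i 1)) := by
      funext y; rw [fderiv_fun_neg]; rfl
    rw [this, fderiv_fun_neg]; rfl
  rw [e1, abs_neg]
  have := h3 x hx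
  linarith

lemma neg_conc {S : Set E2} {F : ℕ → E2 → ℝ} {g : E2 → ℝ} (h : TendstoC2LocOn S F g) :
    TendstoC2LocOn S (fun n x => - F n x) (fun x => - g x) := by
  intro K hK hKc k hk
  have := (h K hK hKc k hk).neg
  have e : ∀ f : E2 → ℝ, (fun x => iteratedFDeriv ℝ k (fun x => - f x) x) = fun x => - iteratedFDeriv ℝ k f x := by
    intro f; funext x; exact iteratedFDeriv_neg_apply
  rw [e g]
  have e2 : (fun n x => iteratedFDeriv ℝ k (fun x => - F n x) x) = fun n x => - iteratedFDeriv ℝ k (F n) x := by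
    funext n; exact e (F n)
  rw [e2]
  exact this

lemma A_transfer (f : E2 → ℝ) (c : E2) (b : ℝ) : ∫ z in ball (0:ℂ) b, f (c + JJ z) = ∫ x in ball c b, f x := by
  have h1 : MeasurePreserving (fun z : ℂ => c + JJ z) volume volume :=
    (measurePreserving_add_left volume c).comp JJ.measurePreserving
  have h2 : MeasurableEmbedding (fun z : ℂ => c + JJ z) :=
    (JJ.toHomeomorph.trans (Homeomorph.addLeft c)).measurableEmbedding
  have h3 := h1.setIntegral_preimage_emb h2 f (ball c b)
  rw [← h3]
  congr 2
  ext z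
  simp [dist_eq_norm]

lemma final_arith {p S E : ℕ → ℝ} {K : ℝ} (hp1 : ∀ n, 1 < p n) (hptop : Tendsto p atTop atTop)
    (hT : Tendsto (fun n => p n * (S n / (8 * π * Real.exp 1) - 2) + 4 * Real.log (p n)) atTop
      (𝓝 (-2 + 12 * Real.log 2 + 8 * π * K)))
    (hE : ∀ n, E n = (1 / 2 - 1 / (p n + 1)) * (S n / p n)) :
    Tendsto (fun n => (p n) ^ 2 * (E n - (8 * π * Real.exp 1 / p n
            + (8 * π * Real.exp 1 / (p n) ^ 2) * (-2 * Real.log (p n) + 6 * Real.log 2 - 3)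
            + (32 * π ^ 2 * Real.exp 1 / (p n) ^ 2) * K))) atTop (𝓝 0) := by
  set T := fun n => p n * (S n / (8 * π * Real.exp 1) - 2) + 4 * Real.log (p n) with hTd
  have hi : Tendsto (fun n => (p n + 1)⁻¹) atTop (𝓝 0) :=
    tendsto_inv_atTop_zero.comp (tendsto_atTop_add_const_right _ _ hptop)
  have hl : Tendsto (fun n => Real.log (p n) / p n) atTop (𝓝 0) := by
    have := Real.isLittleO_log_id_atTop.tendsto_div_nhds_zero.comp hptop
    exact this
  have hl2 : Tendsto (fun n => Real.log (p n) / p n * (1 - (p n + 1)⁻¹)) atTop (𝓝 0) := by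
    have := hl.mul (hi.const_sub 1)
    rw [zero_mul] at this
    exact this
  have hlim : Tendsto (fun n => 8 * π * Real.exp 1 * (T n / 2 - 2 * (1 - (p n + 1)⁻¹) - (T n * (p n + 1)⁻¹ - 4 * (Real.log (p n) / p n * (1 - (p n + 1)⁻¹))) - 6 * Real.log 2 + 3 - 4 * π * K)) atTop
      (𝓝 (8 * π * Real.exp 1 * ((-2 + 12 * Real.log 2 + 8 * π * K) / 2 - 2 * (1 - 0) - ((-2 + 12 * Real.log 2 + 8 * π * K) * 0 - 4 * 0) - 6 * Real.log 2 + 3 - 4 * π * K))) := by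
    refine Tendsto.const_mul _ ?_
    refine Tendsto.sub_const (Tendsto.add_const _ (Tendsto.sub_const (Tendsto.sub (Tendsto.sub (hT.div_const 2) ((hi.const_sub 1).const_mul 2)) ?_) _)) _
    exact (hT.mul hi).sub (hl2.const_mul 4)
  have e0 : 8 * π * Real.exp 1 * ((-2 + 12 * Real.log 2 + 8 * π * K) / 2 - 2 * (1 - 0) - ((-2 + 12 * Real.log 2 + 8 * π * K) * 0 - 4 * 0) - 6 * Real.log 2 + 3 - 4 * π * K) = 0 := by ring
  rw [e0] at hlim
  refine hlim.congr fun n => ?_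
  have hp0 : p n ≠ 0 := by linarith [hp1 n]
  have hp2 : p n + 1 ≠ 0 := by linarith [hp1 n]
  have hpi := Real.pi_pos.ne'
  have he := (Real.exp_pos 1).ne'
  rw [hE n]
  simp only [hTd]
  field_simp
  ring

lemma u_int {Ω : Set E2} (hΩb : IsBounded Ω) {p : ℝ} (hp : 1 < p) {u : E2 → ℝ} (h : IsSolution Ω p u) :
    IntegrableOn (fun x => |u x| ^ (p + 1)) Ω := by
  have hc : IsCompact (closure Ω) := hΩb.isCompact_closure
  refine IntegrableOn.mono_set ?_ (subset_closure (s := Ω))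
  exact (h.2.1.abs.rpow_const (fun x _ => Or.inr (by linarith))).integrableOn_compact hc

lemma out_bound {Ω : Set E2} (hΩb : IsBounded Ω) {p : ℕ → ℝ} (hp1 : ∀ n, 1 < p n) (hptop : Tendsto p atTop atTop)
    {u : ℕ → E2 → ℝ} (gd : GreenData Ω) {xP xM : E2} (hxP : xP ∈ Ω) (hxM : xM ∈ Ω)
    (hconc : TendstoC2LocOn (closure Ω \ {xP, xM}) (fun n x => p n * u n x)
      (fun x => 8 * π * Real.sqrt (Real.exp 1) * (gd.G xP x - gd.G xM x)))
    {b : ℝ} (b0 : 0 < b) :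
    Tendsto (fun n => p n * (p n * ∫ x in Ω \ (ball xP b ∪ ball xM b), |u n x| ^ (p n + 1))) atTop (𝓝 0) := by
  set K := closure Ω \ (ball xP b ∪ ball xM b) with hK
  have hKc : IsCompact K := hΩb.isCompact_closure.diff (isOpen_ball.union isOpen_ball)
  have hne : ∀ x ∈ K, x ≠ xP ∧ x ≠ xM := by
    rintro x ⟨_, hx⟩
    refine ⟨fun h => hx (Or.inl ?_), fun h => hx (Or.inr ?_)⟩ <;> rw [h] <;> exact mem_ball_self b0
  have hKS : K ⊆ closure Ω \ {xP, xM} := by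
    intro x hx
    refine ⟨hx.1, ?_⟩
    have := hne x hx
    simp [this.1, this.2]
  have hG : ∀ a ∈ Ω, (∀ x ∈ K, x ≠ a) → ContinuousOn (gd.G a) K := by
    intro a ha hx
    have : gd.G a = fun y => -(1 / (2 * π)) * Real.log ‖a - y‖ + gd.H a y := by
      funext y; exact gd.decomp a y
    rw [this]
    refine ContinuousOn.add (ContinuousOn.mul continuousOn_const (ContinuousOn.log (by fun_prop) ?_)) ((gd.contH a ha).mono fun x hx => hx.1)
    intro x hxK
    exact norm_ne_zero_iff.2 (sub_ne_zero.2 (hx x hxK).symm)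
  have hgc : ContinuousOn (fun x => 8 * π * Real.sqrt (Real.exp 1) * (gd.G xP x - gd.G xM x)) K :=
    continuousOn_const.mul ((hG xP hxP fun x hx => (hne x hx).1).sub (hG xM hxM fun x hx => (hne x hx).2))
  obtain ⟨C, hC⟩ := hKc.exists_bound_of_continuousOn hgc
  set D := |C| + 1 with hD
  have hD0 : 0 < D := by positivity
  have hu := conc_zero hconc hKc hKS
  rw [Metric.tendstoUniformlyOn_iff] at hu
  have hub : ∀ᶠ n in atTop, ∀ x ∈ K, |p n * u n x| ≤ D := by
    filter_upwards [hu 1 one_pos] with n hn x hx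
    have h1 := hn x hx
    have h2 := hC x hx
    rw [dist_comm, Real.dist_eq] at h1
    rw [Real.norm_eq_abs] at h2
    have h3 := abs_sub_abs_le_abs_sub (p n * u n x) (8 * π * Real.sqrt (Real.exp 1) * (gd.G xP x - gd.G xM x))
    have := le_abs_self C
    linarith
  set V := volume.real (Ω \ (ball xP b ∪ ball xM b)) with hV
  have hVf : volume (Ω \ (ball xP b ∪ ball xM b)) < ⊤ := (hΩb.subset Set.sdiff_subset).measure_lt_top
  have hl : Tendsto (fun n => D ^ 3 * V * (p n)⁻¹) atTop (𝓝 0) := by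
    have := (tendsto_inv_atTop_zero.comp hptop).const_mul (D ^ 3 * V)
    rw [mul_zero] at this
    exact this
  refine squeeze_zero' (Eventually.of_forall fun n => ?_) ?_ hl
  · have := hp1 n
    have : 0 ≤ ∫ x in Ω \ (ball xP b ∪ ball xM b), |u n x| ^ (p n + 1) := integral_nonneg fun x => by positivity
    positivity
  · filter_upwards [hub, hptop.eventually_ge_atTop (max D 2)] with n hn hpn
    have hp0 : 0 < p n := by linarith [hp1 n]
    have hpD : D ≤ p n := le_trans (le_max_left _ _) hpn
    have hp2 : 2 ≤ p n := le_trans (le_max_right _ _) hpn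
    have hb : ∀ x ∈ Ω \ (ball xP b ∪ ball xM b), ‖|u n x| ^ (p n + 1)‖ ≤ (D / p n) ^ 3 := by
      intro x hx
      have h1 := hn x ⟨subset_closure hx.1, hx.2⟩
      rw [abs_mul, abs_of_pos hp0] at h1
      have h2 : |u n x| ≤ D / p n := by rw [le_div_iff₀ hp0]; linarith
      rw [Real.norm_of_nonneg (by positivity)]
      calc |u n x| ^ (p n + 1) ≤ (D / p n) ^ (p n + 1) := by gcongr
        _ ≤ (D / p n) ^ (3:ℝ) := by
          apply Real.rpow_le_rpow_of_exponent_ge (by positivity) _ (by linarith)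
          rw [div_le_one hp0]; exact hpD
        _ = (D / p n) ^ 3 := by norm_cast
    have h3 := norm_setIntegral_le_of_norm_le_const hVf hb
    have h4 : ∫ x in Ω \ (ball xP b ∪ ball xM b), |u n x| ^ (p n + 1) ≤ (D / p n) ^ 3 * V := le_trans (le_abs_self _) h3
    calc p n * (p n * ∫ x in Ω \ (ball xP b ∪ ball xM b), |u n x| ^ (p n + 1)) ≤ p n * (p n * ((D / p n) ^ 3 * V)) := by gcongr
      _ = D ^ 3 * V * (p n)⁻¹ := by field_simp

/-- Corollary 1.5: sharp asymptotic expansion of the energy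
`J_p(u_p)` for low energy nodal solutions. -/
theorem energy_sharp_expansion
    (Ω : Set E2) (hΩo : IsOpen Ω) (hΩb : IsBounded Ω) (hΩne : Ω.Nonempty)
    (p : ℕ → ℝ) (hp1 : ∀ n, 1 < p n) (hptop : Tendsto p atTop atTop)
    (u : ℕ → E2 → ℝ)
    (hsol : ∀ n, IsSolution Ω (p n) (u n))
    (hnod : ∀ n, IsNodal Ω (u n))
    (hlow : Tendsto (fun n => p n * ∫ x in Ω, |u n x| ^ (p n + 1)) atTop
      (𝓝 (16 * π * Real.exp 1)))
    (gd : GreenData Ω) (xP xM : E2) (hxP : xP ∈ Ω) (hxM : xM ∈ Ω) (hPM : xP ≠ xM)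
    (hconc : TendstoC2LocOn (closure Ω \ {xP, xM})
      (fun n x => p n * u n x)
      (fun x => 8 * π * Real.sqrt (Real.exp 1) * (gd.G xP x - gd.G xM x)))
    :
    Tendsto (fun n => (p n) ^ 2 *
        (energy Ω (p n) (u n) -
          (8 * π * Real.exp 1 / p n
            + (8 * π * Real.exp 1 / (p n) ^ 2) *
                (-2 * Real.log (p n) + 6 * Real.log 2 - 3)
            + (32 * π ^ 2 * Real.exp 1 / (p n) ^ 2) * KR gd (xP, xM))))
      atTop (𝓝 0) := by
  obtain ⟨b, b0, b1, hbP, hbM, hb3⟩ : ∃ b : ℝ, 0 < b ∧ b ≤ 1 / 2 ∧ closedBall xP (3 * b) ⊆ Ω ∧ closedBall xM (3 * b) ⊆ Ω ∧ 3 * b < ‖xP - xM‖ := by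
    obtain ⟨r1, hr1, h1⟩ := Metric.nhds_basis_closedBall.mem_iff.1 (hΩo.mem_nhds hxP)
    obtain ⟨r2, hr2, h2⟩ := Metric.nhds_basis_closedBall.mem_iff.1 (hΩo.mem_nhds hxM)
    have h3 : 0 < ‖xP - xM‖ := norm_pos_iff.2 (sub_ne_zero.2 hPM)
    refine ⟨min (min (r1 / 3) (r2 / 3)) (min (1 / 2) (‖xP - xM‖ / 6)), by positivity, ?_, ?_, ?_, ?_⟩
    · exact (min_le_right _ _).trans (min_le_left _ _)
    · refine (closedBall_subset_closedBall ?_).trans h1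
      have := (min_le_left (min (r1 / 3) (r2 / 3)) (min (1 / 2) (‖xP - xM‖ / 6))).trans (min_le_left _ _)
      linarith
    · refine (closedBall_subset_closedBall ?_).trans h2
      have := (min_le_left (min (r1 / 3) (r2 / 3)) (min (1 / 2) (‖xP - xM‖ / 6))).trans (min_le_right _ _)
      linarith
    · have := (min_le_right (min (r1 / 3) (r2 / 3)) (min (1 / 2) (‖xP - xM‖ / 6))).trans (min_le_right _ _)
      linarith
  have hconc' : TendstoC2LocOn (closure Ω \ {xM, xP}) (fun n x => p n * (fun x => - u n x) x)
      (fun x => 8 * π * Real.sqrt (Real.exp 1) * (gd.G xM x - gd.G xP x)) := by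
    have h := neg_conc hconc
    rw [Set.pair_comm] at h
    have e1 : (fun n x => p n * (fun x => - u n x) x) = fun n x => -(p n * u n x) := by
      funext n x; simp
    have e2 : (fun x => 8 * π * Real.sqrt (Real.exp 1) * (gd.G xM x - gd.G xP x)) = fun x => -(8 * π * Real.sqrt (Real.exp 1) * (gd.G xP x - gd.G xM x)) := by
      funext x; ring
    rw [e1, e2]; exact h
  obtain ⟨eP, LP, HP⟩ := Loc.ofE2 hΩo hp1 hptop hsol gd hxP hxM hPM hconc b0 b1 hbP hb3
  obtain ⟨eM, LM, HM⟩ := Loc.ofE2 hΩo hp1 hptop (fun n => neg_sol (hsol n)) gd hxM hxP hPM.symm hconc' b0 b1 hbM (by rw [norm_sub_rev]; exact hb3)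
  set AP := Loc.A p (fun n z => u n (xP + JJ z)) b with hAP
  set AM := Loc.A p (fun n z => - u n (xM + JJ z)) b with hAM
  set AO := fun n => p n * ∫ x in Ω \ (ball xP b ∪ ball xM b), |u n x| ^ (p n + 1) with hAO
  have hO := out_bound hΩb hp1 hptop gd hxP hxM hconc b0
  have eAP : ∀ n, AP n = p n * ∫ x in ball xP b, |u n x| ^ (p n + 1) := by
    intro n
    rw [hAP, Loc.A, ← A_transfer (fun x => |u n x| ^ (p n + 1)) xP b]
  have eAM : ∀ n, AM n = p n * ∫ x in ball xM b, |u n x| ^ (p n + 1) := by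
    intro n
    rw [hAM, Loc.A, ← A_transfer (fun x => |u n x| ^ (p n + 1)) xM b]
    simp only [abs_neg]
  have hsubP : ball xP b ⊆ Ω := ((ball_subset_ball (by linarith)).trans ball_subset_closedBall).trans hbP
  have hsubM : ball xM b ⊆ Ω := ((ball_subset_ball (by linarith)).trans ball_subset_closedBall).trans hbM
  have hdisj : Disjoint (ball xP b) (ball xM b) := by
    apply ball_disjoint_ball
    rw [dist_eq_norm]; linarith
  have hsum : ∀ n, p n * ∫ x in Ω, |u n x| ^ (p n + 1) = AP n + AM n + AO n := by
    intro n
    have hi := u_int hΩb (hp1 n) (hsol n)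
    have h1 := setIntegral_union (μ := volume) (f := fun x => |u n x| ^ (p n + 1)) (s := ball xP b ∪ ball xM b) (t := Ω \ (ball xP b ∪ ball xM b)) Set.disjoint_sdiff_right
      (hΩo.measurableSet.diff (measurableSet_ball.union measurableSet_ball)) (hi.mono_set (Set.union_subset hsubP hsubM)) (hi.mono_set Set.sdiff_subset)
    rw [Set.union_sdiff_cancel (Set.union_subset hsubP hsubM)] at h1
    have h2 := setIntegral_union (μ := volume) (f := fun x => |u n x| ^ (p n + 1)) hdisj measurableSet_ball (hi.mono_set hsubP) (hi.mono_set hsubM)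
    rw [h1, h2, eAP, eAM, hAO]
    ring
  have hnn : ∀ (n : ℕ) (s : Set E2), 0 ≤ p n * ∫ x in s, |u n x| ^ (p n + 1) := by
    intro n s
    have := hp1 n
    have : 0 ≤ ∫ x in s, |u n x| ^ (p n + 1) := integral_nonneg fun x => by positivity
    positivity
  have hAP0 : ∀ n, 0 ≤ AP n := fun n => by rw [eAP]; exact hnn n _
  have hAM0 : ∀ n, 0 ≤ AM n := fun n => by rw [eAM]; exact hnn n _
  have hAO0 : ∀ n, 0 ≤ AO n := fun n => hnn n _
  have hup : ∀ᶠ n in atTop, AP n + AM n + AO n ≤ 16 * π * Real.exp 1 + 1 := by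
    filter_upwards [hlow.eventually (ge_mem_nhds (show 16 * π * Real.exp 1 < 16 * π * Real.exp 1 + 1 by linarith))] with n hn
    rw [← hsum n]; exact hn
  have hcP : ∀ᶠ n in atTop, AP n ≤ 16 * π * Real.exp 1 + 1 := by
    filter_upwards [hup] with n hn
    linarith [hAM0 n, hAO0 n]
  have hcM : ∀ᶠ n in atTop, AM n ≤ 16 * π * Real.exp 1 + 1 := by
    filter_upwards [hup] with n hn
    linarith [hAP0 n, hAO0 n]
  have hlP := HP.A_lower hcP one_pos
  have hlM := HM.A_lower hcM one_pos
  have hnum : 16 * π * Real.exp 1 + 1 - (8 * π * √(Real.exp 1) - 1) ≤ 32 * π := by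
    have h1 := Real.exp_one_lt_d9
    have h2 := sqrt_e_bd
    have h3 := Real.pi_gt_three
    nlinarith [h2.1, mul_pos Real.pi_pos (sub_pos.2 h1), mul_pos Real.pi_pos (sub_pos.2 h2.1)]
  have huP : ∀ᶠ n in atTop, AP n ≤ 32 * π := by
    filter_upwards [hup, hlM] with n h1 h2
    have h2' : 8 * π * √(Real.exp 1) - 1 ≤ AM n := h2
    linarith [hAO0 n]
  have huM : ∀ᶠ n in atTop, AM n ≤ 32 * π := by
    filter_upwards [hup, hlP] with n h1 h2
    have h2' : 8 * π * √(Real.exp 1) - 1 ≤ AP n := h2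
    linarith [hAO0 n]
  have hmP : Tendsto (fun n => p n * (AP n / (8 * π * Real.exp 1) - 1) + 2 * Real.log (p n)) atTop _ := HP.main huP
  have hmM : Tendsto (fun n => p n * (AM n / (8 * π * Real.exp 1) - 1) + 2 * Real.log (p n)) atTop _ := HM.main huM
  have hT : Tendsto (fun n => p n * ((AP n + AM n + AO n) / (8 * π * Real.exp 1) - 2) + 4 * Real.log (p n)) atTop
      (𝓝 (-2 + 12 * Real.log 2 + 8 * π * KR gd (xP, xM))) := by
    have h := (hmP.add hmM).add (hO.div_const (8 * π * Real.exp 1))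
    have hs : √(Real.exp 1) ≠ 0 := (Real.sqrt_pos.2 (Real.exp_pos 1)).ne'
    have e : (-1 + 6 * Real.log 2 - 8 * π * √(Real.exp 1) * (gd.H xP (xP + JJ 0) - gd.G xM (xP + JJ 0)) / √(Real.exp 1)) +
        (-1 + 6 * Real.log 2 - 8 * π * √(Real.exp 1) * (gd.H xM (xM + JJ 0) - gd.G xP (xM + JJ 0)) / √(Real.exp 1)) + 0 / (8 * π * Real.exp 1)
        = -2 + 12 * Real.log 2 + 8 * π * KR gd (xP, xM) := by
      rw [map_zero, add_zero, add_zero, KR, gd.symm xM xP]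
      field_simp
      ring
    rw [e] at h
    refine h.congr fun n => ?_
    simp only [hAO]
    ring
  refine final_arith hp1 hptop hT fun n => ?_
  have hp0 : p n ≠ 0 := by linarith [hp1 n]
  rw [energy, EI.main hΩo hΩb (hp1 n) (hsol n), ← hsum n]
  field_simp

end
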